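/- arXiv:2403.01959 — 5 statements merged into one kernel-verified Lean document; each statement's English description precedes it below -/
import Mathlib

section
/- Let N > 1 and c ∈ ℝ with c + 1 > 0, and set 2* = 2(N+1)/(N−1). Then there exists a constant C > 0 such that for every u ∈ C_c^∞(cl(ℝ^{N+1}_+)) one has ‖u‖_{L^{2*}_c} ≤ C (∫_{ℝ^{N+1}_+} y^{−2c/(N+1)} |∇u(x,y)|² y^c dx dy)^{1/2}. -/
open MeasureTheory Real

noncomputable section

/-- The upper half-space `ℝ^{N+1}_+`. -/
def HS (N : ℕ) : Set ((Fin N → ℝ) × ℝ) := {z | 0 < z.2}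

/-- Partial derivative of `u` in the `i`-th `x` direction. -/
def pX {N : ℕ} (u : ((Fin N → ℝ) × ℝ) → ℝ) (i : Fin N) (z : (Fin N → ℝ) × ℝ) : ℝ :=
  fderiv ℝ u z (Pi.single i 1, 0)

/-- Partial derivative of `u` in the `y` direction. -/
def pY {N : ℕ} (u : ((Fin N → ℝ) × ℝ) → ℝ) (z : (Fin N → ℝ) × ℝ) : ℝ :=
  fderiv ℝ u z (0, 1)

/-- Euclidean norm of the full gradient `∇u`. -/
def gradNorm {N : ℕ} (u : ((Fin N → ℝ) × ℝ) → ℝ) (z : (Fin N → ℝ) × ℝ) : ℝ :=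
  Real.sqrt ((∑ i, pX u i z ^ 2) + pY u z ^ 2)

open Set Function ENNReal

lemma hs_lintegral (N : ℕ) (f : (Fin N → ℝ) × ℝ → ℝ≥0∞) (hf : Measurable f) :
    ∫⁻ z in HS N, f z = ∫⁻ y in Ioi (0:ℝ), ∫⁻ x : Fin N → ℝ, f (x, y) := by
  have h : HS N = (univ : Set (Fin N → ℝ)) ×ˢ Ioi (0:ℝ) := by
    ext z; simp [HS]
  rw [h, Measure.volume_eq_prod, ← Measure.prod_restrict, Measure.restrict_univ,
    lintegral_prod_symm _ hf.aemeasurable]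

lemma hs_measurable (N : ℕ) : MeasurableSet (HS N) :=
  measurableSet_lt measurable_const measurable_snd

lemma ftc_bound (g g' : ℝ → ℝ) (a R : ℝ) (h : ∀ s, a ≤ s → HasDerivAt g (g' s) s)
    (hc : ContinuousOn g' (Ici a)) (hR : ∀ s, R ≤ s → g s = 0) :
    ‖g a‖ₑ ≤ ∫⁻ s in Ioi a, ‖g' s‖ₑ := by
  set b := max a R with hb
  have hab : a ≤ b := le_max_left _ _
  have hgb : g b = 0 := hR _ (le_max_right _ _)
  have hsub : uIcc a b ⊆ Ici a := by
    rw [uIcc_of_le hab]; exact fun x hx => hx.1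
  have h1 : ∫ s in a..b, g' s = g b - g a := by
    apply intervalIntegral.integral_eq_sub_of_hasDerivAt
    · intro s hs; exact h s (hsub hs)
    · exact (hc.mono hsub).intervalIntegrable
  have h2 : ‖g a‖ₑ = ‖∫ s in a..b, g' s‖ₑ := by
    rw [h1, hgb]; simp
  rw [h2, intervalIntegral.integral_of_le hab]
  refine (enorm_integral_le_lintegral_enorm _).trans ?_
  exact lintegral_mono_set (fun x hx => hx.1)

lemma gagliardo (N : ℕ) (hN : 1 ≤ N) (F h : (Fin N → ℝ) × ℝ → ℝ≥0∞) (hF : Measurable F)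
    (h1 : ∀ x y j, h (x, y) ≤ ∫⁻ t, F (update x j t, y))
    (h2 : ∀ x y, h (x, y) ≤ ∫⁻ s, F (x, s)) :
    ∫⁻ z, h z ^ (1 + 1 / (N : ℝ)) ≤ (∫⁻ z, F z) ^ (1 + 1 / (N : ℝ)) := by
  have hN0 : (0:ℝ) < N := by exact_mod_cast hN
  let e : (Fin (N+1) → ℝ) ≃ᵐ (Fin N → ℝ) × ℝ :=
    (MeasurableEquiv.piFinSuccAbove (fun _ => ℝ) (Fin.last N)).trans MeasurableEquiv.prodComm
  have he : MeasurePreserving e volume volume :=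
    (volume_preserving_piFinSuccAbove (fun _ => ℝ) (Fin.last N)).trans
      Measure.measurePreserving_swap
  have hev : ∀ v, e v = (fun j => v (Fin.castSucc j), v (Fin.last N)) := by
    intro v
    ext j
    · simp [e, MeasurableEquiv.piFinSuccAbove, MeasurableEquiv.prodComm, Fin.init]
    · simp [e, MeasurableEquiv.piFinSuccAbove, MeasurableEquiv.prodComm]
  rw [he.lintegral_map_equiv, he.lintegral_map_equiv]
  have hconj : Real.HolderConjugate (Fintype.card (Fin (N+1))) (1 + 1 / (N:ℝ)) := by
    rw [Real.holderConjugate_iff]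
    simp only [Fintype.card_fin]; push_cast
    constructor
    · linarith
    · field_simp; ring
  have key := lintegral_prod_lintegral_pow_le (fun _ : Fin (N+1) => (volume : Measure ℝ)) hconj
    (f := fun v => F (e v)) (hF.comp e.measurable)
  refine le_trans (lintegral_mono ?_) key
  intro v
  simp only [Fintype.card_fin]; push_cast
  rw [add_sub_cancel_right]
  have h3 : ∀ i : Fin (N+1), h (e v) ≤ ∫⁻ t, F (e (update v i t)) := by
    intro i
    refine Fin.lastCases ?_ (fun j => ?_) i
    · have : ∀ t, e (update v (Fin.last N) t) = ((e v).1, t) := by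
        intro t; rw [hev, hev]; ext j
        · simp [(Fin.castSucc_lt_last j).ne]
        · simp
      simp_rw [this]
      exact h2 _ _
    · have : ∀ t, e (update v j.castSucc t) = (update (e v).1 j t, (e v).2) := by
        intro t; rw [hev, hev]; ext k
        · by_cases hk : k = j
          · subst hk; simp
          · simp [hk]
        · simp [(Fin.castSucc_lt_last j).ne']
      simp_rw [this]
      exact h1 _ _ _
  calc h (e v) ^ (1 + 1 / (N:ℝ)) = ∏ _i : Fin (N+1), h (e v) ^ (1 / (N:ℝ)) := by
        rw [Finset.prod_const, Finset.card_univ, Fintype.card_fin, ← ENNReal.rpow_natCast,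
          ← ENNReal.rpow_mul]
        congr 1; push_cast; field_simp
    _ ≤ _ := by
        apply Finset.prod_le_prod' 
        intro i _
        exact ENNReal.rpow_le_rpow (h3 i) (by positivity)

lemma scale_lintegral (N : ℕ) (f : (Fin N → ℝ) → ℝ≥0∞) (hf : Measurable f) (x : Fin N → ℝ)
    (s : ℝ) (hs : 0 < s) :
    ∫⁻ ξ : Fin N → ℝ, f (x + s • ξ) = ENNReal.ofReal ((s ^ N)⁻¹) * ∫⁻ ξ : Fin N → ℝ, f ξ := by
  have h1 : ∫⁻ ξ : Fin N → ℝ, f (x + s • ξ) =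
      ∫⁻ η, f (x + η) ∂(Measure.map (fun ξ : Fin N → ℝ => s • ξ) volume) := by
    rw [lintegral_map (by fun_prop) (by fun_prop)]
  rw [h1]
  have := Measure.map_addHaar_smul (volume : Measure (Fin N → ℝ)) hs.ne'
  erw [this]
  rw [lintegral_smul_measure, lintegral_add_left_eq_self (fun η => f η) x]
  simp [abs_of_pos hs]

lemma rpow_lintegral (c s : ℝ) (hc : -1 < c) (hs : 0 < s) :
    ∫⁻ y in Ioo 0 s, ENNReal.ofReal (y ^ c) = ENNReal.ofReal (s ^ (c + 1) / (c + 1)) := by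
  rw [← ofReal_integral_eq_lintegral_ofReal]
  · rw [← integral_Ioc_eq_integral_Ioo, ← intervalIntegral.integral_of_le hs.le,
      integral_rpow (Or.inl hc)]
    rw [Real.zero_rpow (by linarith)]; simp
  · exact (intervalIntegral.integrableOn_Ioo_rpow_iff hs).2 hc
  · filter_upwards [ae_restrict_mem measurableSet_Ioo] with y hy
    exact Real.rpow_nonneg hy.1.le _

lemma swap_lintegral (a b : ℝ → ℝ≥0∞) (ha : Measurable a) (hb : Measurable b) :
    ∫⁻ y in Ioi (0:ℝ), a y * ∫⁻ s in Ioi y, b s =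
      ∫⁻ s in Ioi (0:ℝ), (∫⁻ y in Ioo 0 s, a y) * b s := by
  have hm : Measurable (fun p : ℝ × ℝ => {p : ℝ × ℝ | 0 < p.1 ∧ p.1 < p.2}.indicator
      (fun p => a p.1 * b p.2) p) := by
    apply Measurable.indicator (by fun_prop)
    exact (measurableSet_lt measurable_const measurable_fst).inter
      (measurableSet_lt measurable_fst measurable_snd)
  have e1 : ∫⁻ y in Ioi (0:ℝ), a y * ∫⁻ s in Ioi y, b s = ∫⁻ y, ∫⁻ s,
      {p : ℝ × ℝ | 0 < p.1 ∧ p.1 < p.2}.indicator (fun p => a p.1 * b p.2) (y, s) := by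
    rw [← lintegral_indicator measurableSet_Ioi]
    congr 1; ext y
    by_cases hy : 0 < y
    · rw [indicator_of_mem (by exact hy), ← lintegral_const_mul _ hb,
        ← lintegral_indicator measurableSet_Ioi]
      congr 1; ext s
      by_cases hs : y < s <;> simp [hy, hs]
    · simp [hy]
  have e2 : ∫⁻ s in Ioi (0:ℝ), (∫⁻ y in Ioo 0 s, a y) * b s = ∫⁻ s, ∫⁻ y,
      {p : ℝ × ℝ | 0 < p.1 ∧ p.1 < p.2}.indicator (fun p => a p.1 * b p.2) (y, s) := by
    rw [← lintegral_indicator measurableSet_Ioi]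
    congr 1; ext s
    by_cases hs : 0 < s
    · rw [indicator_of_mem (by exact hs), ← lintegral_mul_const _ ha,
        ← lintegral_indicator measurableSet_Ioo]
      congr 1
    · rw [indicator_of_notMem (by exact hs)]
      symm
      rw [lintegral_eq_zero_iff (by fun_prop)]
      filter_upwards with y
      exact indicator_of_notMem (fun hh => hs (hh.1.trans hh.2)) _
  rw [e1, e2, lintegral_lintegral_swap]
  exact hm.aemeasurable

lemma holder_aux {α : Type*} [MeasurableSpace α] (μ : Measure α) (r : ℝ) (hr : 0 < r)
    (g m n : α → ℝ≥0∞) (hg : AEMeasurable g μ) (hm : AEMeasurable m μ) (hn : AEMeasurable n μ)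
    (hmn : ∀ᵐ a ∂μ, m a ^ r * n a = 1) :
    (∫⁻ a, g a ∂μ) ^ (1 + r) ≤ (∫⁻ a, g a * m a ∂μ) ^ r * ∫⁻ a, g a * n a ∂μ := by
  have h := ENNReal.lintegral_mul_norm_pow_le (μ := μ) (f := fun a => g a * m a)
    (g := fun a => g a * n a) (hg.mul hm) (hg.mul hn) (p := r / (1 + r)) (q := 1 / (1 + r))
    (by positivity) (by positivity) (by field_simp; ring)
  have e : ∫⁻ a, g a ∂μ = ∫⁻ a, (g a * m a) ^ (r / (1 + r)) * (g a * n a) ^ (1 / (1 + r)) ∂μ := by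
    apply lintegral_congr_ae
    filter_upwards [hmn] with a ha
    rw [ENNReal.mul_rpow_of_nonneg _ _ (by positivity), ENNReal.mul_rpow_of_nonneg _ _ (by positivity)]
    have : r / (1 + r) = r * (1 / (1 + r)) := by ring
    calc g a = g a ^ (r / (1 + r) + 1 / (1 + r)) * (m a ^ r * n a) ^ (1 / (1 + r)) := by
          rw [ha]
          have : r / (1 + r) + 1 / (1 + r) = 1 := by field_simp; ring
          rw [this]; simp
      _ = _ := by
          rw [ENNReal.rpow_add_of_nonneg _ _ (by positivity) (by positivity),
            ENNReal.mul_rpow_of_nonneg _ _ (by positivity), ← ENNReal.rpow_mul, ← this]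
          ring
  rw [e]
  refine (ENNReal.rpow_le_rpow h (by positivity)).trans ?_
  rw [ENNReal.mul_rpow_of_nonneg _ _ (by positivity), ← ENNReal.rpow_mul, ← ENNReal.rpow_mul]
  have a1 : r / (1 + r) * (1 + r) = r := by field_simp
  have a2 : 1 / (1 + r) * (1 + r) = 1 := by field_simp
  rw [a1, a2, ENNReal.rpow_one]

lemma b_est (N : ℕ) (hN : 1 ≤ N) (c β : ℝ) (hc : -1 < c) (hβ : β * (1 + 1 / (N:ℝ)) = c)
    (G : (Fin N → ℝ) × ℝ → ℝ≥0∞) (hG : Measurable G) :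
    ∫⁻ y in Ioi (0:ℝ), ENNReal.ofReal (y ^ c) * ∫⁻ x : Fin N → ℝ,
      (∫⁻ s in Ioi y, ∫⁻ ξ in Icc (0 : Fin N → ℝ) 1, G (x + s • ξ, s)) ^ (1 + 1 / (N:ℝ)) ≤
    (∫⁻ s in Ioi (0:ℝ), ENNReal.ofReal (s ^ β) * ∫⁻ x : Fin N → ℝ, G (x, s)) ^ (1 / (N:ℝ)) *
      (ENNReal.ofReal (1 / (c + 1)) *
        ∫⁻ s in Ioi (0:ℝ), ENNReal.ofReal (s ^ β) * ∫⁻ x : Fin N → ℝ, G (x, s)) := by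
  have hN0 : (0:ℝ) < N := by exact_mod_cast hN
  set T := ∫⁻ s in Ioi (0:ℝ), ENNReal.ofReal (s ^ β) * ∫⁻ x : Fin N → ℝ, G (x, s) with hT
  set H : ℝ → ℝ≥0∞ := fun s => ∫⁻ x : Fin N → ℝ, G (x, s) with hH
  have hHm : Measurable H := Measurable.lintegral_prod_left' hG
  set e : ℝ := -((N + β) / N) with he
  have hvol : volume (Icc (0 : Fin N → ℝ) 1) = 1 := by
    simp [Real.volume_Icc_pi]
  -- pointwise in (x, y)
  have hpt : ∀ y, 0 < y → ∀ x : Fin N → ℝ,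
      (∫⁻ s in Ioi y, ∫⁻ ξ in Icc (0 : Fin N → ℝ) 1, G (x + s • ξ, s)) ^ (1 + 1 / (N:ℝ)) ≤
      T ^ (1 / (N:ℝ)) * ∫⁻ p, G (x + p.1 • p.2, p.1) * ENNReal.ofReal (p.1 ^ e)
        ∂((volume.restrict (Ioi y)).prod (volume.restrict (Icc (0 : Fin N → ℝ) 1))) := by
    intro y hy x
    have hgm : Measurable (fun p : ℝ × (Fin N → ℝ) => G (x + p.1 • p.2, p.1)) := by fun_prop
    have h1 := holder_aux ((volume.restrict (Ioi y)).prod (volume.restrict (Icc (0 : Fin N → ℝ) 1)))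
      (1 / (N:ℝ)) (by positivity) (fun p => G (x + p.1 • p.2, p.1))
      (fun p => ENNReal.ofReal (p.1 ^ ((N:ℝ) + β))) (fun p => ENNReal.ofReal (p.1 ^ e))
      hgm.aemeasurable (by fun_prop) (by fun_prop) (by
        rw [Measure.prod_restrict]
        filter_upwards [ae_restrict_mem (measurableSet_Ioi.prod measurableSet_Icc)] with p hp
        have hp1 : 0 < p.1 := hy.trans hp.1
        rw [ENNReal.ofReal_rpow_of_pos (by positivity), ← ENNReal.ofReal_mul (by positivity),
          ← Real.rpow_mul hp1.le, ← Real.rpow_add hp1]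
        have : ((N:ℝ) + β) * (1 / (N:ℝ)) + e = 0 := by rw [he]; ring
        rw [this]; simp)
    rw [lintegral_prod _ hgm.aemeasurable] at h1
    refine h1.trans ?_
    gcongr
    rw [lintegral_prod _ (by fun_prop)]
    simp only
    calc ∫⁻ s in Ioi y, ∫⁻ ξ in Icc (0 : Fin N → ℝ) 1,
          G (x + s • ξ, s) * ENNReal.ofReal (s ^ ((N:ℝ) + β))
        ≤ ∫⁻ s in Ioi y, ENNReal.ofReal (s ^ β) * H s := by
          apply setLIntegral_mono (by fun_prop)
          intro s hs
          have hs0 : 0 < s := hy.trans hs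
          rw [lintegral_mul_const _ (by fun_prop)]
          calc (∫⁻ ξ in Icc (0 : Fin N → ℝ) 1, G (x + s • ξ, s)) *
                ENNReal.ofReal (s ^ ((N:ℝ) + β))
              ≤ (∫⁻ ξ, G (x + s • ξ, s)) * ENNReal.ofReal (s ^ ((N:ℝ) + β)) := by
                gcongr; exact Measure.restrict_le_self
            _ = ENNReal.ofReal (s ^ β) * H s := by
                rw [scale_lintegral N (fun x => G (x, s)) (by fun_prop) x s hs0]
                rw [mul_comm, ← mul_assoc, ← ENNReal.ofReal_mul (by positivity)]
                congr 2
                rw [Real.rpow_add hs0, Real.rpow_natCast]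
                field_simp
      _ ≤ T := lintegral_mono_set (Ioi_subset_Ioi hy.le)
  have hx : ∀ y, 0 < y → ∫⁻ x : Fin N → ℝ,
      (∫⁻ s in Ioi y, ∫⁻ ξ in Icc (0 : Fin N → ℝ) 1, G (x + s • ξ, s)) ^ (1 + 1 / (N:ℝ)) ≤
      T ^ (1 / (N:ℝ)) * ∫⁻ s in Ioi y, ENNReal.ofReal (s ^ e) * H s := by
    intro y hy
    refine (lintegral_mono (hpt y hy)).trans ?_
    have hm : Measurable (fun q : (Fin N → ℝ) × (ℝ × (Fin N → ℝ)) =>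
        G (q.1 + q.2.1 • q.2.2, q.2.1) * ENNReal.ofReal (q.2.1 ^ e)) := by fun_prop
    rw [lintegral_const_mul _ (Measurable.lintegral_prod_right' hm)]
    gcongr
    rw [lintegral_lintegral_swap hm.aemeasurable]
    have h2 : ∀ p : ℝ × (Fin N → ℝ), ∫⁻ x : Fin N → ℝ,
        G (x + p.1 • p.2, p.1) * ENNReal.ofReal (p.1 ^ e) = ENNReal.ofReal (p.1 ^ e) * H p.1 := by
      intro p
      rw [lintegral_mul_const _ (by fun_prop),
        lintegral_add_right_eq_self (fun x => G (x, p.1)) (p.1 • p.2), mul_comm]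
    simp_rw [h2]
    rw [lintegral_prod _ (by fun_prop)]
    simp [hvol]
  calc _ ≤ ∫⁻ y in Ioi (0:ℝ), ENNReal.ofReal (y ^ c) *
        (T ^ (1 / (N:ℝ)) * ∫⁻ s in Ioi y, ENNReal.ofReal (s ^ e) * H s) := by
        apply lintegral_mono_ae
        filter_upwards [ae_restrict_mem measurableSet_Ioi] with y hy
        gcongr
        exact hx y hy
    _ = ∫⁻ y in Ioi (0:ℝ), (T ^ (1 / (N:ℝ)) * ENNReal.ofReal (y ^ c)) *
        ∫⁻ s in Ioi y, ENNReal.ofReal (s ^ e) * H s := by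
        congr 1; ext y; ring
    _ = ∫⁻ s in Ioi (0:ℝ), (∫⁻ y in Ioo 0 s, T ^ (1 / (N:ℝ)) * ENNReal.ofReal (y ^ c)) *
        (ENNReal.ofReal (s ^ e) * H s) :=
        swap_lintegral _ _ (by fun_prop) (by fun_prop)
    _ = ∫⁻ s in Ioi (0:ℝ), (T ^ (1 / (N:ℝ)) * ENNReal.ofReal (1 / (c + 1))) *
          (ENNReal.ofReal (s ^ β) * H s) := by
        apply setLIntegral_congr_fun measurableSet_Ioi
        intro s hs
        have hs0 : 0 < s := hs
        simp only
        rw [lintegral_const_mul _ (by fun_prop), rpow_lintegral c s hc hs0]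
        have hc1 : 0 < c + 1 := by linarith
        have h5 : ENNReal.ofReal (s ^ (c + 1) / (c + 1)) * ENNReal.ofReal (s ^ e) =
            ENNReal.ofReal (1 / (c + 1)) * ENNReal.ofReal (s ^ β) := by
          rw [← ENNReal.ofReal_mul (by positivity), ← ENNReal.ofReal_mul (by positivity)]
          congr 1
          rw [div_mul_eq_mul_div, ← Real.rpow_add hs0]
          have : c + 1 + e = β := by rw [he, ← hβ]; field_simp; ring
          rw [this]; ring
        calc _ = T ^ (1 / (N:ℝ)) * (ENNReal.ofReal (s ^ (c + 1) / (c + 1)) *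
              ENNReal.ofReal (s ^ e)) * H s := by ring
          _ = _ := by rw [h5]; ring
    _ = _ := by
        rw [lintegral_const_mul _ (by fun_prop), mul_assoc]

lemma ftc_bound0 (g g' : ℝ → ℝ) (a b : ℝ) (hab : a ≤ b)
    (h : ∀ s, HasDerivAt g (g' s) s) (hc : Continuous g') :
    ‖g b - g a‖ₑ ≤ ∫⁻ s in Ioc a b, ‖g' s‖ₑ := by
  have h1 : ∫ s in a..b, g' s = g b - g a :=
    intervalIntegral.integral_eq_sub_of_hasDerivAt (fun s _ => h s) (hc.intervalIntegrable _ _)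
  rw [← h1, intervalIntegral.integral_of_le hab]
  exact enorm_integral_le_lintegral_enorm _

/-- shear map -/
def shear {N : ℕ} (ξ : Fin N → ℝ) : ((Fin N → ℝ) × ℝ) →L[ℝ] ((Fin N → ℝ) × ℝ) :=
  (ContinuousLinearMap.fst ℝ (Fin N → ℝ) ℝ +
    (ContinuousLinearMap.snd ℝ (Fin N → ℝ) ℝ).smulRight ξ).prod
      (ContinuousLinearMap.snd ℝ (Fin N → ℝ) ℝ)

lemma shear_apply {N : ℕ} (ξ : Fin N → ℝ) (z : (Fin N → ℝ) × ℝ) :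
    shear ξ z = (z.1 + z.2 • ξ, z.2) := by
  simp [shear]

lemma shear_norm {N : ℕ} (ξ : Fin N → ℝ) (hξ : ‖ξ‖ ≤ 1) : ‖shear ξ‖ ≤ 2 := by
  apply ContinuousLinearMap.opNorm_le_bound _ (by norm_num)
  intro z
  rw [shear_apply, Prod.norm_def]
  have h1 := norm_fst_le z
  have h2 := norm_snd_le z
  have h3 : ‖z.1 + z.2 • ξ‖ ≤ ‖z.1‖ + ‖z.2‖ * ‖ξ‖ := by
    rw [← norm_smul]; exact norm_add_le _ _
  have h4 : ‖z.2‖ * ‖ξ‖ ≤ ‖z.2‖ * 1 := by gcongr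
  apply max_le
  · linarith
  · simp only; have := norm_nonneg z; linarith

lemma enorm_clm_le {N : ℕ} (L : ((Fin N → ℝ) × ℝ) →L[ℝ] ℝ) (v : (Fin N → ℝ) × ℝ)
    (hv : ‖v‖ ≤ 1) : ‖L v‖ₑ ≤ ‖L‖ₑ := by
  rw [enorm_le_iff_norm_le]
  exact (L.le_opNorm v).trans (mul_le_of_le_one_right (norm_nonneg _) hv)

lemma wgag (N : ℕ) (hN : 1 ≤ N) (c β : ℝ) (hβ : β * (1 + 1 / (N:ℝ)) = c)
    (w : (Fin N → ℝ) × ℝ → ℝ) (hw : ContDiff ℝ 1 w) (R : ℝ) (hR : ∀ z, R ≤ ‖z‖ → w z = 0) :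
    ∫⁻ y in Ioi (0:ℝ), ENNReal.ofReal (y ^ c) * ∫⁻ x : Fin N → ℝ, ‖w (x, y)‖ₑ ^ (1 + 1 / (N:ℝ)) ≤
    (∫⁻ y in Ioi (0:ℝ), ∫⁻ x : Fin N → ℝ, (ENNReal.ofReal (y ^ β) * ‖fderiv ℝ w (x, y)‖ₑ +
      ENNReal.ofReal (|β| * y ^ (β - 1)) * ‖w (x, y)‖ₑ)) ^ (1 + 1 / (N:ℝ)) := by
  have hN0 : (0:ℝ) < N := by exact_mod_cast hN
  have hwc : Continuous w := hw.continuous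
  have hdc : Continuous (fderiv ℝ w) := hw.continuous_fderiv one_ne_zero
  have hwd : ∀ z, HasFDerivAt w (fderiv ℝ w z) z := fun z =>
    (hw.differentiable one_ne_zero z).hasFDerivAt
  set f : (Fin N → ℝ) × ℝ → ℝ≥0∞ := fun z => ENNReal.ofReal (z.2 ^ β) * ‖fderiv ℝ w z‖ₑ +
      ENNReal.ofReal (|β| * z.2 ^ (β - 1)) * ‖w z‖ₑ with hf
  have hfm : Measurable f := by
    have := hdc.measurable
    have := hwc.measurable
    fun_prop
  set k : (Fin N → ℝ) × ℝ → ℝ≥0∞ := fun z => ENNReal.ofReal (z.2 ^ β) * ‖w z‖ₑ with hk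
  have key := gagliardo N hN ((HS N).indicator f) ((HS N).indicator k)
    (hfm.indicator (hs_measurable N)) ?_ ?_
  · rw [lintegral_indicator (hs_measurable N), hs_lintegral N f hfm] at key
    refine le_trans (le_of_eq ?_) key
    have e1 : ∀ z, (HS N).indicator k z ^ (1 + 1 / (N:ℝ)) = (HS N).indicator
        (fun z => ENNReal.ofReal (z.2 ^ c) * ‖w z‖ₑ ^ (1 + 1 / (N:ℝ))) z := by
      intro z
      by_cases hz : z ∈ HS N
      · rw [indicator_of_mem hz, indicator_of_mem hz]
        have hz' : 0 < z.2 := hz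
        rw [hk, ENNReal.mul_rpow_of_nonneg _ _ (by positivity),
          ENNReal.ofReal_rpow_of_pos (by positivity), ← Real.rpow_mul hz'.le, hβ]
      · rw [indicator_of_notMem hz, indicator_of_notMem hz, ENNReal.zero_rpow_of_pos (by positivity)]
    simp_rw [e1]
    have hm2 := hwc.measurable
    rw [lintegral_indicator (hs_measurable N), hs_lintegral N _ (by fun_prop)]
    congr 1; ext y
    simp only
    rw [lintegral_const_mul _ (by fun_prop)]
  · intro x y j
    by_cases hy : 0 < y
    · have hmem : ∀ x' : Fin N → ℝ, (x', y) ∈ HS N := fun _ => hy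
      simp_rw [indicator_of_mem (hmem _)]
      have h1 := ftc_bound (fun t => w (update x j t, y))
        (fun t => fderiv ℝ w (update x j t, y) (Pi.single j 1, 0)) (x j) R
        (fun s _ => by
          have hu : HasDerivAt (fun t => (update x j t, y)) ((Pi.single j 1 : Fin N → ℝ), (0:ℝ)) s :=
            (hasDerivAt_update x j s).prodMk (hasDerivAt_const s y)
          exact (hwd (update x j s, y)).comp_hasDerivAt s hu)
        (by
          have : Continuous (fun t : ℝ => (update x j t, y)) := by fun_prop
          exact ((hdc.comp this).clm_apply continuous_const).continuousOn)
        (fun s hs => by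
          apply hR
          refine hs.trans ((le_abs_self s).trans ?_)
          have a1 := norm_fst_le (update x j s, y)
          have a2 := norm_le_pi_norm (update x j s) j
          simp only [update_self, Real.norm_eq_abs] at a2
          exact a2.trans a1)
      simp only [update_eq_self] at h1
      calc k (x, y) ≤ ENNReal.ofReal (y ^ β) * ∫⁻ t, ‖fderiv ℝ w (update x j t, y)‖ₑ := by
            simp only [hk]
            gcongr
            refine h1.trans ((setLIntegral_le_lintegral _ _).trans (lintegral_mono fun t => ?_))
            apply enorm_clm_le
            rw [Prod.norm_def]; simp [Pi.norm_single]
        _ = ∫⁻ t, ENNReal.ofReal (y ^ β) * ‖fderiv ℝ w (update x j t, y)‖ₑ := by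
            rw [lintegral_const_mul]
            have : Continuous (fun t : ℝ => (update x j t, y)) := by fun_prop
            exact (hdc.comp this).measurable.enorm
        _ ≤ _ := lintegral_mono fun t => by simp only [hf]; exact le_self_add
    · have hmem : (x, y) ∉ HS N := hy
      rw [indicator_of_notMem hmem]; exact bot_le
  · intro x y
    by_cases hy : 0 < y
    · rw [indicator_of_mem (show (x, y) ∈ HS N from hy)]
      have h1 := ftc_bound (fun s => s ^ β * w (x, s))
        (fun s => β * s ^ (β - 1) * w (x, s) + s ^ β * fderiv ℝ w (x, s) (0, 1)) y R
        (fun s hs => by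
          have hs0 : 0 < s := hy.trans_le hs
          have hu : HasDerivAt (fun t => (x, t)) ((0 : Fin N → ℝ), (1:ℝ)) s :=
            (hasDerivAt_const s x).prodMk (hasDerivAt_id s)
          have h2 := (hwd (x, s)).comp_hasDerivAt s hu
          exact (Real.hasDerivAt_rpow_const (Or.inl hs0.ne')).mul h2)
        (by
          have : Continuous (fun t : ℝ => (x, t)) := by fun_prop
          have c1 : Continuous (fun s => fderiv ℝ w (x, s) (0, 1)) :=
            (hdc.comp this).clm_apply continuous_const
          have c2 : Continuous (fun s => w (x, s)) := hwc.comp this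
          have hne : ∀ s ∈ Ici y, s ≠ 0 := fun s hs => (hy.trans_le hs).ne'
          have c3 : ∀ a : ℝ, ContinuousOn (fun s : ℝ => s ^ a) (Ici y) := fun a =>
            continuousOn_id.rpow_const (fun s hs => Or.inl (hne s hs))
          exact ((continuousOn_const.mul (c3 _)).mul c2.continuousOn).add
            ((c3 _).mul c1.continuousOn))
        (fun s hs => by
          have : w (x, s) = 0 := by
            apply hR
            exact hs.trans ((le_abs_self s).trans (norm_snd_le (x, s)))
          simp [this])
      calc k (x, y) = ‖y ^ β * w (x, y)‖ₑ := by
            rw [enorm_mul, Real.enorm_eq_ofReal (by positivity)]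
        _ ≤ _ := h1
        _ ≤ ∫⁻ s in Ioi y, f (x, s) := by
            apply setLIntegral_mono (by fun_prop)
            intro s hs
            have hs0 : 0 < s := hy.trans hs
            refine (enorm_add_le _ _).trans ?_
            rw [add_comm]
            simp only [hf]
            rw [enorm_mul, enorm_mul, Real.enorm_eq_ofReal (r := s ^ β) (by positivity),
              Real.enorm_eq_ofReal_abs (β * _), abs_mul, abs_of_pos (a := s ^ (β - 1)) (by positivity)]
            gcongr
            apply enorm_clm_le
            rw [Prod.norm_def]; simp
        _ ≤ ∫⁻ s in Ioi 0, f (x, s) := lintegral_mono_set (Ioi_subset_Ioi hy.le)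
        _ = ∫⁻ s, (HS N).indicator f (x, s) := by
            rw [← lintegral_indicator measurableSet_Ioi]
            rfl
    · have hmem : (x, y) ∉ HS N := hy
      rw [indicator_of_notMem hmem]; exact bot_le

lemma shear_comp_enorm {N : ℕ} (ξ : Fin N → ℝ) (hξ : ‖ξ‖ ≤ 1)
    (L : ((Fin N → ℝ) × ℝ) →L[ℝ] ℝ) : ‖L.comp (shear ξ)‖ₑ ≤ 2 * ‖L‖ₑ := by
  rw [← ofReal_norm, ← ofReal_norm]
  have h2 : (2 : ℝ≥0∞) = ENNReal.ofReal 2 := by simp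
  rw [h2, ← ENNReal.ofReal_mul (by norm_num)]
  apply ENNReal.ofReal_le_ofReal
  refine (ContinuousLinearMap.opNorm_comp_le _ _).trans ?_
  rw [mul_comm]
  exact mul_le_mul_of_nonneg_right (shear_norm ξ hξ) (norm_nonneg _)

lemma w_est (N : ℕ) (hN : 1 ≤ N) (c β : ℝ) (hβ : β * (1 + 1 / (N:ℝ)) = c)
    (u : (Fin N → ℝ) × ℝ → ℝ) (hu : ContDiff ℝ 1 u) (hcs : HasCompactSupport u)
    (ξ : Fin N → ℝ) (hξ : ‖ξ‖ ≤ 1) :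
    ∫⁻ y in Ioi (0:ℝ), ENNReal.ofReal (y ^ c) * ∫⁻ x : Fin N → ℝ,
      ‖u (x, y) - u (x + y • ξ, y)‖ₑ ^ (1 + 1 / (N:ℝ)) ≤
    (ENNReal.ofReal (3 + |β|) * ∫⁻ y in Ioi (0:ℝ), ENNReal.ofReal (y ^ β) *
      ∫⁻ x : Fin N → ℝ, ‖fderiv ℝ u (x, y)‖ₑ) ^ (1 + 1 / (N:ℝ)) := by
  obtain ⟨R, hR0, hR⟩ := hcs.exists_pos_le_norm
  set w : (Fin N → ℝ) × ℝ → ℝ := fun z => u z - u (shear ξ z) with hw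
  have hwC : ContDiff ℝ 1 w := hu.sub (hu.comp (shear ξ).contDiff)
  have huc : Continuous u := hu.continuous
  have hdc : Continuous (fderiv ℝ u) := hu.continuous_fderiv one_ne_zero
  have hud : ∀ z, HasFDerivAt u (fderiv ℝ u z) z := fun z =>
    (hu.differentiable one_ne_zero z).hasFDerivAt
  have hwR : ∀ z, 2 * R ≤ ‖z‖ → w z = 0 := by
    intro z hz
    have h1 : u z = 0 := hR z (by linarith)
    have h2 : u (shear ξ z) = 0 := by
      apply hR
      by_contra hcon
      push Not at hcon
      have hs : ‖shear (-ξ) (shear ξ z)‖ ≤ 2 * ‖shear ξ z‖ :=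
        ((shear (-ξ)).le_opNorm _).trans (by
          gcongr; exact shear_norm _ (by simpa using hξ))
      have : shear (-ξ) (shear ξ z) = z := by
        rw [shear_apply, shear_apply]; ext <;> simp
      rw [this] at hs
      linarith
    simp [hw, h1, h2]
  have key := wgag N hN c β hβ w hwC (2 * R) hwR
  have e0 : ∀ x y, w (x, y) = u (x, y) - u (x + y • ξ, y) := by
    intro x y; simp [hw, shear_apply]
  simp_rw [← e0]
  refine key.trans (ENNReal.rpow_le_rpow ?_ (by positivity))
  set G : (Fin N → ℝ) × ℝ → ℝ≥0∞ := fun z => ‖fderiv ℝ u z‖ₑ with hG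
  have hGm : Measurable G := hdc.measurable.enorm
  have hwm : Measurable w := hwC.continuous.measurable
  have hH : Measurable fun y => ∫⁻ x : Fin N → ℝ, G (x, y) := Measurable.lintegral_prod_left' hGm
  have hfw : ∀ x y, ‖fderiv ℝ w (x, y)‖ₑ ≤ G (x, y) + 2 * G (x + y • ξ, y) := by
    intro x y
    have h1 : HasFDerivAt w (fderiv ℝ u (x, y) -
        (fderiv ℝ u (shear ξ (x, y))).comp (shear ξ)) (x, y) :=
      (hud _).sub ((hud _).comp _ (shear ξ).hasFDerivAt)
    rw [h1.fderiv]
    refine (enorm_sub_le).trans ?_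
    gcongr
    rw [shear_apply]
    exact shear_comp_enorm ξ hξ _
  have hw0 : ∀ x y, 0 < y → ‖w (x, y)‖ₑ ≤
      ENNReal.ofReal y * ∫⁻ t in Ioc (0:ℝ) 1, G (x + (t * y) • ξ, y) := by
    intro x y hy
    have h1 := ftc_bound0 (fun t => u (x + (t * y) • ξ, y))
      (fun t => fderiv ℝ u (x + (t * y) • ξ, y) (y • ξ, 0)) 0 1 zero_le_one
      (fun t => by
        have h2 : HasDerivAt (fun t : ℝ => (x + (t * y) • ξ, y)) (y • ξ, (0:ℝ)) t := by
          refine HasDerivAt.prodMk ?_ (hasDerivAt_const t y)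
          have := ((hasDerivAt_id t).mul_const y).smul_const ξ
          simpa using this.const_add x
        exact (hud _).comp_hasDerivAt t h2)
      (by
        have : Continuous (fun t : ℝ => (x + (t * y) • ξ, y)) := by fun_prop
        exact (hdc.comp this).clm_apply continuous_const)
    simp only [one_mul, zero_mul, zero_smul, add_zero] at h1
    rw [e0, ← enorm_neg, neg_sub]
    refine h1.trans ?_
    rw [← lintegral_const_mul _ (by fun_prop)]
    apply lintegral_mono
    intro t
    have h3 : ((y • ξ, (0:ℝ)) : (Fin N → ℝ) × ℝ) = y • (ξ, 0) := by simp
    simp only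
    rw [h3, map_smul, smul_eq_mul, enorm_mul, Real.enorm_eq_ofReal hy.le]
    gcongr
    apply enorm_clm_le
    rw [Prod.norm_def]; simpa using hξ
  have hxy : ∀ y, 0 < y → ∫⁻ x : Fin N → ℝ, (ENNReal.ofReal (y ^ β) * ‖fderiv ℝ w (x, y)‖ₑ +
      ENNReal.ofReal (|β| * y ^ (β - 1)) * ‖w (x, y)‖ₑ) ≤
      ENNReal.ofReal (3 + |β|) * (ENNReal.ofReal (y ^ β) * ∫⁻ x : Fin N → ℝ, G (x, y)) := by
    intro y hy
    calc _ ≤ ∫⁻ x : Fin N → ℝ, (ENNReal.ofReal (y ^ β) * (G (x, y) + 2 * G (x + y • ξ, y)) +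
          ENNReal.ofReal (|β| * y ^ β) * ∫⁻ t in Ioc (0:ℝ) 1, G (x + (t * y) • ξ, y)) := by
          apply lintegral_mono
          intro x
          simp only
          refine add_le_add (mul_le_mul_right (hfw x y) _) ?_
          · refine (mul_le_mul_right (hw0 x y hy) _).trans (le_of_eq ?_)
            rw [← mul_assoc, ← ENNReal.ofReal_mul (by positivity), mul_assoc]
            congr 3
            rw [← Real.rpow_add_one hy.ne']; congr 1; ring
      _ = ENNReal.ofReal (y ^ β) * ((∫⁻ x : Fin N → ℝ, G (x, y)) +
            2 * ∫⁻ x : Fin N → ℝ, G (x, y)) +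
          ENNReal.ofReal (|β| * y ^ β) * ∫⁻ x : Fin N → ℝ, G (x, y) := by
          have hm3 : Measurable (fun q : (Fin N → ℝ) × ℝ => G (q.1 + (q.2 * y) • ξ, y)) := by
            fun_prop
          have hm4 : Measurable (fun x : Fin N → ℝ =>
              ∫⁻ t in Ioc (0:ℝ) 1, G (x + (t * y) • ξ, y)) :=
            Measurable.lintegral_prod_right' hm3
          rw [lintegral_add_left (by fun_prop), lintegral_const_mul _ (by fun_prop),
            lintegral_const_mul _ hm4, lintegral_add_left (by fun_prop),
            lintegral_const_mul _ (by fun_prop),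
            lintegral_add_right_eq_self (fun x => G (x, y)) (y • ξ),
            lintegral_lintegral_swap hm3.aemeasurable]
          congr 2
          have : ∀ t : ℝ, ∫⁻ x : Fin N → ℝ, G (x + (t * y) • ξ, y) = ∫⁻ x, G (x, y) := fun t =>
            lintegral_add_right_eq_self (fun x => G (x, y)) ((t * y) • ξ)
          simp_rw [this]
          simp
      _ = _ := by
          rw [ENNReal.ofReal_mul (abs_nonneg _), ENNReal.ofReal_add (by norm_num) (abs_nonneg _)]
          have : ENNReal.ofReal 3 = 1 + 2 := by norm_num
          rw [this]
          ring
  rw [← lintegral_const_mul _ (by fun_prop)]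
  exact setLIntegral_mono (by fun_prop) (fun y hy => hxy y hy)

lemma jensen_aux {α : Type*} [MeasurableSpace α] (μ : Measure α) (hμ : μ univ = 1)
    (r : ℝ) (hr : 0 < r) (g : α → ℝ≥0∞) (hg : Measurable g) :
    (∫⁻ a, g a ∂μ) ^ (1 + r) ≤ ∫⁻ a, g a ^ (1 + r) ∂μ := by
  have h := ENNReal.lintegral_mul_norm_pow_le (μ := μ) (f := fun a => g a ^ (1 + r))
    (g := fun _ => 1) (by fun_prop) (by fun_prop) (p := 1 / (1 + r)) (q := r / (1 + r))
    (by positivity) (by positivity) (by field_simp)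
  have e : ∀ a, (g a ^ (1 + r)) ^ (1 / (1 + r)) = g a := by
    intro a
    rw [← ENNReal.rpow_mul]
    have : (1 + r) * (1 / (1 + r)) = 1 := by field_simp
    rw [this, ENNReal.rpow_one]
  simp only [e, ENNReal.one_rpow, mul_one, lintegral_const, hμ] at h
  refine (ENNReal.rpow_le_rpow h (by positivity)).trans ?_
  rw [← ENNReal.rpow_mul]
  have : 1 / (1 + r) * (1 + r) = 1 := by field_simp
  rw [this, ENNReal.rpow_one]

lemma L1_est (N : ℕ) (hN : 1 ≤ N) (c β : ℝ) (hc : -1 < c) (hβ : β * (1 + 1 / (N:ℝ)) = c) :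
    ∃ K : ℝ≥0∞, K ≠ ⊤ ∧ ∀ u : (Fin N → ℝ) × ℝ → ℝ, ContDiff ℝ 1 u → HasCompactSupport u →
    ∫⁻ y in Ioi (0:ℝ), ENNReal.ofReal (y ^ c) * ∫⁻ x : Fin N → ℝ, ‖u (x, y)‖ₑ ^ (1 + 1 / (N:ℝ)) ≤
    K * (∫⁻ y in Ioi (0:ℝ), ENNReal.ofReal (y ^ β) *
      ∫⁻ x : Fin N → ℝ, ‖fderiv ℝ u (x, y)‖ₑ) ^ (1 + 1 / (N:ℝ)) := by
  have hN0 : (0:ℝ) < N := by exact_mod_cast hN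
  refine ⟨2 ^ (1 / (N:ℝ)) * (ENNReal.ofReal (3 + |β|) ^ (1 + 1 / (N:ℝ)) +
    ENNReal.ofReal (1 / (c + 1))), ?_, ?_⟩
  · apply ENNReal.mul_ne_top
    · exact ENNReal.rpow_ne_top_of_nonneg (by positivity) (by simp)
    · exact ENNReal.add_ne_top.2 ⟨ENNReal.rpow_ne_top_of_nonneg (by positivity) (by simp), by simp⟩
  intro u hu hcs
  obtain ⟨R, hR0, hR⟩ := hcs.exists_pos_le_norm
  have huc : Continuous u := hu.continuous
  have hum : Measurable u := huc.measurable
  have hdc : Continuous (fderiv ℝ u) := hu.continuous_fderiv one_ne_zero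
  have hud : ∀ z, HasFDerivAt u (fderiv ℝ u z) z := fun z =>
    (hu.differentiable one_ne_zero z).hasFDerivAt
  set G : (Fin N → ℝ) × ℝ → ℝ≥0∞ := fun z => ‖fderiv ℝ u z‖ₑ with hG
  have hGm : Measurable G := hdc.measurable.enorm
  set q : ℝ := 1 + 1 / (N:ℝ) with hq
  have hq0 : 0 ≤ q := by positivity
  set I : Set (Fin N → ℝ) := Icc 0 1 with hI
  have hvol : volume I = 1 := by simp [hI, Real.volume_Icc_pi]
  have hIn : ∀ ξ ∈ I, ‖ξ‖ ≤ 1 := by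
    intro ξ hξ
    rw [pi_norm_le_iff_of_nonneg zero_le_one]
    intro i
    rw [Real.norm_eq_abs, abs_le]
    exact ⟨by linarith [hξ.1 i, show (0 : Fin N → ℝ) i = 0 from rfl], hξ.2 i⟩
  have hIm : MeasurableSet I := measurableSet_Icc
  set T := ∫⁻ y in Ioi (0:ℝ), ENNReal.ofReal (y ^ β) * ∫⁻ x : Fin N → ℝ, G (x, y) with hT
  set A : (Fin N → ℝ) → ℝ → ℝ≥0∞ := fun x y =>
    ∫⁻ ξ in I, ‖u (x, y) - u (x + y • ξ, y)‖ₑ with hA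
  set B : (Fin N → ℝ) → ℝ → ℝ≥0∞ := fun x y =>
    ∫⁻ s in Ioi y, ∫⁻ ξ in I, G (x + s • ξ, s) with hB
  have hAB : ∀ x y, ‖u (x, y)‖ₑ ≤ A x y + B x y := by
    intro x y
    have hsl : ∀ ξ ∈ I, ‖u (x + y • ξ, y)‖ₑ ≤ ∫⁻ s in Ioi y, G (x + s • ξ, s) := by
      intro ξ hξ
      have h1 := ftc_bound (fun s => u (x + s • ξ, s)) (fun s => fderiv ℝ u (x + s • ξ, s) (ξ, 1))
        y R (fun s _ => by
          have h2 : HasDerivAt (fun s : ℝ => (x + s • ξ, s)) (ξ, (1:ℝ)) s := by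
            refine HasDerivAt.prodMk ?_ (hasDerivAt_id s)
            have := (hasDerivAt_id s).smul_const ξ
            simpa using this.const_add x
          exact (hud _).comp_hasDerivAt s h2)
        (by
          have : Continuous (fun t : ℝ => (x + t • ξ, t)) := by fun_prop
          exact ((hdc.comp this).clm_apply continuous_const).continuousOn)
        (fun s hs => hR _ (hs.trans ((le_abs_self s).trans (norm_snd_le (x + s • ξ, s)))))
      refine h1.trans (lintegral_mono fun s => ?_)
      apply enorm_clm_le
      rw [Prod.norm_def]; simpa using hIn ξ hξ
    have hm3 : Measurable (fun p : (Fin N → ℝ) × ℝ => G (x + p.2 • p.1, p.2)) := by fun_prop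
    calc ‖u (x, y)‖ₑ = ∫⁻ ξ in I, ‖u (x, y)‖ₑ := by simp [hvol]
      _ ≤ ∫⁻ ξ in I, (‖u (x, y) - u (x + y • ξ, y)‖ₑ + ∫⁻ s in Ioi y, G (x + s • ξ, s)) := by
          apply lintegral_mono_ae
          filter_upwards [ae_restrict_mem hIm] with ξ hξ
          calc ‖u (x, y)‖ₑ = ‖(u (x, y) - u (x + y • ξ, y)) + u (x + y • ξ, y)‖ₑ := by
                rw [sub_add_cancel]
            _ ≤ _ := (enorm_add_le _ _).trans (by gcongr; exact hsl ξ hξ)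
      _ = A x y + B x y := by
          rw [lintegral_add_left (by fun_prop), hA, hB]
          simp only
          rw [lintegral_lintegral_swap hm3.aemeasurable]
  have hAm3 : Measurable (fun p : ((Fin N → ℝ) × ℝ) × (Fin N → ℝ) =>
      ‖u (p.1.1, p.1.2) - u (p.1.1 + p.1.2 • p.2, p.1.2)‖ₑ ^ q) := by fun_prop
  have hAest : ∫⁻ y in Ioi (0:ℝ), ENNReal.ofReal (y ^ c) * ∫⁻ x, A x y ^ q ≤
      (ENNReal.ofReal (3 + |β|) * T) ^ q := by
    calc _ ≤ ∫⁻ y in Ioi (0:ℝ), ENNReal.ofReal (y ^ c) * ∫⁻ x, ∫⁻ ξ in I,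
            ‖u (x, y) - u (x + y • ξ, y)‖ₑ ^ q := by
          gcongr with y x
          exact jensen_aux _ (by simpa using hvol) _ (by positivity) _ (by fun_prop)
      _ = ∫⁻ y in Ioi (0:ℝ), ∫⁻ ξ in I, ENNReal.ofReal (y ^ c) * ∫⁻ x,
            ‖u (x, y) - u (x + y • ξ, y)‖ₑ ^ q := by
          congr 1; ext y
          have m1 : Measurable (fun p : (Fin N → ℝ) × (Fin N → ℝ) =>
            ‖u (p.1, y) - u (p.1 + y • p.2, y)‖ₑ ^ q) := by fun_prop
          rw [lintegral_lintegral_swap m1.aemeasurable, lintegral_const_mul]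
          exact Measurable.lintegral_prod_left' m1
      _ = ∫⁻ ξ in I, ∫⁻ y in Ioi (0:ℝ), ENNReal.ofReal (y ^ c) * ∫⁻ x,
            ‖u (x, y) - u (x + y • ξ, y)‖ₑ ^ q := by
          rw [lintegral_lintegral_swap]
          apply Measurable.aemeasurable
          have m2 : Measurable (fun p : (ℝ × (Fin N → ℝ)) × (Fin N → ℝ) =>
            ‖u (p.2, p.1.1) - u (p.2 + p.1.1 • p.1.2, p.1.1)‖ₑ ^ q) := by fun_prop
          have m3 := Measurable.lintegral_prod_right' (ν := (volume : Measure (Fin N → ℝ))) m2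
          exact (by fun_prop : Measurable fun p : ℝ × (Fin N → ℝ) =>
            ENNReal.ofReal (p.1 ^ c)).mul m3
      _ ≤ ∫⁻ ξ in I, (ENNReal.ofReal (3 + |β|) * T) ^ q := by
          apply setLIntegral_mono (by fun_prop)
          intro ξ hξ
          exact w_est N hN c β hβ u hu hcs ξ (hIn ξ hξ)
      _ = _ := by simp [hvol]
  have hBest : ∫⁻ y in Ioi (0:ℝ), ENNReal.ofReal (y ^ c) * ∫⁻ x, B x y ^ q ≤
      T ^ (1 / (N:ℝ)) * (ENNReal.ofReal (1 / (c + 1)) * T) :=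
    b_est N hN c β hc hβ G hGm
  have hAmeas : Measurable (fun p : (Fin N → ℝ) × ℝ => A p.1 p.2) := by
    have : Measurable (fun p : ((Fin N → ℝ) × ℝ) × (Fin N → ℝ) =>
      ‖u (p.1.1, p.1.2) - u (p.1.1 + p.1.2 • p.2, p.1.2)‖ₑ) := by fun_prop
    exact Measurable.lintegral_prod_right' this
  have hAq : Measurable (fun y => ∫⁻ x, A x y ^ q) :=
    Measurable.lintegral_prod_left' (f := fun p : (Fin N → ℝ) × ℝ => A p.1 p.2 ^ q) (by fun_prop)
  calc _ ≤ ∫⁻ y in Ioi (0:ℝ), 2 ^ (1 / (N:ℝ)) * (ENNReal.ofReal (y ^ c) * (∫⁻ x, A x y ^ q) +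
        ENNReal.ofReal (y ^ c) * ∫⁻ x, B x y ^ q) := by
        apply lintegral_mono
        intro y
        simp only
        rw [← mul_add, mul_left_comm]
        gcongr
        have hAx : Measurable (fun x => A x y ^ q) :=
          (hAmeas.comp (measurable_id.prodMk measurable_const)).pow_const q
        rw [← lintegral_add_left hAx, ← lintegral_const_mul' _ _
          (ENNReal.rpow_ne_top_of_nonneg (by positivity) (by simp))]
        apply lintegral_mono
        intro x
        refine (ENNReal.rpow_le_rpow (hAB x y) hq0).trans ?_
        have := ENNReal.rpow_add_le_mul_rpow_add_rpow (A x y) (B x y) (p := q)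
          (by rw [hq]; simp)
        simpa [hq] using this
    _ = 2 ^ (1 / (N:ℝ)) * ((∫⁻ y in Ioi (0:ℝ), ENNReal.ofReal (y ^ c) * (∫⁻ x, A x y ^ q)) +
        ∫⁻ y in Ioi (0:ℝ), ENNReal.ofReal (y ^ c) * ∫⁻ x, B x y ^ q) := by
        rw [lintegral_const_mul' _ _ (ENNReal.rpow_ne_top_of_nonneg (by positivity) (by simp)),
          lintegral_add_left (by fun_prop)]
    _ ≤ 2 ^ (1 / (N:ℝ)) * ((ENNReal.ofReal (3 + |β|) * T) ^ q +
        T ^ (1 / (N:ℝ)) * (ENNReal.ofReal (1 / (c + 1)) * T)) := by gcongr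
    _ = _ := by
        rw [ENNReal.mul_rpow_of_nonneg _ _ hq0]
        have : T ^ q = T * T ^ (1 / (N:ℝ)) := by
          rw [hq, ENNReal.rpow_add_of_nonneg _ _ zero_le_one (by positivity), ENNReal.rpow_one]
        rw [this]; ring

lemma finite_aux (N : ℕ) (a : ℝ) (ha : -1 < a) (f : (Fin N → ℝ) × ℝ → ℝ) (hf : Continuous f)
    (R : ℝ) (hR0 : 0 < R) (hR : ∀ z, R ≤ ‖z‖ → f z = 0) :
    ∫⁻ z in HS N, ENNReal.ofReal (z.2 ^ a * f z) < ⊤ := by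
  obtain ⟨M, hM⟩ := (isCompact_closedBall (0 : (Fin N → ℝ) × ℝ) R).exists_bound_of_continuousOn
    hf.continuousOn
  have hfm := hf.measurable
  rw [hs_lintegral N _ (by fun_prop)]
  have h1 : ∀ y ∈ Ioi (0:ℝ), ∫⁻ x : Fin N → ℝ, ENNReal.ofReal (y ^ a * f (x, y)) ≤
      (Ioo 0 R).indicator (fun y => ENNReal.ofReal (y ^ a)) y *
        (ENNReal.ofReal M * volume (Metric.closedBall (0 : Fin N → ℝ) R)) := by
    intro y hy
    have hy0 : 0 < y := hy
    by_cases hyR : y < R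
    · rw [indicator_of_mem (show y ∈ Ioo 0 R from ⟨hy, hyR⟩)]
      have h2 : ∀ x : Fin N → ℝ, ENNReal.ofReal (y ^ a * f (x, y)) ≤
          (Metric.closedBall (0 : Fin N → ℝ) R).indicator
            (fun _ => ENNReal.ofReal (y ^ a) * ENNReal.ofReal M) x := by
        intro x
        by_cases hx : x ∈ Metric.closedBall (0 : Fin N → ℝ) R
        · rw [indicator_of_mem hx, ENNReal.ofReal_mul (by positivity)]
          gcongr
          refine (le_abs_self _).trans (hM (x, y) ?_)
          rw [mem_closedBall_zero_iff, Prod.norm_def]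
          apply max_le
          · simpa using hx
          · simpa [abs_of_pos hy0] using hyR.le
        · rw [hR (x, y)]
          · simp
          · have : R < ‖x‖ := by simpa using hx
            exact this.le.trans (norm_fst_le (x, y))
      refine (lintegral_mono h2).trans ?_
      rw [lintegral_indicator Metric.isClosed_closedBall.measurableSet]
      simp [mul_assoc]
    · have : ∀ x : Fin N → ℝ, f (x, y) = 0 := by
        intro x
        apply hR
        push Not at hyR
        exact hyR.trans ((le_abs_self y).trans (norm_snd_le (x, y)))
      simp [this]
  have hm : Measurable (fun y : ℝ => (Ioo 0 R).indicator (fun y => ENNReal.ofReal (y ^ a)) y) :=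
    Measurable.indicator (by fun_prop) measurableSet_Ioo
  refine (setLIntegral_mono (by fun_prop) h1).trans_lt ?_
  rw [lintegral_mul_const _ hm]
  apply ENNReal.mul_lt_top
  · refine (setLIntegral_le_lintegral _ _).trans_lt ?_
    rw [lintegral_indicator measurableSet_Ioo, rpow_lintegral a R ha hR0]
    simp
  · exact ENNReal.mul_lt_top (by simp) Metric.isBounded_closedBall.measure_lt_top

lemma fderiv_le_gradNorm {N : ℕ} (u : ((Fin N → ℝ) × ℝ) → ℝ) (z : (Fin N → ℝ) × ℝ) :
    ‖fderiv ℝ u z‖ ≤ (N + 1) * gradNorm u z := by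
  have hg : 0 ≤ gradNorm u z := Real.sqrt_nonneg _
  apply ContinuousLinearMap.opNorm_le_bound _ (by positivity)
  intro v
  have hv : v = (∑ i, v.1 i • ((Pi.single i 1 : Fin N → ℝ), (0:ℝ))) + v.2 • ((0 : Fin N → ℝ), (1:ℝ)) := by
    ext j
    · simp [Prod.fst_sum, Finset.sum_apply, Pi.single_apply]
    · simp [Prod.snd_sum]
  have hX : ∀ i, |pX u i z| ≤ gradNorm u z := by
    intro i
    apply Real.abs_le_sqrt
    have := Finset.single_le_sum (f := fun i => pX u i z ^ 2) (fun i _ => sq_nonneg _)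
      (Finset.mem_univ i)
    nlinarith [sq_nonneg (pY u z)]
  have hY : |pY u z| ≤ gradNorm u z := by
    apply Real.abs_le_sqrt
    have := Finset.sum_nonneg (s := Finset.univ) (f := fun i => pX u i z ^ 2)
      (fun i _ => sq_nonneg _)
    linarith
  have e : fderiv ℝ u z v = (∑ i, v.1 i * pX u i z) + v.2 * pY u z := by
    conv_lhs => rw [hv]
    simp only [map_add, map_sum, map_smul, smul_eq_mul, pX, pY]
  rw [e, Real.norm_eq_abs]
  have hv1 : ∀ i, |v.1 i| ≤ ‖v‖ := fun i =>
    (norm_le_pi_norm v.1 i).trans (norm_fst_le v)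
  have hv2 : |v.2| ≤ ‖v‖ := norm_snd_le v
  calc |(∑ i, v.1 i * pX u i z) + v.2 * pY u z|
      ≤ (∑ i, |v.1 i * pX u i z|) + |v.2 * pY u z| :=
        (abs_add_le _ _).trans (by gcongr; exact Finset.abs_sum_le_sum_abs _ _)
    _ ≤ (∑ _i : Fin N, ‖v‖ * gradNorm u z) + ‖v‖ * gradNorm u z := by
        gcongr with i
        · rw [abs_mul]; exact mul_le_mul (hv1 i) (hX i) (abs_nonneg _) (norm_nonneg _)
        · rw [abs_mul]; exact mul_le_mul hv2 hY (abs_nonneg _) (norm_nonneg _)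
    _ = _ := by simp; ring

/-- for `N > 1` and `c + 1 > 0`, with `p = 2* = 2(N+1)/(N−1)`,
`‖u‖_{L^{2*}_c} ≤ C ‖y^{−c/(N+1)} ∇u‖_{L²_c}` for all smooth compactly
supported `u` on the closed half-space. -/
theorem stmt_6 (N : ℕ) (hN : 1 < N) (c : ℝ) (hc : c + 1 > 0)
    (p : ℝ) (hp : p = 2 * ((N : ℝ) + 1) / ((N : ℝ) - 1)) :
    ∃ C > 0, ∀ u : ((Fin N → ℝ) × ℝ) → ℝ, ContDiff ℝ (⊤ : ℕ∞) u → HasCompactSupport u →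
      (∫ z in HS N, |u z| ^ p * z.2 ^ c) ^ (1 / p) ≤
        C * (∫ z in HS N, z.2 ^ (-(2 * c) / ((N : ℝ) + 1)) * gradNorm u z ^ 2 * z.2 ^ c) ^
          (1 / 2 : ℝ) := by
  have hN1 : (1:ℝ) < N := by exact_mod_cast hN
  have hN0 : (0:ℝ) < N := by linarith
  have hNm : (0:ℝ) < N - 1 := by linarith
  have hc' : -1 < c := by linarith
  set β : ℝ := c * N / (N + 1) with hβd
  set γ : ℝ := 2 * N / (N - 1) with hγd
  set q : ℝ := 1 + 1 / (N:ℝ) with hq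
  have hq0 : 0 < q := by positivity
  have hβ : β * q = c := by rw [hβd, hq]; field_simp
  have hγ1 : 1 < γ := by rw [hγd, lt_div_iff₀ hNm]; linarith
  have hγq : γ * q = p := by rw [hγd, hq, hp]; field_simp
  have hγp : 2 * (γ - 1) = p := by rw [hγd, hp]; field_simp; ring
  have hp0 : 0 < p := by rw [hp]; positivity
  have hqp : 1 / q = 1 / p + 1 / 2 := by rw [hq, hp]; field_simp; ring
  set e : ℝ := -(2 * c) / ((N : ℝ) + 1) + c with he
  have he2 : c / 2 + e / 2 = β := by rw [he, hβd]; field_simp; ring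
  have hea : -1 < e := by
    have : e = c * ((N - 1) / (N + 1)) := by rw [he]; field_simp; ring
    rw [this]
    have h1 : (0:ℝ) < (N - 1) / (N + 1) := by positivity
    have h2 : ((N:ℝ) - 1) / (N + 1) < 1 := by rw [div_lt_one (by positivity)]; linarith
    nlinarith
  obtain ⟨K, hK, hmain⟩ := L1_est N hN.le c β hc' hβ
  set g : ℝ := γ * (N + 1) with hg
  have hg0 : 0 < g := by positivity
  refine ⟨K.toReal ^ (1 / q) * g + 1, by positivity, ?_⟩
  intro u hu hcs
  have hu1 : ContDiff ℝ 1 u := hu.of_le (by exact_mod_cast le_top)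
  have huc : Continuous u := hu1.continuous
  have hdc : Continuous (fderiv ℝ u) := hu1.continuous_fderiv one_ne_zero
  have hgc : Continuous (gradNorm u) := by
    unfold gradNorm
    apply Real.continuous_sqrt.comp
    unfold pX pY
    fun_prop
  have hum := huc.measurable
  have hgm := hgc.measurable
  have hg0' : ∀ z, 0 ≤ gradNorm u z := fun z => Real.sqrt_nonneg _
  obtain ⟨R, hR0, hR⟩ := hcs.exists_pos_le_norm
  obtain ⟨R', hR0', hR'⟩ := (hcs.fderiv ℝ).exists_pos_le_norm
  -- the two integrands
  set X := ∫⁻ z in HS N, ENNReal.ofReal (|u z| ^ p * z.2 ^ c) with hX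
  set Y := ∫⁻ z in HS N, ENNReal.ofReal (z.2 ^ (-(2 * c) / ((N : ℝ) + 1)) * gradNorm u z ^ 2 *
    z.2 ^ c) with hY
  have hXi : ∫ z in HS N, |u z| ^ p * z.2 ^ c = X.toReal := by
    rw [integral_eq_lintegral_of_nonneg_ae]
    · filter_upwards [ae_restrict_mem (hs_measurable N)] with z hz
      have hz' : 0 < z.2 := hz
      simp only [Pi.zero_apply]; positivity
    · exact Measurable.aestronglyMeasurable (by fun_prop)
  have hYi : ∫ z in HS N, z.2 ^ (-(2 * c) / ((N : ℝ) + 1)) * gradNorm u z ^ 2 * z.2 ^ c =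
      Y.toReal := by
    rw [integral_eq_lintegral_of_nonneg_ae]
    · filter_upwards [ae_restrict_mem (hs_measurable N)] with z hz
      have hz' : 0 < z.2 := hz
      simp only [Pi.zero_apply]; positivity
    · exact Measurable.aestronglyMeasurable (by fun_prop)
  have hXf : X < ⊤ := by
    have := finite_aux N c hc' (fun z => |u z| ^ p)
      (huc.abs.rpow_const (fun _ => Or.inr hp0.le)) R hR0 (fun z hz => by
        simp only [hR z hz, abs_zero]; exact Real.zero_rpow hp0.ne')
    rw [hX, lintegral_congr (fun z => by rw [mul_comm])]; exact this
  have hYe : ∀ z ∈ HS N, z.2 ^ (-(2 * c) / ((N : ℝ) + 1)) * gradNorm u z ^ 2 * z.2 ^ c =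
      z.2 ^ e * gradNorm u z ^ 2 := by
    intro z hz
    rw [he, Real.rpow_add hz]; ring
  have hYf : Y < ⊤ := by
    have := finite_aux N e hea (fun z => gradNorm u z ^ 2) (hgc.pow 2) R' hR0' (fun z hz => by
        simp [gradNorm, pX, pY, hR' z hz])
    rw [hY, setLIntegral_congr_fun (hs_measurable N) (fun z hz => by rw [hYe z hz])]
    exact this
  -- apply the L1 estimate to |u|^γ
  set v : (Fin N → ℝ) × ℝ → ℝ := fun z => ‖u z‖ ^ γ with hv
  have hvC : ContDiff ℝ 1 v := hu1.norm_rpow hγ1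
  have hvcs : HasCompactSupport v := by
    apply hcs.comp_left (g := fun t : ℝ => ‖t‖ ^ γ)
    simp [Real.zero_rpow (by linarith : γ ≠ 0)]
  have hL := hmain v hvC hvcs
  have hvm := hvC.continuous.measurable
  have hdvm := (hvC.continuous_fderiv one_ne_zero).measurable
  have hLX : ∫⁻ y in Ioi (0:ℝ), ENNReal.ofReal (y ^ c) *
      ∫⁻ x : Fin N → ℝ, ‖v (x, y)‖ₑ ^ q = X := by
    rw [hX, hs_lintegral N _ (by fun_prop)]
    apply setLIntegral_congr_fun measurableSet_Ioi
    intro y hy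
    have hy0 : 0 < y := hy
    simp only
    rw [← lintegral_const_mul _ (by fun_prop)]
    congr 1; ext x
    rw [mul_comm (|u (x, y)| ^ p), ENNReal.ofReal_mul (by positivity)]
    congr 1
    simp only [hv]
    rw [Real.enorm_eq_ofReal (by positivity), ENNReal.ofReal_rpow_of_nonneg (by positivity) hq0.le,
      ← Real.rpow_mul (norm_nonneg _), hγq, Real.norm_eq_abs]
  have hT : ∫⁻ y in Ioi (0:ℝ), ENNReal.ofReal (y ^ β) *
      ∫⁻ x : Fin N → ℝ, ‖fderiv ℝ v (x, y)‖ₑ ≤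
      ENNReal.ofReal g * (X ^ (1 / 2 : ℝ) * Y ^ (1 / 2 : ℝ)) := by
    have e1 : ∫⁻ y in Ioi (0:ℝ), ENNReal.ofReal (y ^ β) *
        ∫⁻ x : Fin N → ℝ, ‖fderiv ℝ v (x, y)‖ₑ =
        ∫⁻ z in HS N, ENNReal.ofReal (z.2 ^ β) * ‖fderiv ℝ v z‖ₑ := by
      rw [hs_lintegral N _ (by fun_prop)]
      congr 1; ext y
      simp only
      rw [lintegral_const_mul _ (by fun_prop)]
    rw [e1]
    have hH := ENNReal.lintegral_mul_norm_pow_le (μ := volume.restrict (HS N))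
      (f := fun z => ENNReal.ofReal (|u z| ^ p * z.2 ^ c))
      (g := fun z => ENNReal.ofReal (z.2 ^ (-(2 * c) / ((N : ℝ) + 1)) * gradNorm u z ^ 2 *
        z.2 ^ c)) (by fun_prop) (by fun_prop) (p := 1 / 2) (q := 1 / 2)
      (by norm_num) (by norm_num) (by norm_num)
    refine le_trans ?_ (mul_le_mul_right hH _)
    rw [← lintegral_const_mul _ (by fun_prop)]
    apply setLIntegral_mono (by fun_prop)
    intro z hz
    have hz' : 0 < z.2 := hz
    rw [hYe z hz, ← ofReal_norm, ← ENNReal.ofReal_mul (by positivity),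
      ENNReal.ofReal_rpow_of_nonneg (by positivity) (by norm_num),
      ENNReal.ofReal_rpow_of_nonneg (by positivity) (by norm_num),
      ← ENNReal.ofReal_mul (by positivity), ← ENNReal.ofReal_mul (by positivity)]
    apply ENNReal.ofReal_le_ofReal
    have b1 : ‖fderiv ℝ v z‖ ≤ γ * ‖u z‖ ^ (γ - 1) * ‖fderiv ℝ u z‖ :=
      norm_fderiv_norm_rpow_le (hu1.differentiable one_ne_zero) hγ1
    have b2 := fderiv_le_gradNorm u z
    have r1 : (|u z| ^ p * z.2 ^ c) ^ (1 / 2 : ℝ) = ‖u z‖ ^ (γ - 1) * z.2 ^ (c / 2) := by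
      rw [Real.mul_rpow (by positivity) (by positivity), ← Real.rpow_mul (abs_nonneg _),
        ← Real.rpow_mul hz'.le, ← hγp, Real.norm_eq_abs]
      congr 2 <;> ring
    have r2 : (z.2 ^ e * gradNorm u z ^ 2) ^ (1 / 2 : ℝ) = z.2 ^ (e / 2) * gradNorm u z := by
      rw [Real.mul_rpow (by positivity) (by positivity), ← Real.rpow_mul hz'.le,
        ← Real.sqrt_eq_rpow, Real.sqrt_sq (hg0' z)]
      congr 2; ring
    rw [r1, r2]
    calc z.2 ^ β * ‖fderiv ℝ v z‖
        ≤ z.2 ^ β * (γ * ‖u z‖ ^ (γ - 1) * ((N + 1) * gradNorm u z)) := by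
          gcongr
          exact b1.trans (by gcongr)
      _ = _ := by
          rw [← he2, Real.rpow_add hz', hg]; ring
  rw [hLX] at hL
  have hfin := hL.trans (mul_le_mul_right (ENNReal.rpow_le_rpow hT hq0.le) K)
  -- pass to the reals
  rw [hXi, hYi]
  set x := X.toReal with hx
  set y := Y.toReal with hy
  have hx0 : 0 ≤ x := ENNReal.toReal_nonneg
  have hy0 : 0 ≤ y := ENNReal.toReal_nonneg
  have hreal : x ≤ K.toReal * (g * (x ^ (1 / 2 : ℝ) * y ^ (1 / 2 : ℝ))) ^ q := by
    have hne : K * (ENNReal.ofReal g * (X ^ (1 / 2 : ℝ) * Y ^ (1 / 2 : ℝ))) ^ q ≠ ⊤ := by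
      refine ENNReal.mul_ne_top hK (ENNReal.rpow_ne_top_of_nonneg hq0.le ?_)
      refine ENNReal.mul_ne_top (by simp) (ENNReal.mul_ne_top ?_ ?_)
      · exact ENNReal.rpow_ne_top_of_nonneg (by norm_num) hXf.ne
      · exact ENNReal.rpow_ne_top_of_nonneg (by norm_num) hYf.ne
    have := ENNReal.toReal_mono hne hfin
    simpa only [ENNReal.toReal_mul, ← ENNReal.toReal_rpow, ENNReal.toReal_ofReal hg0.le] using this
  have hk0 : 0 ≤ K.toReal := ENNReal.toReal_nonneg
  rcases hx0.eq_or_lt with h0 | hxpos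
  · rw [← h0, Real.zero_rpow (by positivity)]
    positivity
  have h1 := Real.rpow_le_rpow hx0 hreal (by positivity : 0 ≤ 1 / q)
  rw [Real.mul_rpow hk0 (by positivity), ← Real.rpow_mul (by positivity),
    mul_one_div_cancel hq0.ne', Real.rpow_one, hqp, Real.rpow_add hxpos, ← hqp] at h1
  have hxh : 0 < x ^ (1 / 2 : ℝ) := by positivity
  have h2 : x ^ (1 / p) ≤ K.toReal ^ (1 / q) * g * y ^ (1 / 2 : ℝ) := by
    refine le_of_mul_le_mul_right (h1.trans (le_of_eq ?_)) hxh
    ring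
  have hyh : 0 ≤ y ^ (1 / 2 : ℝ) := by positivity
  linarith
end
end

section
/- Let N > 1, −1 < c < 0 and r > 0, and set 2* = 2(N+1)/(N−1). Then there exists a constant C = C(r) > 0 such that for every u ∈ C_c^∞(cl(ℝ^{N+1}_+)) with supp u ⊆ ℝ^N × [0,r] one has ‖u‖_{L^{2*}_c} ≤ C ‖∇u‖_{L²_c}. -/
open MeasureTheory Real

noncomputable section

open Function Set in
lemma s8_grid {ι : Type*} [Fintype ι] [DecidableEq ι] (μ : ι → Measure ℝ) [∀ i, SigmaFinite (μ i)]
    {q : ℝ} (hq : Real.HolderConjugate (Fintype.card ι) q) {f : (ι → ℝ) → ℝ}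
    (hf : ContDiff ℝ 1 f) (K : ENNReal)
    (h : ∀ᵐ x ∂(Measure.pi μ), ∀ i, ‖f x‖ₑ ≤ ∫⁻ t, K * ‖fderiv ℝ f (update x i t)‖ₑ ∂μ i) :
    ∫⁻ x, ‖f x‖ₑ ^ q ∂(Measure.pi μ) ≤ (K * ∫⁻ x, ‖fderiv ℝ f x‖ₑ ∂(Measure.pi μ)) ^ q := by
  have h1 : (1 : ℝ) ≤ ↑(Fintype.card ι) - 1 := by
    have hι : (2 : ℝ) ≤ Fintype.card ι := by exact_mod_cast hq.lt
    linarith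
  have hm : Measurable fun x => ‖fderiv ℝ f x‖ₑ := by
    have := hf.continuous_fderiv one_ne_zero
    fun_prop
  calc ∫⁻ x, ‖f x‖ₑ ^ q ∂(Measure.pi μ)
      = ∫⁻ x, (‖f x‖ₑ ^ (1 / (Fintype.card ι - 1 : ℝ))) ^ (Fintype.card ι : ℝ) ∂(Measure.pi μ) := by
        congr! 2 with x
        rw [← ENNReal.rpow_mul, hq.conjugate_eq]
        field_simp
    _ = ∫⁻ x, ∏ _i : ι, ‖f x‖ₑ ^ (1 / (Fintype.card ι - 1 : ℝ)) ∂(Measure.pi μ) := by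
        congr! 2 with x
        simp_rw [Finset.prod_const]
        norm_cast
    _ ≤ ∫⁻ x, ∏ i, (∫⁻ t, (fun x => K * ‖fderiv ℝ f x‖ₑ) (update x i t) ∂μ i) ^
          ((1 : ℝ) / (Fintype.card ι - 1 : ℝ)) ∂(Measure.pi μ) := by
        apply lintegral_mono_ae
        filter_upwards [h] with x hx
        apply Finset.prod_le_prod' 
        intro i _
        exact ENNReal.rpow_le_rpow (hx i) (by positivity)
    _ ≤ (∫⁻ x, K * ‖fderiv ℝ f x‖ₑ ∂(Measure.pi μ)) ^ q := by
        apply lintegral_prod_lintegral_pow_le _ hq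
        exact hm.const_mul K
    _ = _ := by rw [lintegral_const_mul _ hm]

def s8nu (c : ℝ) : Measure ℝ :=
  (volume.restrict (Set.Ioi 0)).withDensity (fun y => ENNReal.ofReal (y ^ c))

lemma s8_meas (c : ℝ) : Measurable (fun y : ℝ => ENNReal.ofReal (y ^ c)) := by fun_prop

instance (c : ℝ) : SigmaFinite (s8nu c) := by
  unfold s8nu
  exact SigmaFinite.withDensity_of_ne_top (by simp)

lemma s8_finc (c : ℝ) (hc : -1 < c) : IsFiniteMeasureOnCompacts (s8nu c) := by
  constructor
  intro K hK
  obtain ⟨R, hR⟩ := hK.isBounded.subset_closedBall 0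
  have h1 : IntegrableOn (fun y : ℝ => y ^ c) (Set.Ioc 0 (max R 0)) volume := by
    rw [← intervalIntegrable_iff_integrableOn_Ioc_of_le (le_max_right _ _)]
    exact intervalIntegral.intervalIntegrable_rpow' hc
  have h2 : s8nu c K ≤ ∫⁻ y in Set.Ioc 0 (max R 0), ENNReal.ofReal (y ^ c) := by
    unfold s8nu
    rw [withDensity_apply _ hK.measurableSet, Measure.restrict_restrict hK.measurableSet]
    apply lintegral_mono_set
    rintro y ⟨hy, hy0⟩
    have := hR hy
    rw [Metric.mem_closedBall, dist_zero_right] at this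
    exact ⟨hy0, (le_abs_self y).trans (this.trans (le_max_left _ _))⟩
  exact h2.trans_lt h1.lintegral_lt_top

lemma s8_up {h : ℝ → ℝ} (hh : ContDiff ℝ 1 h) (hs : HasCompactSupport h) (a : ℝ) :
    ‖h a‖ₑ ≤ ∫⁻ t in Set.Ici a, ‖deriv h t‖ₑ := by
  have := HasCompactSupport.enorm_le_lintegral_Ici_deriv (f := fun t => h (-t))
    (hh.comp contDiff_neg) (hs.comp_homeomorph (Homeomorph.neg ℝ)) (-a)
  simp only [neg_neg, deriv_comp_neg, enorm_neg] at this
  refine this.trans (le_of_eq ?_)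
  rw [← (Measure.measurePreserving_neg (volume : Measure ℝ)).setLIntegral_comp_preimage_emb
    (MeasurableEquiv.neg ℝ).measurableEmbedding (fun t => ‖deriv h t‖ₑ)]
  simp

lemma s8_y (c r : ℝ) (hc₂ : c < 0) (hr : 0 < r) {h : ℝ → ℝ} (hh : ContDiff ℝ 1 h)
    (hs : HasCompactSupport h) (h0 : ∀ t, r < t → h t = 0) (a : ℝ) (ha : 0 < a) :
    ‖h a‖ₑ ≤ ∫⁻ t, ENNReal.ofReal (r ^ (-c)) * ‖deriv h t‖ₑ ∂(s8nu c) := by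
  have hm : Measurable fun t => ‖deriv h t‖ₑ := by
    have := hh.continuous_deriv le_rfl
    fun_prop
  unfold s8nu
  rw [lintegral_withDensity_eq_lintegral_mul _ (s8_meas c) (hm.const_mul _)]
  refine (s8_up hh hs a).trans ?_
  refine (lintegral_mono_set (t := Set.Ioi 0) (fun t ht => lt_of_lt_of_le ha ht)).trans ?_
  apply setLIntegral_mono' measurableSet_Ioi
  intro t ht
  have ht : 0 < t := ht
  simp only [Pi.mul_apply]
  rcases le_or_gt t r with htr | htr
  · rw [← mul_assoc, ← ENNReal.ofReal_mul (by positivity)]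
    have : 1 ≤ t ^ c * r ^ (-c) := by
      rw [Real.rpow_neg hr.le, ← div_eq_mul_inv, one_le_div (by positivity)]
      exact Real.rpow_le_rpow_of_nonpos ht htr hc₂.le
    calc _ = 1 * ‖deriv h t‖ₑ := (one_mul _).symm
      _ ≤ _ := by
        gcongr
        rw [← ENNReal.ofReal_one]
        exact ENNReal.ofReal_le_ofReal this
  · have : h =ᶠ[nhds t] fun _ => 0 := by
      filter_upwards [lt_mem_nhds htr] with s hs using h0 s hs
    rw [this.deriv_eq]
    simp

def s8mu (N : ℕ) (c : ℝ) : Fin (N+1) → Measure ℝ := Fin.cons (s8nu c) (fun _ => volume)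

instance (N : ℕ) (c : ℝ) (i : Fin (N+1)) : SigmaFinite (s8mu N c i) := by
  refine Fin.cases ?_ (fun j => ?_) i
  · change SigmaFinite (s8nu c); infer_instance
  · change SigmaFinite (volume : Measure ℝ); infer_instance

lemma s8_enorm_rpow_abs (x s : ℝ) (hs : 0 ≤ s) : ‖|x| ^ s‖ₑ = ‖x‖ₑ ^ s := by
  rw [Real.enorm_rpow_of_nonneg (abs_nonneg x) hs, Real.enorm_abs]

open Function in
lemma s8_ineq1 (N : ℕ) (hN : 1 < N) (c r : ℝ) (hc₂ : c < 0) (hr : 0 < r)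
    {f : (Fin (N+1) → ℝ) → ℝ} (hf : ContDiff ℝ 1 f) (hs : HasCompactSupport f)
    (h0 : ∀ w, r < w 0 → f w = 0) :
    ∫⁻ w, ‖f w‖ₑ ^ (((N:ℝ)+1)/N) ∂(Measure.pi (s8mu N c)) ≤
      (ENNReal.ofReal (1 + r ^ (-c)) * ∫⁻ w, ‖fderiv ℝ f w‖ₑ ∂(Measure.pi (s8mu N c))) ^
        (((N:ℝ)+1)/N) := by
  have hN' : (1:ℝ) < N := by exact_mod_cast hN
  apply s8_grid (s8mu N c) _ hf
  swap
  · rw [Real.holderConjugate_iff]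
    simp only [Fintype.card_fin]
    push_cast
    constructor
    · linarith
    · field_simp
      ring
  have hpos : ∀ᵐ w ∂(Measure.pi (s8mu N c)), 0 < w 0 := by
    have : ∀ᵐ y ∂(s8mu N c 0), 0 < y := by
      change ∀ᵐ y ∂(s8nu c), 0 < y
      unfold s8nu
      exact (withDensity_absolutelyContinuous _ _).ae_le (ae_restrict_mem measurableSet_Ioi)
    exact (Measure.quasiMeasurePreserving_eval (s8mu N c) 0).ae this
  filter_upwards [hpos] with w hw i
  have hd : ∀ t, ‖deriv (f ∘ update w i) t‖ₑ ≤ ‖fderiv ℝ f (update w i t)‖ₑ := by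
    intro y
    calc ‖deriv (f ∘ update w i) y‖ₑ = ‖fderiv ℝ f (update w i y) (deriv (update w i) y)‖ₑ := by
          rw [fderiv_comp_deriv _ (hf.differentiable one_ne_zero).differentiableAt
            (hasDerivAt_update w i y).differentiableAt]
      _ ≤ ‖fderiv ℝ f (update w i y)‖ₑ * ‖deriv (update w i) y‖ₑ :=
        ContinuousLinearMap.le_opENorm _ _
      _ ≤ ‖fderiv ℝ f (update w i y)‖ₑ := by
        simp [deriv_update, Pi.enorm_single]
  have hcd : ContDiff ℝ 1 (f ∘ update w i) := hf.comp (by convert! contDiff_update 1 w i)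
  have hcs : HasCompactSupport (f ∘ update w i) :=
    hs.comp_isClosedEmbedding (isClosedEmbedding_update w i)
  have hr' : 0 < r ^ (-c) := by positivity
  revert hd hcd hcs
  refine Fin.cases ?_ (fun j => ?_) i
  · intro hd hcd hcs
    have := s8_y c r hc₂ hr hcd hcs (fun t ht => h0 _ (by simpa using ht)) (w 0) hw
    simp only [comp_apply, update_eq_self] at this
    refine this.trans ?_
    change _ ≤ lintegral (s8nu c) _
    apply lintegral_mono
    intro t
    apply mul_le_mul' (ENNReal.ofReal_le_ofReal (by linarith)) (hd t)
  · intro hd hcd hcs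
    have := HasCompactSupport.enorm_le_lintegral_Ici_deriv hcd hcs (w j.succ)
    simp only [comp_apply, update_eq_self] at this
    refine this.trans ?_
    change _ ≤ lintegral volume _
    refine (setLIntegral_le_lintegral _ _).trans ?_
    apply lintegral_mono
    intro t
    calc _ ≤ 1 * ‖fderiv ℝ f (update w j.succ t)‖ₑ := by rw [one_mul]; exact hd t
      _ ≤ _ := by
        refine mul_le_mul' ?_ le_rfl
        rw [← ENNReal.ofReal_one]
        exact ENNReal.ofReal_le_ofReal (by linarith)

lemma s8_ineq2 (N : ℕ) (hN : 1 < N) (c r : ℝ) (hc₂ : c < 0) (hr : 0 < r)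
    {v : (Fin (N+1) → ℝ) → ℝ} (hv : ContDiff ℝ 1 v) (hs : HasCompactSupport v)
    (h0 : ∀ w, r < w 0 → v w = 0) (p : ℝ) (hp : p = 2 * ((N : ℝ) + 1) / ((N : ℝ) - 1))
    (hfin : ∫⁻ w, ‖v w‖ₑ ^ p ∂(Measure.pi (s8mu N c)) ≠ ⊤) :
    (∫⁻ w, ‖v w‖ₑ ^ p ∂(Measure.pi (s8mu N c))) ^ (1 / p) ≤
      ENNReal.ofReal ((1 + r ^ (-c)) * (2 * N / (N - 1))) *
      (∫⁻ w, ‖fderiv ℝ v w‖ₑ ^ (2:ℝ) ∂(Measure.pi (s8mu N c))) ^ (1 / 2 : ℝ) := by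
  have hN' : (1:ℝ) < N := by exact_mod_cast hN
  have hN1 : (0:ℝ) < N - 1 := by linarith
  have hr' : 0 < r ^ (-c) := by positivity
  set g : ℝ := 2 * N / (N - 1) with hg
  have hg1 : 1 < g := by rw [hg, one_lt_div hN1]; linarith
  have hp0 : 0 < p := by rw [hp]; positivity
  set A := ∫⁻ w, ‖v w‖ₑ ^ p ∂(Measure.pi (s8mu N c)) with hA
  set B := ∫⁻ w, ‖fderiv ℝ v w‖ₑ ^ (2:ℝ) ∂(Measure.pi (s8mu N c)) with hB
  have key := s8_ineq1 N hN c r hc₂ hr (f := fun w => ‖v w‖ ^ g) (hv.norm_rpow hg1)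
    (hs.comp_left (g := fun x => ‖x‖ ^ g) (by simp; exact Real.zero_rpow (by linarith)))
    (fun w hw => by simp [h0 w hw]; rw [Real.zero_rpow (by linarith)])
  have e1 : ∀ w, ‖‖v w‖ ^ g‖ₑ ^ (((N:ℝ)+1)/N) = ‖v w‖ₑ ^ p := by
    intro w
    rw [Real.norm_eq_abs, s8_enorm_rpow_abs _ _ (by linarith), ← ENNReal.rpow_mul]
    congr 1
    rw [hg, hp]; field_simp
  simp only [e1] at key
  have hmv : Measurable v := hv.continuous.measurable
  have hmd : Measurable (fun w => ‖fderiv ℝ v w‖ₑ) := by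
    have := hv.continuous_fderiv one_ne_zero
    fun_prop
  have h2 : ∫⁻ w, ‖fderiv ℝ (fun w => ‖v w‖ ^ g) w‖ₑ ∂(Measure.pi (s8mu N c)) ≤
      ENNReal.ofReal g * (A ^ (1/2:ℝ) * B ^ (1/2:ℝ)) := by
    calc _ ≤ ∫⁻ w, ENNReal.ofReal g * (‖v w‖ₑ ^ (p/2) * ‖fderiv ℝ v w‖ₑ) ∂(Measure.pi (s8mu N c)) := by
          apply lintegral_mono
          intro w
          have := norm_fderiv_norm_rpow_le (hv.differentiable one_ne_zero) (x := w) hg1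
          have e2 : g - 1 = p / 2 := by rw [hg, hp]; field_simp; ring
          rw [e2] at this
          change ‖_‖ₑ ≤ _
          rw [← ofReal_norm]
          refine (ENNReal.ofReal_le_ofReal this).trans (le_of_eq ?_)
          rw [ENNReal.ofReal_mul (by positivity), ENNReal.ofReal_mul (by positivity), ofReal_norm,
            ← ENNReal.ofReal_rpow_of_nonneg (norm_nonneg _) (by positivity), ofReal_norm, mul_assoc]
      _ = ENNReal.ofReal g * ∫⁻ w, ((fun w => ‖v w‖ₑ ^ (p/2)) * fun w => ‖fderiv ℝ v w‖ₑ) w ∂(Measure.pi (s8mu N c)) := by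
          rw [← lintegral_const_mul]
          · rfl
          · exact (hmv.enorm.pow_const _).mul hmd
      _ ≤ _ := by
          gcongr
          have := ENNReal.lintegral_mul_le_Lp_mul_Lq (Measure.pi (s8mu N c)) (p := 2) (q := 2)
            (by rw [Real.holderConjugate_iff]; norm_num) (hmv.enorm.pow_const (p/2)).aemeasurable hmd.aemeasurable
          refine this.trans (le_of_eq ?_)
          rw [hA, hB]
          congr! 4 with w
          rw [← ENNReal.rpow_mul]; congr 1; ring
  have hA1 : A ^ ((N:ℝ)/(N+1)) ≤ ENNReal.ofReal ((1 + r ^ (-c)) * g) * B ^ (1/2:ℝ) * A ^ (1/2:ℝ) := by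
    have := ENNReal.rpow_le_rpow key (z := (N:ℝ)/(N+1)) (by positivity)
    rw [← ENNReal.rpow_mul] at this
    rw [show ((N:ℝ)+1)/N * (N/(N+1)) = 1 by field_simp, ENNReal.rpow_one] at this
    refine this.trans ?_
    refine (mul_le_mul_right h2 _).trans (le_of_eq ?_)
    rw [ENNReal.ofReal_mul (by positivity)]
    ring
  rcases eq_or_ne A 0 with hA0 | hA0
  · rw [hA0, ENNReal.zero_rpow_of_pos (by positivity)]; exact zero_le
  have e3 : (N:ℝ)/(N+1) = 1/p + 1/2 := by rw [hp]; field_simp; ring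
  rw [e3, ENNReal.rpow_add _ _ hA0 hfin] at hA1
  refine (ENNReal.mul_le_mul_iff_left ?_ ?_).1 hA1
  · simp [ENNReal.rpow_eq_zero_iff, hA0, hfin]
  · exact ENNReal.rpow_ne_top_of_nonneg (by norm_num) hfin

def s8Phi (N : ℕ) : (Fin (N+1) → ℝ) ≃ₜ (Fin N → ℝ) × ℝ where
  toFun w := (fun j => w j.succ, w 0)
  invFun z := Fin.cons z.2 z.1
  left_inv w := by
    funext i
    refine Fin.cases ?_ (fun j => ?_) i <;> simp
  right_inv z := by simp
  continuous_toFun := by fun_prop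
  continuous_invFun := by
    refine continuous_pi (fun i => ?_)
    refine Fin.cases ?_ (fun j => ?_) i
    · simpa using continuous_snd
    · simp only [Fin.cons_succ]; fun_prop

def s8L (N : ℕ) : (Fin (N+1) → ℝ) →L[ℝ] (Fin N → ℝ) × ℝ :=
  (ContinuousLinearMap.pi fun j => ContinuousLinearMap.proj j.succ).prod (ContinuousLinearMap.proj 0)

lemma s8_mp (N : ℕ) (c : ℝ) : MeasurePreserving (s8Phi N) (Measure.pi (s8mu N c))
    ((volume : Measure (Fin N → ℝ)).prod (s8nu c)) := by
  have h := measurePreserving_piFinSuccAbove (s8mu N c) 0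
  have h2 := (Measure.measurePreserving_swap (μ := s8nu c) (ν := (volume : Measure (Fin N → ℝ))))
  exact h2.comp h

lemma s8_prod (N : ℕ) (c : ℝ) : (volume : Measure (Fin N → ℝ)).prod (s8nu c) =
    ((volume : Measure ((Fin N → ℝ) × ℝ)).restrict (HS N)).withDensity
      (fun z => ENNReal.ofReal (z.2 ^ c)) := by
  unfold s8nu
  rw [prod_withDensity_right (s8_meas c)]
  congr 1
  have : HS N = Set.univ ×ˢ Set.Ioi 0 := by ext z; simp [HS]
  rw [this, Measure.volume_eq_prod, ← Measure.prod_restrict, Measure.restrict_univ]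

lemma s8_int (N : ℕ) (c : ℝ) {g : (Fin N → ℝ) × ℝ → ℝ} (hg : Continuous g) (h0 : ∀ z, 0 ≤ g z) :
    ∫ z in HS N, g z * z.2 ^ c =
      (∫⁻ z, ENNReal.ofReal (g z) ∂((volume : Measure (Fin N → ℝ)).prod (s8nu c))).toReal := by
  have hHS : MeasurableSet (HS N) := measurableSet_lt measurable_const measurable_snd
  have hgm := hg.measurable
  rw [integral_eq_lintegral_of_nonneg_ae, s8_prod, lintegral_withDensity_eq_lintegral_mul]
  · congr 1
    apply setLIntegral_congr_fun hHS
    intro z hz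
    simp only [Pi.mul_apply]
    rw [ENNReal.ofReal_mul (h0 z), mul_comm]
  · fun_prop
  · fun_prop
  · filter_upwards [ae_restrict_mem hHS] with z hz
    have hz : 0 < z.2 := hz
    have := h0 z
    simp only [Pi.zero_apply]
    positivity
  · apply Measurable.aestronglyMeasurable
    fun_prop

lemma s8_fin (N : ℕ) (c : ℝ) (hc : -1 < c) {g : (Fin N → ℝ) × ℝ → ℝ} (hg : Continuous g)
    (hs : HasCompactSupport g) :
    ∫⁻ z, ENNReal.ofReal (g z) ∂((volume : Measure (Fin N → ℝ)).prod (s8nu c)) ≠ ⊤ := by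
  have := s8_finc c hc
  exact (hg.integrable_of_hasCompactSupport hs).lintegral_lt_top.ne

lemma s8_grad (N : ℕ) {u : (Fin N → ℝ) × ℝ → ℝ} (hu : ContDiff ℝ 1 u) (w : Fin (N+1) → ℝ) :
    ‖fderiv ℝ (u ∘ s8Phi N) w‖ ≤ (N + 1) * gradNorm u (s8Phi N w) := by
  have h1 : fderiv ℝ (u ∘ s8Phi N) w = (fderiv ℝ u (s8Phi N w)).comp (s8L N) := by
    have ha : HasFDerivAt u (fderiv ℝ u (s8Phi N w)) (s8L N w) :=
      (hu.differentiable one_ne_zero (s8Phi N w)).hasFDerivAt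
    exact (ha.comp w (s8L N).hasFDerivAt).fderiv
  rw [h1]
  set z := s8Phi N w
  have hg0 : 0 ≤ gradNorm u z := Real.sqrt_nonneg _
  have hX : ∀ i, |pX u i z| ≤ gradNorm u z := by
    intro i
    apply Real.abs_le_sqrt
    have := Finset.single_le_sum (f := fun i => pX u i z ^ 2) (fun i _ => sq_nonneg _)
      (Finset.mem_univ i)
    have h2 := sq_nonneg (pY u z)
    linarith
  have hY : |pY u z| ≤ gradNorm u z := by
    apply Real.abs_le_sqrt
    have := Finset.sum_nonneg (s := Finset.univ) (f := fun i => pX u i z ^ 2)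
      (fun i _ => sq_nonneg _)
    linarith
  apply ContinuousLinearMap.opNorm_le_bound _ (by positivity)
  intro h
  have e : ((fderiv ℝ u z).comp (s8L N)) h = (∑ i, h i.succ * pX u i z) + h 0 * pY u z := by
    have : s8L N h = (∑ i : Fin N, h i.succ • ((Pi.single i 1, 0) : (Fin N → ℝ) × ℝ))
        + h 0 • ((0, 1) : (Fin N → ℝ) × ℝ) := by
      ext j
      · simp [s8L, Prod.fst_sum, Finset.sum_apply, Pi.single_apply]
      · simp [s8L, Prod.snd_sum]
    rw [ContinuousLinearMap.comp_apply, this, map_add, map_sum, map_smul]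
    simp only [map_smul, smul_eq_mul, pX, pY]
  rw [e]
  have hb : ∀ i, |h i| ≤ ‖h‖ := fun i => norm_le_pi_norm h i
  calc ‖(∑ i, h i.succ * pX u i z) + h 0 * pY u z‖
      ≤ ‖∑ i, h i.succ * pX u i z‖ + ‖h 0 * pY u z‖ := norm_add_le _ _
    _ ≤ (∑ i : Fin N, ‖h i.succ * pX u i z‖) + ‖h 0 * pY u z‖ := by gcongr; exact norm_sum_le _ _
    _ ≤ (∑ i : Fin N, ‖h‖ * gradNorm u z) + ‖h‖ * gradNorm u z := by
        gcongr with i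
        · rw [norm_mul]; exact mul_le_mul (hb _) (hX _) (norm_nonneg _) (norm_nonneg _)
        · rw [norm_mul]; exact mul_le_mul (hb _) hY (norm_nonneg _) (norm_nonneg _)
    _ = _ := by simp; ring

/-- for `N > 1`, `−1 < c < 0` and `r > 0`, with `p = 2* = 2(N+1)/(N−1)`,
`‖u‖_{L^{2*}_c} ≤ C(r) ‖∇u‖_{L²_c}` for all smooth compactly supported `u` on the
closed half-space supported in `ℝ^N × [0,r]`. -/
theorem stmt_8 (N : ℕ) (hN : 1 < N) (c : ℝ) (hc₁ : -1 < c) (hc₂ : c < 0)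
    (r : ℝ) (hr : 0 < r) (p : ℝ) (hp : p = 2 * ((N : ℝ) + 1) / ((N : ℝ) - 1)) :
    ∃ C > 0, ∀ u : ((Fin N → ℝ) × ℝ) → ℝ, ContDiff ℝ (⊤ : ℕ∞) u → HasCompactSupport u →
      (∀ z : (Fin N → ℝ) × ℝ, r < z.2 → u z = 0) →
      (∫ z in HS N, |u z| ^ p * z.2 ^ c) ^ (1 / p) ≤
        C * (∫ z in HS N, gradNorm u z ^ 2 * z.2 ^ c) ^ (1 / 2 : ℝ) := by
  have hN' : (1:ℝ) < N := by exact_mod_cast hN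
  have hN1 : (0:ℝ) < N - 1 := by linarith
  have hr' : 0 < r ^ (-c) := by positivity
  have hp0 : 0 < p := by rw [hp]; positivity
  set K : ℝ := (1 + r ^ (-c)) * (2 * N / (N - 1)) with hK
  have hK0 : 0 < K := by positivity
  refine ⟨K * (N + 1), by positivity, fun u hu' hs h0 => ?_⟩
  have hu : ContDiff ℝ 1 u := hu'.of_le (by exact_mod_cast le_top)
  have hdc : Continuous (fderiv ℝ u) := hu.continuous_fderiv one_ne_zero
  have hgc : Continuous (gradNorm u) := by
    unfold gradNorm pX pY
    fun_prop
  have hgs : HasCompactSupport (fun z => gradNorm u z ^ 2) := by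
    refine (hs.fderiv (𝕜 := ℝ)).comp_left (g := fun l : ((Fin N → ℝ) × ℝ) →L[ℝ] ℝ =>
      Real.sqrt ((∑ i, l (Pi.single i 1, 0) ^ 2) + l (0, 1) ^ 2) ^ 2) ?_
    simp
  have huc := hu.continuous
  have hpc : Continuous (fun z => |u z| ^ p) :=
    huc.abs.rpow_const (fun _ => Or.inr hp0.le)
  have hps : HasCompactSupport (fun z => |u z| ^ p) :=
    hs.comp_left (g := fun x => |x| ^ p) (by simp; exact Real.zero_rpow hp0.ne')
  have hgc2 : Continuous (fun z => gradNorm u z ^ 2) := hgc.pow 2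
  have fA := s8_fin N c hc₁ hpc hps
  have fB := s8_fin N c hc₁ hgc2 hgs
  rw [s8_int N c hpc (fun z => by positivity), s8_int N c hgc2 (fun z => by positivity)]
  have hemb := (s8Phi N).measurableEmbedding
  have eA : ∫⁻ w, ‖(u ∘ s8Phi N) w‖ₑ ^ p ∂(Measure.pi (s8mu N c)) =
      ∫⁻ z, ENNReal.ofReal (|u z| ^ p) ∂((volume : Measure (Fin N → ℝ)).prod (s8nu c)) := by
    rw [← (s8_mp N c).lintegral_comp_emb hemb]
    congr! 2 with w
    rw [← ENNReal.ofReal_rpow_of_nonneg (abs_nonneg _) hp0.le, ← Real.norm_eq_abs, ofReal_norm]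
    rfl
  have eB : ∫⁻ w, ‖fderiv ℝ (u ∘ s8Phi N) w‖ₑ ^ (2:ℝ) ∂(Measure.pi (s8mu N c)) ≤
      ENNReal.ofReal (N + 1) ^ (2:ℝ) *
      ∫⁻ z, ENNReal.ofReal (gradNorm u z ^ 2) ∂((volume : Measure (Fin N → ℝ)).prod (s8nu c)) := by
    rw [← (s8_mp N c).lintegral_comp_emb hemb, ← lintegral_const_mul' _ _ (by finiteness)]
    apply lintegral_mono
    intro w
    have h1 := ENNReal.ofReal_le_ofReal (s8_grad N hu w)
    rw [ofReal_norm, ENNReal.ofReal_mul (by positivity)] at h1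
    have h2 := ENNReal.rpow_le_rpow h1 (z := 2) (by norm_num)
    refine h2.trans (le_of_eq ?_)
    rw [ENNReal.mul_rpow_of_nonneg _ _ (by norm_num)]
    have hg0 : 0 ≤ gradNorm u (s8Phi N w) := Real.sqrt_nonneg _
    beta_reduce
    rw [ENNReal.ofReal_pow hg0]
    congr 1
    exact_mod_cast ENNReal.rpow_natCast _ 2
  have hvc : ContDiff ℝ 1 (u ∘ s8Phi N) := hu.comp (s8L N).contDiff
  have main := s8_ineq2 N hN c r hc₂ hr hvc (hs.comp_homeomorph (s8Phi N))
    (fun w hw => h0 _ hw) p hp (by rw [eA]; exact fA)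
  rw [eA] at main
  set A := ∫⁻ z, ENNReal.ofReal (|u z| ^ p) ∂((volume : Measure (Fin N → ℝ)).prod (s8nu c))
  set B := ∫⁻ z, ENNReal.ofReal (gradNorm u z ^ 2) ∂((volume : Measure (Fin N → ℝ)).prod (s8nu c))
  have main2 : A ^ (1 / p) ≤ ENNReal.ofReal (K * (N + 1)) * B ^ (1 / 2 : ℝ) := by
    refine main.trans ?_
    refine (mul_le_mul_right (ENNReal.rpow_le_rpow eB (by norm_num)) _).trans (le_of_eq ?_)
    rw [ENNReal.mul_rpow_of_nonneg _ _ (by norm_num), ← ENNReal.rpow_mul,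
      ENNReal.ofReal_mul hK0.le]
    norm_num
    ring
  have fB' : B ^ (1 / 2 : ℝ) ≠ ⊤ := ENNReal.rpow_ne_top_of_nonneg (by norm_num) fB
  have := ENNReal.toReal_mono (ENNReal.mul_ne_top ENNReal.ofReal_ne_top fB') main2
  rwa [ENNReal.toReal_mul, ENNReal.toReal_ofReal (by positivity), ← ENNReal.toReal_rpow,
    ← ENNReal.toReal_rpow] at this
end
end

section
/- Let N ≥ 1, −1 < c < 0, r > 0, and let q ∈ (2,∞) satisfy 1/q ≥ 1/2 − 1/(N+1). Set θ = (N+1)(1/2 − 1/q). Then there exists a constant C > 0 such that for every u ∈ C_c^∞(cl(ℝ^{N+1}_+)) with supp u ⊆ ℝ^N × [0,r] one has ‖u‖_{L^q_c} ≤ C ‖∇u‖_{L²_c}^{θ} ‖u‖_{L²_c}^{1−θ}. -/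
open MeasureTheory Real

noncomputable section

open Set Filter Topology
open scoped ENNReal

def muY (c : ℝ) : Measure ℝ :=
  (volume.restrict (Ioi 0)).withDensity (fun y => ENNReal.ofReal (y ^ c))

def nuM (N : ℕ) (c : ℝ) : Measure ((Fin N → ℝ) × ℝ) := (volume : Measure (Fin N → ℝ)).prod (muY c)

def muI (N : ℕ) (c : ℝ) : Fin (N + 1) → Measure ℝ :=
  Fin.cons (muY c) (fun _ => volume)

instance (c : ℝ) : SigmaFinite (muY c) := by
  unfold muY; infer_instance

instance (N : ℕ) (c : ℝ) (i : Fin (N + 1)) : SigmaFinite (muI N c i) := by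
  refine Fin.cases ?_ (fun j => ?_) i
  · simp only [muI, Fin.cons_zero]; infer_instance
  · simp only [muI, Fin.cons_succ]; infer_instance

def eqv (N : ℕ) : (Fin (N + 1) → ℝ) ≃ᵐ ((Fin N → ℝ) × ℝ) :=
  (MeasurableEquiv.piFinSuccAbove (fun _ => ℝ) 0).trans MeasurableEquiv.prodComm

lemma eqv_apply (N : ℕ) (x : Fin (N + 1) → ℝ) : eqv N x = (fun i => x i.succ, x 0) := by
  simp [eqv, MeasurableEquiv.trans, MeasurableEquiv.piFinSuccAbove, MeasurableEquiv.prodComm]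
  rfl

lemma eqv_mp (N : ℕ) (c : ℝ) : MeasurePreserving (eqv N) (Measure.pi (muI N c)) (nuM N c) := by
  have h1 := measurePreserving_piFinSuccAbove (muI N c) 0
  have h2 : MeasurePreserving (MeasurableEquiv.prodComm : ℝ × (Fin N → ℝ) ≃ᵐ _)
     ((muI N c 0).prod (Measure.pi fun j => muI N c (Fin.succAbove 0 j))) (nuM N c) := by
    have := Measure.measurePreserving_swap (μ := muY c) (ν := (volume : Measure (Fin N → ℝ)))
    simp only [nuM, muI, volume_pi] at this ⊢
    exact this
  exact h2.comp h1

lemma muY_ae (c : ℝ) : ∀ᵐ y ∂(muY c), 0 < y := by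
  have : muY c ≪ volume.restrict (Ioi 0) := withDensity_absolutelyContinuous _ _
  exact this.ae_le (ae_restrict_mem measurableSet_Ioi)

lemma nuM_ae (N : ℕ) (c : ℝ) : ∀ᵐ z ∂(nuM N c), 0 < z.2 :=
  Measure.quasiMeasurePreserving_snd.ae (muY_ae c)

lemma grid (N : ℕ) (hN : 1 ≤ N) (c : ℝ) (F W : (Fin N → ℝ) × ℝ → ℝ≥0∞) (hF : Measurable F)
    (hx : ∀ z : (Fin N → ℝ) × ℝ, 0 < z.2 → ∀ i, W z ≤ ∫⁻ t, F (Function.update z.1 i t, z.2))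
    (hy : ∀ z : (Fin N → ℝ) × ℝ, 0 < z.2 → W z ≤ ∫⁻ t, F (z.1, t) ∂(muY c)) :
    ∫⁻ z, W z ^ (((N : ℝ) + 1) / N) ∂(nuM N c) ≤ (∫⁻ z, F z ∂(nuM N c)) ^ (((N : ℝ) + 1) / N) := by
  have hN' : (1 : ℝ) ≤ N := by exact_mod_cast hN
  have hc : Real.HolderConjugate (Fintype.card (Fin (N + 1)) : ℝ) (((N : ℝ) + 1) / N) := by
    rw [Real.holderConjugate_iff]
    simp only [Fintype.card_fin]
    push_cast
    constructor
    · linarith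
    · field_simp
      ring
  have key := lintegral_prod_lintegral_pow_le (muI N c) hc (hF.comp (eqv N).measurable)
  have h2 : ∫⁻ x, F (eqv N x) ∂(Measure.pi (muI N c)) = ∫⁻ z, F z ∂(nuM N c) :=
    (eqv_mp N c).lintegral_comp_emb (eqv N).measurableEmbedding F
  have h1 : ∫⁻ x, (W (eqv N x)) ^ (((N : ℝ) + 1) / N) ∂(Measure.pi (muI N c))
      = ∫⁻ z, W z ^ (((N : ℝ) + 1) / N) ∂(nuM N c) :=
    (eqv_mp N c).lintegral_comp_emb (eqv N).measurableEmbedding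
      (fun z => W z ^ (((N : ℝ) + 1) / N))
  rw [← h1, ← h2]
  refine le_trans (lintegral_mono_ae ?_) key
  have hpos := (eqv_mp N c).quasiMeasurePreserving.ae (nuM_ae N c)
  filter_upwards [hpos] with x hx0
  have e1 : W (eqv N x) ^ (((N : ℝ) + 1) / N)
      = ∏ i : Fin (N + 1), W (eqv N x) ^ ((1 : ℝ) / ((Fintype.card (Fin (N + 1)) : ℝ) - 1)) := by
    rw [Finset.prod_const, ← ENNReal.rpow_natCast, ← ENNReal.rpow_mul]
    congr 1
    simp
    field_simp
  rw [e1]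
  refine Finset.prod_le_prod' (fun i _ => ?_)
  have hex : (0 : ℝ) ≤ (1 : ℝ) / ((Fintype.card (Fin (N + 1)) : ℝ) - 1) := by
    simp
  refine ENNReal.rpow_le_rpow ?_ hex
  refine Fin.cases ?_ (fun j => ?_) i
  · refine (hy _ hx0).trans (le_of_eq ?_)
    simp only [muI, Fin.cons_zero, Function.comp]
    congr 1
  · refine (hx _ hx0 j).trans (le_of_eq ?_)
    simp only [muI, Fin.cons_succ, Function.comp]
    congr 1; ext t
    congr 1
    simp only [eqv_apply, Prod.mk.injEq]
    constructor
    · ext k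
      by_cases hk : k = j
      · subst hk; simp
      · simp [Function.update_of_ne, hk]
    · rw [Function.update_of_ne]
      exact (Fin.succ_ne_zero j).symm

lemma oneD (g : ℝ → ℝ) (hg : ContDiff ℝ 1 g) (hs : HasCompactSupport g) (γ : ℝ) (hγ : 1 < γ)
    (t : ℝ) : ENNReal.ofReal (|g t| ^ γ) ≤
      ∫⁻ s in Ioi t, ENNReal.ofReal (γ * (|g s| ^ (γ - 1) * |deriv g s|)) := by
  have hw : ContDiff ℝ 1 (fun s => |g s| ^ γ) := by
    simpa using hg.norm_rpow hγ
  have hws : HasCompactSupport (fun s => |g s| ^ γ) :=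
    hs.comp_left (g := fun v => |v| ^ γ) (by simp [Real.zero_rpow (by linarith : γ ≠ 0)])
  have h := hws.integral_Ioi_deriv_eq hw t
  have h0 : 0 ≤ |g t| ^ γ := by positivity
  have hd : ∀ s, ‖deriv (fun s => |g s| ^ γ) s‖ₑ =
      ENNReal.ofReal (γ * (|g s| ^ (γ - 1) * |deriv g s|)) := by
    intro s
    have h1 : HasDerivAt g (deriv g s) s := (hg.differentiable (by norm_num) s).hasDerivAt
    have h2 := (hasDerivAt_abs_rpow (g s) hγ).comp s h1
    have h3 : deriv (fun s => |g s| ^ γ) s = γ * |g s| ^ (γ - 2) * g s * deriv g s := h2.deriv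
    rw [h3, ← ofReal_norm]
    congr 1
    rw [Real.norm_eq_abs, abs_mul, abs_mul, abs_mul, abs_of_pos (by linarith : 0 < γ),
      abs_of_nonneg (by positivity : 0 ≤ |g s| ^ (γ - 2))]
    have : |g s| ^ (γ - 2) * |g s| = |g s| ^ (γ - 1) := by
      by_cases h : g s = 0
      · simp [h]; rw [Real.zero_rpow]; linarith
      · rw [← Real.rpow_add_one (by simpa using h)]; congr 1; ring
    rw [← this]; ring
  calc ENNReal.ofReal (|g t| ^ γ) = ‖∫ s in Ioi t, deriv (fun s => |g s| ^ γ) s‖ₑ := by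
        rw [h, enorm_neg, ← ofReal_norm, Real.norm_of_nonneg h0]
    _ ≤ ∫⁻ s in Ioi t, ‖deriv (fun s => |g s| ^ γ) s‖ₑ := enorm_integral_le_lintegral_enorm _
    _ = _ := by simp_rw [hd]

lemma nuM_eq (N : ℕ) (c : ℝ) : nuM N c =
    ((volume : Measure ((Fin N → ℝ) × ℝ)).restrict (HS N)).withDensity
      (fun z => ENNReal.ofReal (z.2 ^ c)) := by
  unfold nuM muY
  rw [prod_withDensity_right (by fun_prop)]
  congr 1
  have : HS N = univ ×ˢ Ioi (0 : ℝ) := by ext z; simp [HS]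
  rw [this, Measure.volume_eq_prod, ← Measure.prod_restrict, Measure.restrict_univ]

lemma int_eq (N : ℕ) (c : ℝ) (F : (Fin N → ℝ) × ℝ → ℝ) (hF : Continuous F) (h0 : ∀ z, 0 ≤ F z) :
    ∫ z in HS N, F z * z.2 ^ c = (∫⁻ z, ENNReal.ofReal (F z) ∂(nuM N c)).toReal := by
  have hm : MeasurableSet (HS N) := measurableSet_lt measurable_const measurable_snd
  rw [nuM_eq, lintegral_withDensity_eq_lintegral_mul _ (by fun_prop) (by fun_prop)]
  rw [integral_eq_lintegral_of_nonneg_ae]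
  · congr 1
    apply lintegral_congr
    intro z
    simp only [Pi.mul_apply]
    rw [mul_comm, ENNReal.ofReal_mul' (h0 z)]
  · filter_upwards [ae_restrict_mem hm] with z hz
    exact mul_nonneg (h0 z) (Real.rpow_nonneg (le_of_lt hz) c)
  · exact Measurable.aestronglyMeasurable (by fun_prop)

lemma fin_int (N : ℕ) (c : ℝ) (hc : -1 < c) (F : (Fin N → ℝ) × ℝ → ℝ) (hF : Continuous F)
    (hs : HasCompactSupport F) : ∫⁻ z, ENNReal.ofReal (F z) ∂(nuM N c) ≠ ∞ := by
  obtain ⟨R, hR⟩ := hs.isCompact.isBounded.subset_closedBall 0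
  obtain ⟨B, hB⟩ := hs.exists_bound_of_continuous hF
  set S : Set ((Fin N → ℝ) × ℝ) := Metric.closedBall 0 R ×ˢ Icc (-R) R with hS
  have hle : ∀ z, ENNReal.ofReal (F z) ≤ S.indicator (fun _ => ENNReal.ofReal B) z := by
    intro z
    by_cases hz : z ∈ S
    · rw [indicator_of_mem hz]
      exact ENNReal.ofReal_le_ofReal ((le_abs_self _).trans (hB z))
    · rw [indicator_of_notMem hz]
      have : F z = 0 := by
        by_contra hne
        have h1 := hR (subset_tsupport F hne)
        apply hz
        rw [mem_closedBall_zero_iff, Prod.norm_def, max_le_iff] at h1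
        exact ⟨by simpa using h1.1, abs_le.1 h1.2⟩
      simp [this]
  refine ne_top_of_le_ne_top ?_ (lintegral_mono hle)
  have hSm : MeasurableSet S := Metric.isClosed_closedBall.measurableSet.prod measurableSet_Icc
  rw [lintegral_indicator_const hSm]
  refine ENNReal.mul_ne_top ENNReal.ofReal_ne_top ?_
  rw [hS, nuM, Measure.prod_prod]
  refine ENNReal.mul_ne_top (measure_closedBall_lt_top).ne ?_
  rw [muY, withDensity_apply _ measurableSet_Icc, Measure.restrict_restrict measurableSet_Icc]
  have hInt : IntegrableOn (fun y : ℝ => y ^ c) (Icc (-R) R ∩ Ioi 0) := by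
    have h1 : IntervalIntegrable (fun y : ℝ => y ^ c) volume 0 (max R 0) :=
      intervalIntegral.intervalIntegrable_rpow' hc
    rw [intervalIntegrable_iff_integrableOn_Ioc_of_le (le_max_right _ _)] at h1
    exact h1.mono_set (fun y hy => ⟨hy.2, hy.1.2.trans (le_max_left _ _)⟩)
  exact hInt.lintegral_lt_top.ne

lemma gradNorm_cont {N : ℕ} (u : ((Fin N → ℝ) × ℝ) → ℝ) (hu : ContDiff ℝ (⊤ : ℕ∞) u) :
    Continuous (gradNorm u) := by
  have h : Continuous (fderiv ℝ u) := hu.continuous_fderiv (by simp)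
  unfold gradNorm pX pY
  fun_prop

lemma gradNorm_nonneg {N : ℕ} (u : ((Fin N → ℝ) × ℝ) → ℝ) (z) : 0 ≤ gradNorm u z :=
  Real.sqrt_nonneg _

lemma pX_le {N : ℕ} (u : ((Fin N → ℝ) × ℝ) → ℝ) (i : Fin N) (z) : |pX u i z| ≤ gradNorm u z := by
  apply Real.abs_le_sqrt
  have := Finset.single_le_sum (f := fun i => pX u i z ^ 2) (fun j _ => sq_nonneg _)
    (Finset.mem_univ i)
  nlinarith [sq_nonneg (pY u z)]

lemma pY_le {N : ℕ} (u : ((Fin N → ℝ) × ℝ) → ℝ) (z) : |pY u z| ≤ gradNorm u z := by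
  apply Real.abs_le_sqrt
  have : 0 ≤ ∑ i, pX u i z ^ 2 := Finset.sum_nonneg (fun j _ => sq_nonneg _)
  linarith

lemma gradNorm_supp {N : ℕ} (u : ((Fin N → ℝ) × ℝ) → ℝ) (hs : HasCompactSupport u) :
    HasCompactSupport (gradNorm u) := by
  have h := hs.fderiv (𝕜 := ℝ)
  refine h.mono ?_
  intro z hz
  contrapose! hz
  have : fderiv ℝ u z = 0 := by simpa using hz
  simp [gradNorm, pX, pY, this]

/-- weighted W^{1,1}-type step -/
lemma main_step (N : ℕ) (hN : 1 ≤ N) (c : ℝ) (hc₂ : c < 0)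
    (r : ℝ) (hr : 0 < r) (γ : ℝ) (hγ : 1 < γ) (u : ((Fin N → ℝ) × ℝ) → ℝ)
    (hu : ContDiff ℝ (⊤ : ℕ∞) u) (hs : HasCompactSupport u)
    (hz : ∀ z : (Fin N → ℝ) × ℝ, r < z.2 → u z = 0) :
    ∫⁻ z, ENNReal.ofReal (|u z| ^ γ) ^ (((N : ℝ) + 1) / N) ∂(nuM N c) ≤
      (∫⁻ z, ENNReal.ofReal (max 1 (r ^ (-c)) * (γ * (|u z| ^ (γ - 1) * gradNorm u z))) ∂(nuM N c))
        ^ (((N : ℝ) + 1) / N) := by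
  have hu1 : ContDiff ℝ 1 u := hu.of_le (by exact_mod_cast le_top)
  have hgc := gradNorm_cont u hu
  have huc := hu.continuous
  have hcont : Continuous (fun z => |u z| ^ (γ - 1)) :=
    huc.abs.rpow_const (fun _ => Or.inr (by linarith))
  have hFm : Measurable (fun z => ENNReal.ofReal
      (max 1 (r ^ (-c)) * (γ * (|u z| ^ (γ - 1) * gradNorm u z)))) :=
    (Continuous.measurable (by fun_prop)).ennreal_ofReal
  refine grid N hN c _ _ hFm ?_ ?_
  · intro z _ i
    set g : ℝ → ℝ := fun t => u (Function.update z.1 i t, z.2) with hg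
    have hemb : Topology.IsClosedEmbedding (fun t : ℝ => (Function.update z.1 i t, z.2)) := by
      refine Function.LeftInverse.isClosedEmbedding (f := fun w : (Fin N → ℝ) × ℝ => w.1 i) ?_ ?_ ?_
      · intro t; simp
      · fun_prop
      · fun_prop
    have hg1 : ContDiff ℝ 1 g := by
      refine hu1.comp (ContDiff.prodMk ?_ contDiff_const)
      exact contDiff_update 1 z.1 i
    have hgs : HasCompactSupport g := hs.comp_isClosedEmbedding hemb
    have hd : ∀ t, deriv g t = pX u i (Function.update z.1 i t, z.2) := by
      intro t
      have h1 : HasDerivAt (fun t : ℝ => (Function.update z.1 i t, z.2))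
          ((Pi.single i 1 : Fin N → ℝ), (0 : ℝ)) t :=
        (hasDerivAt_update z.1 i t).prodMk (hasDerivAt_const t z.2)
      exact (((hu1.differentiable (by norm_num) _).hasFDerivAt).comp_hasDerivAt t h1).deriv
    have h := oneD g hg1 hgs γ hγ (z.1 i)
    have e : g (z.1 i) = u z := by simp [hg]
    rw [e] at h
    refine (h.trans (setLIntegral_le_lintegral _ _)).trans (lintegral_mono fun t => ?_)
    apply ENNReal.ofReal_le_ofReal
    rw [hd]
    have h2 := pX_le u i (Function.update z.1 i t, z.2)
    have h3 : 0 ≤ γ * (|g t| ^ (γ - 1) * gradNorm u (Function.update z.1 i t, z.2)) := by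
      have := gradNorm_nonneg u (Function.update z.1 i t, z.2)
      positivity
    refine le_trans ?_ (le_mul_of_one_le_left h3 (le_max_left _ _))
    gcongr
  · intro z hz0
    set g : ℝ → ℝ := fun t => u (z.1, t) with hg
    have hemb : Topology.IsClosedEmbedding (fun t : ℝ => (z.1, t)) :=
      Function.LeftInverse.isClosedEmbedding (f := Prod.snd) (fun t => rfl) (by fun_prop) (by fun_prop)
    have hg1 : ContDiff ℝ 1 g := hu1.comp (ContDiff.prodMk contDiff_const contDiff_id)
    have hgs : HasCompactSupport g := hs.comp_isClosedEmbedding hemb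
    have hd : ∀ t, deriv g t = pY u (z.1, t) := by
      intro t
      have h1 : HasDerivAt (fun t : ℝ => (z.1, t)) ((0 : Fin N → ℝ), (1 : ℝ)) t :=
        (hasDerivAt_const t z.1).prodMk (hasDerivAt_id t)
      exact (((hu1.differentiable (by norm_num) _).hasFDerivAt).comp_hasDerivAt t h1).deriv
    have h := oneD g hg1 hgs γ hγ z.2
    have e : g z.2 = u z := by simp [hg]
    rw [e] at h
    refine h.trans ?_
    have hFz : Measurable (fun t => ENNReal.ofReal
        (max 1 (r ^ (-c)) * (γ * (|u (z.1, t)| ^ (γ - 1) * gradNorm u (z.1, t))))) :=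
      hFm.comp measurable_prodMk_left
    rw [muY, lintegral_withDensity_eq_lintegral_mul _ (by fun_prop) hFz]
    refine le_trans ?_ (lintegral_mono_set (fun t (ht : z.2 < t) => hz0.trans ht))
    refine setLIntegral_mono (by
      exact Measurable.mul (by fun_prop) hFz) (fun t ht => ?_)
    have ht0 : 0 < t := hz0.trans ht
    simp only [Pi.mul_apply]
    rw [← ENNReal.ofReal_mul (by positivity)]
    apply ENNReal.ofReal_le_ofReal
    rw [hd]
    by_cases htr : r < t
    · have : g t = 0 := hz _ htr
      have h4 : u (z.1, t) = 0 := hz _ htr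
      rw [this, h4]
      simp [Real.zero_rpow (by linarith : γ - 1 ≠ 0)]
    · push Not at htr
      have h2 := pY_le u (z.1, t)
      have h3 : 0 ≤ γ * (|g t| ^ (γ - 1) * gradNorm u (z.1, t)) := by
        have := gradNorm_nonneg u (z.1, t)
        positivity
      have h5 : 1 ≤ t ^ c * max 1 (r ^ (-c)) := by
        have h6 : r ^ c ≤ t ^ c := Real.rpow_le_rpow_of_nonpos ht0 htr hc₂.le
        have h7 : r ^ c * r ^ (-c) = 1 := by
          rw [← Real.rpow_add hr]; simp
        have := le_max_right 1 (r ^ (-c))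
        calc 1 = r ^ c * r ^ (-c) := h7.symm
          _ ≤ _ := by gcongr
      calc γ * (|g t| ^ (γ - 1) * |pY u (z.1, t)|)
          ≤ γ * (|g t| ^ (γ - 1) * gradNorm u (z.1, t)) := by gcongr
        _ ≤ (t ^ c * max 1 (r ^ (-c))) * (γ * (|g t| ^ (γ - 1) * gradNorm u (z.1, t))) :=
            le_mul_of_one_le_left h3 h5
        _ = _ := by rw [mul_assoc]

lemma alg1 (n : ℝ) (hn : 1 ≤ n) (q t θ K A B G : ℝ) (hq : 2 < q)
    (hA : 0 ≤ A) (hB : 0 ≤ B) (hG : 0 ≤ G) (hK : 0 < K)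
    (ht : 2 * (q * n / (n + 1) - 1) = 2 * (1 - t) + q * t)
    (hθ : θ = (n + 1) * (1 / 2 - 1 / q))
    (h : A ≤ (K * ((B ^ (1 - t) * A ^ t) ^ (1 / 2 : ℝ) * G ^ (1 / 2 : ℝ))) ^ ((n + 1) / n)) :
    A ^ (1 / q) ≤ K ^ θ * (G ^ (1 / 2 : ℝ)) ^ θ * (B ^ (1 / 2 : ℝ)) ^ (1 - θ) := by
  rcases hA.eq_or_lt with rfl | hA
  · rw [Real.zero_rpow (by positivity)]; positivity
  have hq0 : 0 < q := by linarith
  have hθ0 : 0 < θ := by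
    rw [hθ]
    have : 1 / q < 1 / 2 := one_div_lt_one_div_of_lt (by norm_num) hq
    have : 0 < 1 / 2 - 1 / q := by linarith
    positivity
  have h1 : A ^ (n / (n + 1)) ≤ K * ((B ^ (1 - t) * A ^ t) ^ (1 / 2 : ℝ) * G ^ (1 / 2 : ℝ)) := by
    have := Real.rpow_le_rpow hA.le h (by positivity : 0 ≤ n / (n + 1))
    rwa [← Real.rpow_mul (by positivity), show (n + 1) / n * (n / (n + 1)) = 1 by field_simp,
      Real.rpow_one] at this
  rw [Real.mul_rpow (by positivity) (by positivity), ← Real.rpow_mul hA.le] at h1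
  have hAt : 0 < A ^ (t * (1 / 2)) := by positivity
  have h2 : A ^ (n / (n + 1) - t * (1 / 2)) ≤
      K * ((B ^ (1 - t)) ^ (1 / 2 : ℝ) * G ^ (1 / 2 : ℝ)) := by
    rw [Real.rpow_sub hA, div_le_iff₀ hAt]
    linarith
  have hδ : (n / (n + 1) - t * (1 / 2)) * θ = 1 / q := by
    have ht' : t * (q - 2) = 2 * (q * n / (n + 1) - 1) - 2 := by linarith
    have : t = (2 * (q * n / (n + 1) - 1) - 2) / (q - 2) := by
      rw [eq_div_iff (by linarith)]; exact ht'
    rw [this, hθ]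
    have : q - 2 ≠ 0 := by linarith
    field_simp
    ring
  have hε : (1 - t) * θ = 1 - θ := by
    have ht' : t * (q - 2) = 2 * (q * n / (n + 1) - 1) - 2 := by linarith
    have : t = (2 * (q * n / (n + 1) - 1) - 2) / (q - 2) := by
      rw [eq_div_iff (by linarith)]; exact ht'
    rw [this, hθ]
    have : q - 2 ≠ 0 := by linarith
    field_simp
    ring
  have h3 := Real.rpow_le_rpow (by positivity) h2 hθ0.le
  rw [← Real.rpow_mul hA.le, hδ, Real.mul_rpow hK.le (by positivity),
    Real.mul_rpow (by positivity) (by positivity)] at h3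
  refine h3.trans (le_of_eq ?_)
  rw [← Real.rpow_mul hB, ← Real.rpow_mul hB, ← Real.rpow_mul hB,
    show (1 - t) * (1 / 2) * θ = 1 / 2 * (1 - θ) by rw [← hε]; ring]
  ring

lemma interp (N : ℕ) (c : ℝ) (u : ((Fin N → ℝ) × ℝ) → ℝ) (hu : Continuous u)
    (q t s : ℝ) (hq : 0 < q) (ht0 : 0 ≤ t) (ht1 : t ≤ 1) (hst : s = 2 * (1 - t) + q * t) :
    ∫⁻ z, ENNReal.ofReal (|u z| ^ s) ∂(nuM N c) ≤
      (∫⁻ z, ENNReal.ofReal (u z ^ 2) ∂(nuM N c)) ^ (1 - t) *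
      (∫⁻ z, ENNReal.ofReal (|u z| ^ q) ∂(nuM N c)) ^ t := by
  have hq' : Continuous (fun z => |u z| ^ q) := hu.abs.rpow_const (fun _ => Or.inr hq.le)
  refine le_trans (le_of_eq ?_) (ENNReal.lintegral_mul_norm_pow_le
    (f := fun z => ENNReal.ofReal (u z ^ 2)) (g := fun z => ENNReal.ofReal (|u z| ^ q))
    (by fun_prop) (by fun_prop) (by linarith : 0 ≤ 1 - t) ht0 (by ring))
  apply lintegral_congr
  intro z
  rw [ENNReal.ofReal_rpow_of_nonneg (by positivity) (by linarith),
    ENNReal.ofReal_rpow_of_nonneg (by positivity) ht0, ← ENNReal.ofReal_mul (by positivity)]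
  congr 1
  have : u z ^ 2 = |u z| ^ (2 : ℝ) := by simp
  rw [this, ← Real.rpow_mul (abs_nonneg _), ← Real.rpow_mul (abs_nonneg _),
    ← Real.rpow_add_of_nonneg (abs_nonneg _) (by nlinarith) (by positivity), hst]

lemma crit (N : ℕ) (hN : 1 ≤ N) (c : ℝ) (hc₁ : -1 < c) (hc₂ : c < 0)
    (r : ℝ) (hr : 0 < r) (q : ℝ) (hq₁ : 2 * ((N : ℝ) + 1) / N ≤ q)
    (hq₂ : 1 / q ≥ 1 / 2 - 1 / ((N : ℝ) + 1))
    (θ : ℝ) (hθ : θ = ((N : ℝ) + 1) * (1 / 2 - 1 / q)) :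
    ∃ C > 0, ∀ u : ((Fin N → ℝ) × ℝ) → ℝ, ContDiff ℝ (⊤ : ℕ∞) u → HasCompactSupport u →
      (∀ z : (Fin N → ℝ) × ℝ, r < z.2 → u z = 0) →
      ((∫⁻ z, ENNReal.ofReal (|u z| ^ q) ∂(nuM N c)).toReal) ^ (1 / q) ≤
        C * (((∫⁻ z, ENNReal.ofReal (gradNorm u z ^ 2) ∂(nuM N c)).toReal) ^ (1 / 2 : ℝ)) ^ θ *
          (((∫⁻ z, ENNReal.ofReal (u z ^ 2) ∂(nuM N c)).toReal) ^ (1 / 2 : ℝ)) ^ (1 - θ) := by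
  have hN' : (1 : ℝ) ≤ N := by exact_mod_cast hN
  have hq1' : 2 * ((N : ℝ) + 1) ≤ q * N := by rwa [div_le_iff₀ (by linarith)] at hq₁
  have hq : 2 < q := by nlinarith
  set γ : ℝ := q * N / (N + 1) with hγ
  have hγ2 : 2 ≤ γ := by
    rw [hγ, le_div_iff₀ (by linarith)]; exact hq1'
  set K : ℝ := max 1 (r ^ (-c)) * γ with hK
  have hK0 : 0 < K := by
    have : 0 < max 1 (r ^ (-c)) := lt_max_of_lt_left one_pos
    positivity
  obtain ⟨t, ht⟩ : ∃ t, 2 * (γ - 1) = 2 * (1 - t) + q * t :=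
    ⟨(2 * (γ - 1) - 2) / (q - 2), by
      have : q - 2 ≠ 0 := by linarith
      field_simp; ring⟩
  have ht0 : 0 ≤ t := by
    by_contra hneg; push Not at hneg
    nlinarith
  have ht1 : t ≤ 1 := by
    have hqq : 2 * (γ - 1) ≤ q := by
      have h5 : 1 / 2 - 1 / ((N : ℝ) + 1) ≤ 1 / q := hq₂
      have h6 := mul_le_mul_of_nonneg_left h5 (by positivity : 0 ≤ 2 * q)
      have h7 : 2 * q * (1 / q) = 2 := by field_simp
      have h8 : γ = q - q * (1 / ((N : ℝ) + 1)) := by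
        rw [hγ]; field_simp; ring
      rw [h8]
      nlinarith
    by_contra hneg; push Not at hneg
    nlinarith
  refine ⟨K ^ θ, by positivity, fun u hu hs hz => ?_⟩
  have huc := hu.continuous
  have hgc := gradNorm_cont u hu
  have hcp : ∀ p : ℝ, 0 < p → Continuous (fun z => |u z| ^ p) := fun p hp =>
    huc.abs.rpow_const (fun _ => Or.inr hp.le)
  have hIq : ∫⁻ z, ENNReal.ofReal (|u z| ^ q) ∂(nuM N c) ≠ ∞ :=
    fin_int N c hc₁ _ (hcp q (by linarith))
      (hs.comp_left (g := fun v => |v| ^ q) (by simp [Real.zero_rpow (by linarith : q ≠ 0)]))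
  have hI2 : ∫⁻ z, ENNReal.ofReal (u z ^ 2) ∂(nuM N c) ≠ ∞ :=
    fin_int N c hc₁ _ (by fun_prop) (hs.comp_left (g := fun v => v ^ 2) (by simp))
  have hIG : ∫⁻ z, ENNReal.ofReal (gradNorm u z ^ 2) ∂(nuM N c) ≠ ∞ :=
    fin_int N c hc₁ _ (by fun_prop)
      ((gradNorm_supp u hs).comp_left (g := fun v => v ^ 2) (by simp))
  have hmain := main_step N hN c hc₂ r hr γ (by linarith) u hu hs hz
  have hInt := interp N c u huc q t _ (by linarith) ht0 ht1 ht
  set A := ∫⁻ z, ENNReal.ofReal (|u z| ^ q) ∂(nuM N c) with hA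
  set B := ∫⁻ z, ENNReal.ofReal (u z ^ 2) ∂(nuM N c) with hB
  set G := ∫⁻ z, ENNReal.ofReal (gradNorm u z ^ 2) ∂(nuM N c) with hG
  have e1 : ∫⁻ z, ENNReal.ofReal (|u z| ^ γ) ^ (((N : ℝ) + 1) / N) ∂(nuM N c) = A := by
    rw [hA]
    apply lintegral_congr
    intro z
    rw [ENNReal.ofReal_rpow_of_nonneg (by positivity) (by positivity),
      ← Real.rpow_mul (abs_nonneg _)]
    congr 2
    rw [hγ]; field_simp
  have e2 : ∫⁻ z, ENNReal.ofReal (max 1 (r ^ (-c)) * (γ * (|u z| ^ (γ - 1) * gradNorm u z)))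
      ∂(nuM N c) ≤ ENNReal.ofReal K * ((B ^ (1 - t) * A ^ t) ^ (1 / 2 : ℝ) * G ^ (1 / 2 : ℝ)) := by
    have e3 : ∀ z, ENNReal.ofReal (max 1 (r ^ (-c)) * (γ * (|u z| ^ (γ - 1) * gradNorm u z)))
        = ENNReal.ofReal K * (ENNReal.ofReal (|u z| ^ (2 * (γ - 1))) ^ (1 / 2 : ℝ) *
          ENNReal.ofReal (gradNorm u z ^ 2) ^ (1 / 2 : ℝ)) := by
      intro z
      have hg0 := gradNorm_nonneg u z
      rw [ENNReal.ofReal_rpow_of_nonneg (by positivity) (by positivity),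
        ENNReal.ofReal_rpow_of_nonneg (by positivity) (by positivity),
        ← ENNReal.ofReal_mul (by positivity), ← ENNReal.ofReal_mul (by positivity)]
      congr 1
      rw [← Real.rpow_mul (abs_nonneg _), ← Real.sqrt_eq_rpow, Real.sqrt_sq hg0,
        show 2 * (γ - 1) * (1 / 2) = γ - 1 by ring, hK]
      ring
    simp_rw [e3]
    rw [lintegral_const_mul' _ _ ENNReal.ofReal_ne_top]
    gcongr
    have hc2 := hcp (2 * (γ - 1)) (by linarith)
    refine (ENNReal.lintegral_mul_norm_pow_le
      (f := fun z => ENNReal.ofReal (|u z| ^ (2 * (γ - 1))))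
      (g := fun z => ENNReal.ofReal (gradNorm u z ^ 2)) (by fun_prop)
      (by fun_prop) (by norm_num) (by norm_num) (by norm_num)).trans ?_
    gcongr
  rw [e1] at hmain
  have hex : (0 : ℝ) ≤ ((N : ℝ) + 1) / N := by positivity
  have h4 := hmain.trans (ENNReal.rpow_le_rpow e2 hex)
  have hBt : B ^ (1 - t) ≠ ∞ := ENNReal.rpow_ne_top_of_nonneg (by linarith) hI2
  have hAt : A ^ t ≠ ∞ := ENNReal.rpow_ne_top_of_nonneg ht0 hIq
  have hfin : (ENNReal.ofReal K * ((B ^ (1 - t) * A ^ t) ^ (1 / 2 : ℝ) * G ^ (1 / 2 : ℝ)))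
      ^ (((N : ℝ) + 1) / N) ≠ ∞ := by
    refine ENNReal.rpow_ne_top_of_nonneg hex (ENNReal.mul_ne_top ENNReal.ofReal_ne_top
      (ENNReal.mul_ne_top (ENNReal.rpow_ne_top_of_nonneg (by norm_num)
      (ENNReal.mul_ne_top hBt hAt)) (ENNReal.rpow_ne_top_of_nonneg (by norm_num) hIG)))
  have h5 := ENNReal.toReal_mono hfin h4
  simp only [← ENNReal.toReal_rpow, ENNReal.toReal_mul, ENNReal.toReal_ofReal hK0.le] at h5
  exact alg1 N hN' q t θ K _ _ _ hq ENNReal.toReal_nonneg ENNReal.toReal_nonneg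
    ENNReal.toReal_nonneg hK0 ht hθ h5

/-- local Gagliardo–Nirenberg inequality: for `N ≥ 1`, `−1 < c < 0`,
`r > 0`, `q ∈ (2,∞)` with `1/q ≥ 1/2 − 1/(N+1)` and `θ = (N+1)(1/2 − 1/q)`,
`‖u‖_{L^q_c} ≤ C ‖∇u‖_{L²_c}^θ ‖u‖_{L²_c}^{1−θ}` for all smooth compactly
supported `u` on the closed half-space supported in `ℝ^N × [0,r]`. -/
theorem stmt_10 (N : ℕ) (hN : 1 ≤ N) (c : ℝ) (hc₁ : -1 < c) (hc₂ : c < 0)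
    (r : ℝ) (hr : 0 < r) (q : ℝ) (hq₁ : 2 < q) (hq₂ : 1 / q ≥ 1 / 2 - 1 / ((N : ℝ) + 1))
    (θ : ℝ) (hθ : θ = ((N : ℝ) + 1) * (1 / 2 - 1 / q)) :
    ∃ C > 0, ∀ u : ((Fin N → ℝ) × ℝ) → ℝ, ContDiff ℝ (⊤ : ℕ∞) u → HasCompactSupport u →
      (∀ z : (Fin N → ℝ) × ℝ, r < z.2 → u z = 0) →
      (∫ z in HS N, |u z| ^ q * z.2 ^ c) ^ (1 / q) ≤
        C * ((∫ z in HS N, gradNorm u z ^ 2 * z.2 ^ c) ^ (1 / 2 : ℝ)) ^ θ *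
          ((∫ z in HS N, u z ^ 2 * z.2 ^ c) ^ (1 / 2 : ℝ)) ^ (1 - θ) := by
  have hN' : (1 : ℝ) ≤ N := by exact_mod_cast hN
  set q1 : ℝ := max q (2 * ((N : ℝ) + 1) / N) with hq1
  have hqq1 : q ≤ q1 := le_max_left _ _
  have hq12 : 2 < q1 := hq₁.trans_le hqq1
  have hcond : 1 / q1 ≥ 1 / 2 - 1 / ((N : ℝ) + 1) := by
    rcases max_choice q (2 * ((N : ℝ) + 1) / N) with h | h
    · rw [hq1, h]; exact hq₂
    · rw [hq1, h]
      have e : 1 / (2 * ((N : ℝ) + 1) / N) = 1 / 2 - 1 / (2 * ((N : ℝ) + 1)) := by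
        field_simp; ring
      have e' : 1 / (2 * ((N : ℝ) + 1)) ≤ 1 / ((N : ℝ) + 1) :=
        one_div_le_one_div_of_le (by linarith) (by linarith)
      rw [e]; linarith
  obtain ⟨C, hC, H⟩ := crit N hN c hc₁ hc₂ r hr q1 (le_max_right _ _) hcond _ rfl
  set θ1 : ℝ := ((N : ℝ) + 1) * (1 / 2 - 1 / q1) with hθ1
  have hθ1' : θ1 ≤ 1 := by
    have h1 := mul_le_mul_of_nonneg_left (show 1 / 2 - 1 / q1 ≤ 1 / ((N : ℝ) + 1) by linarith)
      (by linarith : 0 ≤ (N : ℝ) + 1)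
    have h2 : ((N : ℝ) + 1) * (1 / ((N : ℝ) + 1)) = 1 := by field_simp
    linarith
  set t : ℝ := (q - 2) / (q1 - 2) with ht
  have hd : q1 - 2 ≠ 0 := by linarith
  have hd' : 0 < q1 - 2 := by linarith
  have hq0 : 0 < q := by linarith
  have hq10 : 0 < q1 := by linarith
  have ht0 : 0 ≤ t := div_nonneg (by linarith) (by linarith)
  have ht1 : t ≤ 1 := by rw [ht, div_le_one hd']; linarith
  have hst : q = 2 * (1 - t) + q1 * t := by
    rw [ht]; field_simp; ring
  set e : ℝ := t * q1 / q with he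
  have he0 : 0 ≤ e := by positivity
  have hθe : θ1 * e = θ := by
    rw [hθ1, he, hθ, ht]; field_simp
  have hBe : 2 * (1 - t) / q + (1 - θ1) * e = 1 - θ := by
    rw [sub_mul, hθe, he]
    have : 2 * (1 - t) / q + t * q1 / q = 1 := by
      rw [← add_div, div_eq_one_iff_eq hq0.ne']; linarith
    linarith
  refine ⟨C ^ e, by positivity, fun u hu hs hz => ?_⟩
  have huc := hu.continuous
  have hgc := gradNorm_cont u hu
  have hcp : ∀ p : ℝ, 0 < p → Continuous (fun z => |u z| ^ p) := fun p hp =>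
    huc.abs.rpow_const (fun _ => Or.inr hp.le)
  rw [int_eq N c _ (hcp q hq0) (fun z => by positivity),
    int_eq N c _ (by fun_prop) (fun z => by positivity),
    int_eq N c _ (by fun_prop) (fun z => by positivity)]
  have hIq : ∫⁻ z, ENNReal.ofReal (|u z| ^ q1) ∂(nuM N c) ≠ ⊤ :=
    fin_int N c hc₁ _ (hcp q1 hq10)
      (hs.comp_left (g := fun v => |v| ^ q1) (by simp [Real.zero_rpow hq10.ne']))
  have hI2 : ∫⁻ z, ENNReal.ofReal (u z ^ 2) ∂(nuM N c) ≠ ⊤ :=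
    fin_int N c hc₁ _ (by fun_prop) (hs.comp_left (g := fun v => v ^ 2) (by simp))
  have hInt := interp N c u huc q1 t q hq10 ht0 ht1 hst
  have hH := H u hu hs hz
  have h5 := ENNReal.toReal_mono (ENNReal.mul_ne_top
    (ENNReal.rpow_ne_top_of_nonneg (by linarith) hI2)
    (ENNReal.rpow_ne_top_of_nonneg ht0 hIq)) hInt
  simp only [← ENNReal.toReal_rpow, ENNReal.toReal_mul] at h5
  have hA0 : 0 ≤ (∫⁻ z, ENNReal.ofReal (|u z| ^ q) ∂(nuM N c)).toReal := ENNReal.toReal_nonneg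
  have hA10 : 0 ≤ (∫⁻ z, ENNReal.ofReal (|u z| ^ q1) ∂(nuM N c)).toReal := ENNReal.toReal_nonneg
  have hB0 : 0 ≤ (∫⁻ z, ENNReal.ofReal (u z ^ 2) ∂(nuM N c)).toReal := ENNReal.toReal_nonneg
  have hG0 : 0 ≤ (∫⁻ z, ENNReal.ofReal (gradNorm u z ^ 2) ∂(nuM N c)).toReal :=
    ENNReal.toReal_nonneg
  generalize (∫⁻ z, ENNReal.ofReal (|u z| ^ q) ∂(nuM N c)).toReal = A at *
  generalize (∫⁻ z, ENNReal.ofReal (|u z| ^ q1) ∂(nuM N c)).toReal = A1 at *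
  generalize (∫⁻ z, ENNReal.ofReal (u z ^ 2) ∂(nuM N c)).toReal = B at *
  generalize (∫⁻ z, ENNReal.ofReal (gradNorm u z ^ 2) ∂(nuM N c)).toReal = G at *
  calc A ^ (1 / q) ≤ (B ^ (1 - t) * A1 ^ t) ^ (1 / q) :=
        Real.rpow_le_rpow hA0 h5 (by positivity)
    _ = (B ^ (1 / 2 : ℝ)) ^ (2 * (1 - t) / q) * (A1 ^ (1 / q1)) ^ e := by
        rw [Real.mul_rpow (by positivity) (by positivity), ← Real.rpow_mul hB0,
          ← Real.rpow_mul hA10, ← Real.rpow_mul hB0, ← Real.rpow_mul hA10]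
        congr 2
        · field_simp
        · rw [he]; field_simp
    _ ≤ (B ^ (1 / 2 : ℝ)) ^ (2 * (1 - t) / q) *
        (C * (G ^ (1 / 2 : ℝ)) ^ θ1 * (B ^ (1 / 2 : ℝ)) ^ (1 - θ1)) ^ e := by
        gcongr
    _ = C ^ e * (G ^ (1 / 2 : ℝ)) ^ θ *
        ((B ^ (1 / 2 : ℝ)) ^ (2 * (1 - t) / q) * (B ^ (1 / 2 : ℝ)) ^ ((1 - θ1) * e)) := by
        rw [Real.mul_rpow (by positivity) (by positivity), Real.mul_rpow hC.le (by positivity),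
          ← Real.rpow_mul (by positivity : 0 ≤ G ^ (1 / 2 : ℝ)), hθe,
          ← Real.rpow_mul (by positivity : 0 ≤ B ^ (1 / 2 : ℝ)) (1 - θ1)]
        ring
    _ = C ^ e * (G ^ (1 / 2 : ℝ)) ^ θ * (B ^ (1 / 2 : ℝ)) ^ (1 - θ) := by
        rw [← Real.rpow_add_of_nonneg (by positivity)
          (div_nonneg (by linarith) hq0.le) (mul_nonneg (by linarith) he0), hBe]
end
end

section
/- Let N ≥ 1, c ∈ ℝ with c + 1 > 0, a ∈ ℝ^N with |a| < 1, and let φ be as in the context. Then there exists a constant C ≥ 1 such that for every u ∈ 𝒞 one has C^{−1}(‖∇u‖²_{L²_ν} + ‖u‖²_{L²_ν}) ≤ Re 𝔞(φu, φu) + ‖u‖²_{L²_ν} ≤ C(‖∇u‖²_{L²_ν} + ‖u‖²_{L²_ν}), where ‖w‖²_{L²_ν} = ∫_{ℝ^{N+1}_+} |w|² φ(y)² y^c dx dy. -/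
open MeasureTheory Real

noncomputable section

/-- Partial derivative of `u` in the `i`-th `x` direction. -/
def pXc {N : ℕ} (u : ((Fin N → ℝ) × ℝ) → ℂ) (i : Fin N) (z : (Fin N → ℝ) × ℝ) : ℂ :=
  fderiv ℝ u z (Pi.single i 1, 0)

/-- Partial derivative of `u` in the `y` direction. -/
def pYc {N : ℕ} (u : ((Fin N → ℝ) × ℝ) → ℂ) (z : (Fin N → ℝ) × ℝ) : ℂ :=
  fderiv ℝ u z (0, 1)

/-- Squared Euclidean norm of the full gradient `∇u`. -/
def gradSqC {N : ℕ} (u : ((Fin N → ℝ) × ℝ) → ℂ) (z : (Fin N → ℝ) × ℝ) : ℝ :=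
  (∑ i, ‖pXc u i z‖ ^ 2) + ‖pYc u z‖ ^ 2

/-- The sesquilinear form
`𝔞(u,v) = ∫ ⟨∇u, ∇v̄⟩ y^c + 2 ∫ (D_y u)(a·∇_x v̄) y^c` on the half-space. -/
def aForm (N : ℕ) (c : ℝ) (a : Fin N → ℝ) (u v : ((Fin N → ℝ) × ℝ) → ℂ) : ℂ :=
  (∫ z in HS N, ((∑ i, pXc u i z * (starRingEnd ℂ) (pXc v i z)) +
      pYc u z * (starRingEnd ℂ) (pYc v z)) * ((z.2 ^ c : ℝ) : ℂ)) +
  2 * ∫ z in HS N, (pYc u z * ∑ i, (a i : ℂ) * (starRingEnd ℂ) (pXc v i z)) *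
      ((z.2 ^ c : ℝ) : ℂ)

/-- The class `𝒞` of smooth compactly supported functions on the closed half-space
whose `y`-derivative vanishes for `0 ≤ y ≤ δ`, for some `δ > 0`. -/
def memC {N : ℕ} (u : ((Fin N → ℝ) × ℝ) → ℂ) : Prop :=
  ContDiff ℝ (⊤ : ℕ∞) u ∧ HasCompactSupport u ∧
    ∃ δ > 0, ∀ z : (Fin N → ℝ) × ℝ, 0 ≤ z.2 → z.2 ≤ δ → pYc u z = 0

lemma pt_cross {N : ℕ} (a : Fin N → ℝ) (p : Fin N → ℂ) (q : ℂ) :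
    2 * ‖q * ∑ i, (a i : ℂ) * (starRingEnd ℂ) (p i)‖ ≤
      Real.sqrt (∑ i, a i ^ 2) * ((∑ i, ‖p i‖ ^ 2) + ‖q‖ ^ 2) := by
  have h1 : ‖∑ i, (a i : ℂ) * (starRingEnd ℂ) (p i)‖ ≤
      Real.sqrt (∑ i, a i ^ 2) * Real.sqrt (∑ i, ‖p i‖ ^ 2) := by
    refine (norm_sum_le _ _).trans ?_
    have := Real.sum_mul_le_sqrt_mul_sqrt Finset.univ (fun i => |a i|) (fun i => ‖p i‖)
    simpa using this
  have h2 := Real.sq_sqrt (show 0 ≤ ∑ i, ‖p i‖ ^ 2 by positivity)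
  set s := Real.sqrt (∑ i, ‖p i‖ ^ 2)
  set α := Real.sqrt (∑ i, a i ^ 2)
  have hα : 0 ≤ α := Real.sqrt_nonneg _
  rw [norm_mul, ← h2]
  have h3 : ‖q‖ * ‖∑ i, (a i : ℂ) * (starRingEnd ℂ) (p i)‖ ≤ ‖q‖ * (α * s) := by gcongr
  nlinarith [mul_nonneg hα (sq_nonneg (s - ‖q‖))]

lemma pt_mul {N : ℕ} (u : ((Fin N → ℝ) × ℝ) → ℂ) (hu : Differentiable ℝ u) (φ φ' : ℝ → ℝ)
    (z : (Fin N → ℝ) × ℝ) (h : HasDerivAt φ (φ' z.2) z.2) :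
    (∀ i, pXc (fun z => (φ z.2 : ℂ) * u z) i z = (φ z.2 : ℂ) * pXc u i z) ∧
    pYc (fun z => (φ z.2 : ℂ) * u z) z = (φ z.2 : ℂ) * pYc u z + (φ' z.2 : ℂ) * u z := by
  have h1 : HasFDerivAt (fun z : (Fin N → ℝ) × ℝ => z.2) (ContinuousLinearMap.snd ℝ (Fin N → ℝ) ℝ) z :=
    hasFDerivAt_snd
  have h2 := (h.ofReal_comp.hasFDerivAt (x := z.2)).comp z h1
  have h3 := (HasFDerivAt.mul h2 (hu z).hasFDerivAt).fderiv
  simp only [Function.comp_def] at h3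
  constructor
  · intro i
    simp only [pXc]
    erw [h3]
    simp
  · simp only [pYc]
    erw [h3]
    simp
    ring

lemma pt_two (x y : ℂ) : ‖x + y‖ ^ 2 ≤ 2 * ‖x‖ ^ 2 + 2 * ‖y‖ ^ 2 := by
  have := norm_add_le x y
  nlinarith [sq_nonneg (‖x‖ - ‖y‖), norm_nonneg (x + y)]

lemma hs_int {N : ℕ} (ψ : ℝ → ℝ) (hψ : ContinuousOn ψ (Set.Ioi 0))
    (hi : ∀ R, 0 < R → IntegrableOn ψ (Set.Ioc 0 R)) (g : ((Fin N → ℝ) × ℝ) → ℝ)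
    (hg : Continuous g) (hgc : HasCompactSupport g) :
    IntegrableOn (fun z => g z * ψ z.2) (HS N) := by
  have hm : MeasurableSet (HS N) := (isOpen_lt continuous_const continuous_snd).measurableSet
  obtain ⟨M, hM⟩ := hgc.exists_bound_of_continuous hg
  obtain ⟨R, hR, hK⟩ := hgc.isCompact.isBounded.subset_closedBall_lt 0 0
  have hint : Integrable (fun z : (Fin N → ℝ) × ℝ =>
      (Set.indicator (Metric.closedBall (0 : Fin N → ℝ) R) (fun _ => (1 : ℝ)) z.1) *
      (Set.indicator (Set.Ioc 0 R) ψ z.2)) := by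
    refine Integrable.mul_prod (f := Set.indicator (Metric.closedBall (0 : Fin N → ℝ) R) (fun _ => (1 : ℝ))) (g := Set.indicator (Set.Ioc 0 R) ψ) ?_ ?_
    · rw [integrable_indicator_iff measurableSet_closedBall]
      exact integrableOn_const measure_closedBall_lt_top.ne
    · rw [integrable_indicator_iff measurableSet_Ioc]
      exact hi R hR
  refine Integrable.mono' ((hint.norm.const_mul M).integrableOn (s := HS N)) ?_ ?_
  · refine ContinuousOn.aestronglyMeasurable ?_ hm
    exact hg.continuousOn.mul (hψ.comp continuousOn_snd (fun z hz => hz))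
  · refine (ae_restrict_iff' hm).2 (Filter.Eventually.of_forall fun z hz => ?_)
    by_cases hz0 : g z = 0
    · simp only [hz0, zero_mul, norm_zero]
      have : 0 ≤ M := (norm_nonneg _).trans (hM 0)
      positivity
    · have hzK := hK (subset_tsupport _ hz0)
      rw [mem_closedBall_zero_iff, Prod.norm_def, max_le_iff] at hzK
      have e1 : z.1 ∈ Metric.closedBall (0 : Fin N → ℝ) R := mem_closedBall_zero_iff.2 hzK.1
      have e2 : z.2 ∈ Set.Ioc 0 R := ⟨hz, (le_abs_self _).trans hzK.2⟩
      rw [Set.indicator_of_mem e1, Set.indicator_of_mem e2, one_mul, norm_mul]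
      gcongr
      exact hM z

lemma main_abs (N : ℕ) (c : ℝ)
    (a : Fin N → ℝ) (ha : Real.sqrt (∑ i, a i ^ 2) < 1) (φ φ' : ℝ → ℝ) (K : ℝ)
    (hd : ∀ y, 0 < y → HasDerivAt φ (φ' y) y) (hc' : ContinuousOn φ' (Set.Ioi 0))
    (hK : ∀ y, 0 < y → |φ' y| ≤ K * φ y)
    (hi : ∀ R, 0 < R → IntegrableOn (fun y => φ y ^ 2 * y ^ c) (Set.Ioc 0 R)) :
    ∃ C ≥ 1, ∀ u : ((Fin N → ℝ) × ℝ) → ℂ, memC u →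
      C⁻¹ * ((∫ z in HS N, gradSqC u z * (φ z.2 ^ 2 * z.2 ^ c)) +
          ∫ z in HS N, ‖u z‖ ^ 2 * (φ z.2 ^ 2 * z.2 ^ c)) ≤
        (aForm N c a (fun z => (φ z.2 : ℂ) * u z) (fun z => (φ z.2 : ℂ) * u z)).re +
          (∫ z in HS N, ‖u z‖ ^ 2 * (φ z.2 ^ 2 * z.2 ^ c)) ∧
      (aForm N c a (fun z => (φ z.2 : ℂ) * u z) (fun z => (φ z.2 : ℂ) * u z)).re +
          (∫ z in HS N, ‖u z‖ ^ 2 * (φ z.2 ^ 2 * z.2 ^ c)) ≤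
        C * ((∫ z in HS N, gradSqC u z * (φ z.2 ^ 2 * z.2 ^ c)) +
          ∫ z in HS N, ‖u z‖ ^ 2 * (φ z.2 ^ 2 * z.2 ^ c)) := by
  have hm : MeasurableSet (HS N) := (isOpen_lt continuous_const continuous_snd).measurableSet
  set α := Real.sqrt (∑ i, a i ^ 2) with hαdef
  have hα0 : 0 ≤ α := Real.sqrt_nonneg _
  have h1α : 0 < 1 - α := by linarith
  have hφc : ContinuousOn φ (Set.Ioi 0) := fun y hy => (hd y hy).continuousAt.continuousWithinAt
  have hpc : ContinuousOn (fun y : ℝ => y ^ c) (Set.Ioi 0) := fun y hy =>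
    (Real.continuousAt_rpow_const y c (Or.inl (ne_of_gt hy))).continuousWithinAt
  have hψc : ContinuousOn (fun y : ℝ => φ y ^ 2 * y ^ c) (Set.Ioi 0) := (hφc.pow 2).mul hpc
  refine ⟨2 / (1 - α) + 4 * K ^ 2 + 5, ?_, fun u hu => ?_⟩
  · have : 0 < 2 / (1 - α) := by positivity
    nlinarith [sq_nonneg K]
  obtain ⟨hus, huc, -⟩ := hu
  have hudiff : Differentiable ℝ u := hus.differentiable (by simp)
  have hfc : Continuous (fderiv ℝ u) := hus.continuous_fderiv (by simp)
  have hpx : ∀ i, Continuous (pXc u i) := fun i => hfc.clm_apply continuous_const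
  have hpy : Continuous (pYc u) := hfc.clm_apply continuous_const
  have hfs : HasCompactSupport (fderiv ℝ u) := huc.fderiv (𝕜 := ℝ)
  have hG : IntegrableOn (fun z => gradSqC u z * (φ z.2 ^ 2 * z.2 ^ c)) (HS N) := by
    refine hs_int _ hψc hi (gradSqC u) ?_ ?_
    · unfold gradSqC
      fun_prop
    · refine hfs.mono fun z hz => ?_
      rw [Function.mem_support] at hz ⊢
      contrapose! hz
      simp [gradSqC, pXc, pYc, hz]
  have hU : IntegrableOn (fun z => ‖u z‖ ^ 2 * (φ z.2 ^ 2 * z.2 ^ c)) (HS N) := by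
    refine hs_int _ hψc hi (fun z => ‖u z‖ ^ 2) (by have := hus.continuous; fun_prop) ?_
    refine huc.mono fun z hz => ?_
    rw [Function.mem_support] at hz ⊢
    contrapose! hz
    simp [hz]
  set v : ((Fin N → ℝ) × ℝ) → ℂ := fun z => (φ z.2 : ℂ) * u z with hv
  have hvx : ∀ z ∈ HS N, ∀ i, pXc v i z = (φ z.2 : ℂ) * pXc u i z := fun z hz =>
    (pt_mul u hudiff φ φ' z (hd _ hz)).1
  have hvy : ∀ z ∈ HS N, pYc v z = (φ z.2 : ℂ) * pYc u z + (φ' z.2 : ℂ) * u z := fun z hz =>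
    (pt_mul u hudiff φ φ' z (hd _ hz)).2
  have hsnd : Set.MapsTo (Prod.snd : (Fin N → ℝ) × ℝ → ℝ) (HS N) (Set.Ioi 0) := fun z hz => hz
  have cφ : ContinuousOn (fun z : (Fin N → ℝ) × ℝ => (φ z.2 : ℂ)) (HS N) :=
    Complex.continuous_ofReal.comp_continuousOn (hφc.comp continuousOn_snd hsnd)
  have cφ' : ContinuousOn (fun z : (Fin N → ℝ) × ℝ => (φ' z.2 : ℂ)) (HS N) :=
    Complex.continuous_ofReal.comp_continuousOn (hc'.comp continuousOn_snd hsnd)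
  have cp : ContinuousOn (fun z : (Fin N → ℝ) × ℝ => z.2 ^ c) (HS N) :=
    hpc.comp continuousOn_snd hsnd
  have cvx : ∀ i, ContinuousOn (pXc v i) (HS N) := fun i =>
    (cφ.mul (hpx i).continuousOn).congr fun z hz => hvx z hz i
  have cvy : ContinuousOn (pYc v) (HS N) :=
    ((cφ.mul hpy.continuousOn).add (cφ'.mul hus.continuous.continuousOn)).congr hvy
  have cg : ContinuousOn (gradSqC v) (HS N) := by
    unfold gradSqC
    exact (continuousOn_finsetSum _ fun i _ => (cvx i).norm.pow 2).add (cvy.norm.pow 2)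
  -- pointwise comparisons
  have hgx : ∀ z ∈ HS N, ∑ i, ‖pXc v i z‖ ^ 2 = φ z.2 ^ 2 * ∑ i, ‖pXc u i z‖ ^ 2 := by
    intro z hz
    rw [Finset.mul_sum]
    refine Finset.sum_congr rfl fun i _ => ?_
    rw [hvx z hz i, norm_mul, mul_pow, Complex.norm_real, Real.norm_eq_abs, sq_abs]
  have hφ'n : ∀ z ∈ HS N, ‖(φ' z.2 : ℂ) * u z‖ ^ 2 ≤ K ^ 2 * (φ z.2 ^ 2 * ‖u z‖ ^ 2) := by
    intro z hz
    rw [norm_mul, mul_pow, Complex.norm_real, Real.norm_eq_abs, ← mul_assoc, ← mul_pow K]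
    have := hK z.2 hz
    gcongr
  have hφn : ∀ z : (Fin N → ℝ) × ℝ, ‖(φ z.2 : ℂ) * pYc u z‖ ^ 2 = φ z.2 ^ 2 * ‖pYc u z‖ ^ 2 := by
    intro z
    rw [norm_mul, mul_pow, Complex.norm_real, Real.norm_eq_abs, sq_abs]
  have hyc : ∀ z ∈ HS N, 0 ≤ z.2 ^ c := fun z hz => Real.rpow_nonneg (le_of_lt hz) c
  have hup : ∀ z ∈ HS N, gradSqC v z * z.2 ^ c ≤ 2 * (gradSqC u z * (φ z.2 ^ 2 * z.2 ^ c)) +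
      2 * K ^ 2 * (‖u z‖ ^ 2 * (φ z.2 ^ 2 * z.2 ^ c)) := by
    intro z hz
    have h0 : gradSqC v z ≤ 2 * (gradSqC u z * φ z.2 ^ 2) + 2 * K ^ 2 * (‖u z‖ ^ 2 * φ z.2 ^ 2) := by
      simp only [gradSqC, hgx z hz, hvy z hz]
      have h1 := pt_two ((φ z.2 : ℂ) * pYc u z) ((φ' z.2 : ℂ) * u z)
      have h2 := hφ'n z hz
      rw [hφn] at h1
      have h3 : 0 ≤ φ z.2 ^ 2 * ∑ i, ‖pXc u i z‖ ^ 2 := by positivity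
      nlinarith
    have := mul_le_mul_of_nonneg_right h0 (hyc z hz)
    nlinarith
  have hlo : ∀ z ∈ HS N, gradSqC u z * (φ z.2 ^ 2 * z.2 ^ c) ≤ 2 * (gradSqC v z * z.2 ^ c) +
      2 * K ^ 2 * (‖u z‖ ^ 2 * (φ z.2 ^ 2 * z.2 ^ c)) := by
    intro z hz
    have h0 : gradSqC u z * φ z.2 ^ 2 ≤ 2 * gradSqC v z + 2 * K ^ 2 * (‖u z‖ ^ 2 * φ z.2 ^ 2) := by
      simp only [gradSqC, hgx z hz]
      have h1 := pt_two (pYc v z) (-((φ' z.2 : ℂ) * u z))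
      have h2 := hφ'n z hz
      rw [norm_neg, hvy z hz, add_neg_cancel_right, hφn, ← hvy z hz] at h1
      have h3 : 0 ≤ φ z.2 ^ 2 * ∑ i, ‖pXc u i z‖ ^ 2 := by positivity
      nlinarith
    have := mul_le_mul_of_nonneg_right h0 (hyc z hz)
    nlinarith
  have hg0 : ∀ z, 0 ≤ gradSqC v z := fun z => by unfold gradSqC; positivity
  have hRHS : IntegrableOn (fun z => 2 * (gradSqC u z * (φ z.2 ^ 2 * z.2 ^ c)) +
      2 * K ^ 2 * (‖u z‖ ^ 2 * (φ z.2 ^ 2 * z.2 ^ c))) (HS N) :=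
    (hG.const_mul 2).add (hU.const_mul (2 * K ^ 2))
  have hV : IntegrableOn (fun z => gradSqC v z * z.2 ^ c) (HS N) := by
    refine Integrable.mono' hRHS ((cg.mul cp).aestronglyMeasurable hm) ?_
    refine (ae_restrict_iff' hm).2 (Filter.Eventually.of_forall fun z hz => ?_)
    rw [Real.norm_of_nonneg (mul_nonneg (hg0 z) (hyc z hz))]
    exact hup z hz
  set F : ((Fin N → ℝ) × ℝ) → ℂ := fun z =>
    (pYc v z * ∑ i, (a i : ℂ) * (starRingEnd ℂ) (pXc v i z)) * ((z.2 ^ c : ℝ) : ℂ) with hF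
  have hFn : ∀ z ∈ HS N, 2 * ‖F z‖ ≤ α * (gradSqC v z * z.2 ^ c) := by
    intro z hz
    have := mul_le_mul_of_nonneg_right (pt_cross a (fun i => pXc v i z) (pYc v z)) (hyc z hz)
    simp only [hF, gradSqC]
    rw [norm_mul, Complex.norm_real, Real.norm_of_nonneg (hyc z hz), ← mul_assoc, ← mul_assoc]
    exact this
  have hFi : IntegrableOn F (HS N) := by
    refine Integrable.mono' hV ?_ ?_
    · refine ContinuousOn.aestronglyMeasurable ?_ hm
      refine (cvy.mul (continuousOn_finsetSum _ fun i _ => continuousOn_const.mul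
        (Complex.continuous_conj.comp_continuousOn (cvx i)))).mul
        (Complex.continuous_ofReal.comp_continuousOn cp)
    · refine (ae_restrict_iff' hm).2 (Filter.Eventually.of_forall fun z hz => ?_)
      have h1 := hFn z hz
      have h2 := mul_nonneg (hg0 z) (hyc z hz)
      nlinarith [norm_nonneg (F z)]
  have hre : (aForm N c a v v).re = (∫ z in HS N, gradSqC v z * z.2 ^ c) +
      2 * (∫ z in HS N, F z).re := by
    have e1 : (∫ z in HS N, ((∑ i, pXc v i z * (starRingEnd ℂ) (pXc v i z)) +
      pYc v z * (starRingEnd ℂ) (pYc v z)) * ((z.2 ^ c : ℝ) : ℂ)) =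
      ((∫ z in HS N, gradSqC v z * z.2 ^ c : ℝ) : ℂ) := by
      rw [← integral_complex_ofReal]
      congr 1
      ext1 z
      simp only [gradSqC, Complex.mul_conj']
      push_cast
      rfl
    unfold aForm
    rw [e1]
    simp [hF]
  have hFbound : |2 * (∫ z in HS N, F z).re| ≤ α * ∫ z in HS N, gradSqC v z * z.2 ^ c := by
    have h1 : ‖∫ z in HS N, F z‖ ≤ ∫ z in HS N, ‖F z‖ := norm_integral_le_integral_norm _
    have h2 : ∫ z in HS N, 2 * ‖F z‖ ≤ ∫ z in HS N, α * (gradSqC v z * z.2 ^ c) :=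
      setIntegral_mono_on (hFi.norm.const_mul 2) (hV.const_mul α) hm hFn
    rw [integral_const_mul, integral_const_mul] at h2
    rw [abs_mul, abs_two]
    have h3 := Complex.abs_re_le_norm (∫ z in HS N, F z)
    linarith
  have I1 := setIntegral_mono_on hV hRHS hm hup
  have I2 := setIntegral_mono_on hG ((hV.const_mul 2).add (hU.const_mul (2 * K ^ 2))) hm hlo
  simp only [Pi.add_apply] at I2
  rw [integral_add (hG.const_mul 2) (hU.const_mul _), integral_const_mul, integral_const_mul] at I1
  rw [integral_add (hV.const_mul 2) (hU.const_mul _), integral_const_mul, integral_const_mul] at I2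
  have V0 : 0 ≤ ∫ z in HS N, gradSqC v z * z.2 ^ c :=
    setIntegral_nonneg hm fun z hz => mul_nonneg (hg0 z) (hyc z hz)
  have U0 : 0 ≤ ∫ z in HS N, ‖u z‖ ^ 2 * (φ z.2 ^ 2 * z.2 ^ c) :=
    setIntegral_nonneg hm fun z hz => mul_nonneg (by positivity) (mul_nonneg (by positivity) (hyc z hz))
  have G0 : 0 ≤ ∫ z in HS N, gradSqC u z * (φ z.2 ^ 2 * z.2 ^ c) :=
    setIntegral_nonneg hm fun z hz => mul_nonneg (by unfold gradSqC; positivity)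
      (mul_nonneg (by positivity) (hyc z hz))
  rw [hre]
  obtain ⟨b1, b2⟩ := abs_le.1 hFbound
  generalize (∫ z in HS N, gradSqC v z * z.2 ^ c) = V at *
  generalize (∫ z in HS N, ‖u z‖ ^ 2 * (φ z.2 ^ 2 * z.2 ^ c)) = U at *
  generalize (∫ z in HS N, gradSqC u z * (φ z.2 ^ 2 * z.2 ^ c)) = G at *
  generalize 2 * (∫ z in HS N, F z).re = q at *
  have hr : 0 < 1 / (1 - α) := by positivity
  have hr2 : (1 / (1 - α)) * (1 - α) = 1 := by field_simp
  have hr3 : 2 / (1 - α) = 2 * (1 / (1 - α)) := by ring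
  rw [hr3]
  set r := 1 / (1 - α)
  have hCpos : 0 < 2 * r + 4 * K ^ 2 + 5 := by positivity
  have hQ : (1 - α) * V ≤ V + q := by linarith
  have hQ0 : 0 ≤ V + q := le_trans (by positivity) hQ
  have hVQ : V ≤ r * (V + q) := by
    calc V = r * ((1 - α) * V) := by rw [← mul_assoc, hr2, one_mul]
      _ ≤ _ := by gcongr
  have hKQ : 0 ≤ K ^ 2 * (V + q) := by positivity
  have hKU : 0 ≤ K ^ 2 * U := by positivity
  have hKG : 0 ≤ K ^ 2 * G := by positivity
  have hrU : 0 ≤ r * U := by positivity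
  have hrG : 0 ≤ r * G := by positivity
  have hQ2 : V + q ≤ 2 * V := by nlinarith
  constructor
  · rw [inv_mul_le_iff₀ hCpos]
    linarith
  · linarith

/-- equivalence of the norms `u ↦ (Re 𝔞(φu,φu) + ‖u‖²_ν)^{1/2}` and the
`H¹_ν` norm on `𝒞`, where `dν = φ² y^c dx dy`. -/
theorem stmt_13 (N : ℕ) (hN : 1 ≤ N) (c : ℝ) (hc : c + 1 > 0)
    (a : Fin N → ℝ) (ha : Real.sqrt (∑ i, a i ^ 2) < 1)
    (η : ℝ → ℝ) (hη_smooth : ContDiffOn ℝ (⊤ : ℕ∞) η (Set.Ici (0 : ℝ)))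
    (hη_nonneg : ∀ y : ℝ, 0 ≤ y → 0 ≤ η y)
    (hη_le_one : ∀ y : ℝ, 0 ≤ y → η y ≤ 1)
    (hη_one : ∀ y : ℝ, 0 ≤ y → y ≤ 1 / 2 → η y = 1)
    (hη_zero : ∀ y : ℝ, 2 ≤ y → η y = 0)
    (φ : ℝ → ℝ) (hφ : ∀ y : ℝ, φ y = η y + (1 - η y) * y ^ (-(c / 2))) :
    ∃ C ≥ 1, ∀ u : ((Fin N → ℝ) × ℝ) → ℂ, memC u →
      C⁻¹ * ((∫ z in HS N, gradSqC u z * (φ z.2 ^ 2 * z.2 ^ c)) +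
          ∫ z in HS N, ‖u z‖ ^ 2 * (φ z.2 ^ 2 * z.2 ^ c)) ≤
        (aForm N c a (fun z => (φ z.2 : ℂ) * u z) (fun z => (φ z.2 : ℂ) * u z)).re +
          (∫ z in HS N, ‖u z‖ ^ 2 * (φ z.2 ^ 2 * z.2 ^ c)) ∧
      (aForm N c a (fun z => (φ z.2 : ℂ) * u z) (fun z => (φ z.2 : ℂ) * u z)).re +
          (∫ z in HS N, ‖u z‖ ^ 2 * (φ z.2 ^ 2 * z.2 ^ c)) ≤
        C * ((∫ z in HS N, gradSqC u z * (φ z.2 ^ 2 * z.2 ^ c)) +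
          ∫ z in HS N, ‖u z‖ ^ 2 * (φ z.2 ^ 2 * z.2 ^ c)) := by
  have hηd : ContDiffOn ℝ (⊤ : ℕ∞) η (Set.Ioi 0) := hη_smooth.mono Set.Ioi_subset_Ici_self
  have hφd : ContDiffOn ℝ (⊤ : ℕ∞) φ (Set.Ioi 0) := by
    have hp : ContDiffOn ℝ (⊤ : ℕ∞) (fun y : ℝ => y ^ (-(c / 2))) (Set.Ioi 0) := fun y hy =>
      (Real.contDiffAt_rpow_const_of_ne (ne_of_gt hy)).contDiffWithinAt
    exact (hηd.add ((contDiffOn_const.sub hηd).mul hp)).congr fun y _ => hφ y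
  have hdiff : ∀ y, 0 < y → HasDerivAt φ (deriv φ y) y := fun y hy =>
    ((hφd.contDiffAt (Ioi_mem_nhds hy)).differentiableAt (by simp)).hasDerivAt
  have hdc : ContinuousOn (deriv φ) (Set.Ioi 0) :=
    hφd.continuousOn_deriv_of_isOpen isOpen_Ioi (by simp)
  have hφc : ContinuousOn φ (Set.Ioi 0) := hφd.continuousOn
  have hpos : ∀ y, 0 < y → 0 < φ y := by
    intro y hy
    rw [hφ]
    have h1 := hη_nonneg y hy.le
    have h2 := hη_le_one y hy.le
    have h3 : 0 < y ^ (-(c / 2)) := Real.rpow_pos_of_pos hy _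
    rcases h1.eq_or_lt with h | h
    · rw [← h]; simpa using h3
    · have := mul_nonneg (sub_nonneg.2 h2) h3.le
      linarith
  have hsub : Set.Icc (1 / 2 : ℝ) 2 ⊆ Set.Ioi 0 := fun y hy => lt_of_lt_of_le (by norm_num) hy.1
  obtain ⟨K0, hK0⟩ := (isCompact_Icc (a := (1 / 2 : ℝ)) (b := 2)).exists_bound_of_continuousOn
    ((hdc.mono hsub).div (hφc.mono hsub) fun y hy => (hpos y (hsub hy)).ne')
  have hK00 : 0 ≤ K0 := (norm_nonneg _).trans (hK0 1 (by norm_num))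
  refine main_abs N c a ha φ (deriv φ) (K0 + |c|) hdiff hdc ?_ ?_
  · intro y hy
    have hp := hpos y hy
    rcases lt_or_ge y (1 / 2) with h1 | h1
    · have : φ =ᶠ[nhds y] fun _ => 1 := by
        filter_upwards [Ioo_mem_nhds hy h1] with t ht
        rw [hφ, hη_one t ht.1.le ht.2.le]; simp
      rw [this.deriv_eq]
      simp only [deriv_const, abs_zero]
      positivity
    rcases le_or_gt y 2 with h2 | h2
    · have := hK0 y ⟨h1, h2⟩
      rw [Real.norm_eq_abs, Pi.div_apply, abs_div, abs_of_pos hp, div_le_iff₀ hp] at this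
      nlinarith [abs_nonneg c]
    · have : φ =ᶠ[nhds y] fun t => t ^ (-(c / 2)) := by
        filter_upwards [Ioi_mem_nhds h2] with t ht
        rw [hφ, hη_zero t (le_of_lt ht)]; simp
      rw [this.deriv_eq, this.eq_of_nhds, (Real.hasDerivAt_rpow_const (Or.inl hy.ne')).deriv,
        Real.rpow_sub_one hy.ne', abs_mul, abs_div, abs_of_pos hy,
        abs_of_pos (Real.rpow_pos_of_pos hy _), abs_neg, abs_div, abs_two]
      have h3 : 0 < y ^ (-(c / 2)) := Real.rpow_pos_of_pos hy _
      have h4 : y ^ (-(c / 2)) / y ≤ y ^ (-(c / 2)) := div_le_self h3.le (by linarith)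
      have h5 : |c| / 2 ≤ K0 + |c| := by linarith [abs_nonneg c]
      exact mul_le_mul h5 h4 (by positivity) (by positivity)
  · intro R hR
    have hA : IntegrableOn (fun y => φ y ^ 2 * y ^ c) (Set.Ioc 0 (1 / 2)) := by
      have h := (intervalIntegral.intervalIntegrable_rpow' (a := 0) (b := 1 / 2)
        (show -1 < c by linarith)).1
      refine h.congr_fun (fun y hy => ?_) measurableSet_Ioc
      simp [hφ, hη_one y hy.1.le hy.2]
    have hB : IntegrableOn (fun y => φ y ^ 2 * y ^ c) (Set.Icc (1 / 2) R) := by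
      have hs : Set.Icc (1 / 2 : ℝ) R ⊆ Set.Ioi 0 := fun y hy => lt_of_lt_of_le (by norm_num) hy.1
      refine ContinuousOn.integrableOn_Icc (((hφc.mono hs).pow 2).mul fun y hy => ?_)
      exact (Real.continuousAt_rpow_const y c (Or.inl (ne_of_gt (hs hy)))).continuousWithinAt
    refine (hA.union hB).mono_set fun y hy => ?_
    rcases le_total y (1 / 2) with h | h
    · exact Or.inl ⟨hy.1, h⟩
    · exact Or.inr ⟨h, hy.2⟩
end
end

section
/- Let N ≥ 1, c ∈ ℝ with c + 1 > 0, a ∈ ℝ^N with |a| < 1, and let φ be as in the context. Then for every ε ∈ (0,1) there exists a constant C_ε > 0, depending only on ε, a and c, such that for every α ∈ ℝ, every ψ ∈ Ψ and every u ∈ 𝒞 one has Re 𝔞(e^{αψ} φ u, e^{−αψ} φ u) ≥ ε(1−|a|) ‖∇u‖²_{L²_ν} − C_ε(α² + 1) ‖u‖²_{L²_ν}, where ‖w‖²_{L²_ν} = ∫_{ℝ^{N+1}_+} |w|² φ(y)² y^c dx dy. -/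
open MeasureTheory Real

noncomputable section

/-- Partial derivative of a real-valued function in the `i`-th `x` direction. -/
def pXr {N : ℕ} (ψ : ((Fin N → ℝ) × ℝ) → ℝ) (i : Fin N) (z : (Fin N → ℝ) × ℝ) : ℝ :=
  fderiv ℝ ψ z (Pi.single i 1, 0)

/-- Partial derivative of a real-valued function in the `y` direction. -/
def pYr {N : ℕ} (ψ : ((Fin N → ℝ) × ℝ) → ℝ) (z : (Fin N → ℝ) × ℝ) : ℝ :=
  fderiv ℝ ψ z (0, 1)

/-- Euclidean norm of a vector of `ℝ^{N+1} = ℝ^N × ℝ`. -/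
def eNrm {N : ℕ} (w : (Fin N → ℝ) × ℝ) : ℝ :=
  Real.sqrt ((∑ i, w.1 i ^ 2) + w.2 ^ 2)

/-- The class `Ψ` of smooth bounded real functions with `|∇ψ| ≤ 1` (Euclidean norm of
the gradient) and `|D²ψ| ≤ 1` (operator norm of the Hessian, expressed via the
bilinear bound). -/
def memPsi {N : ℕ} (ψ : ((Fin N → ℝ) × ℝ) → ℝ) : Prop :=
  ContDiff ℝ (⊤ : ℕ∞) ψ ∧ (∃ M : ℝ, ∀ z, |ψ z| ≤ M) ∧
    (∀ z, Real.sqrt ((∑ i, pXr ψ i z ^ 2) + pYr ψ z ^ 2) ≤ 1) ∧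
    (∀ z v w, |fderiv ℝ (fun z' => fderiv ℝ ψ z' v) z w| ≤ eNrm v * eNrm w)

/-- Properties of the auxiliary weight `φ`. -/
theorem phi_props (c : ℝ)
    (η : ℝ → ℝ) (hη_smooth : ContDiffOn ℝ (⊤ : ℕ∞) η (Set.Ici (0 : ℝ)))
    (hη_nonneg : ∀ y : ℝ, 0 ≤ y → 0 ≤ η y)
    (hη_le_one : ∀ y : ℝ, 0 ≤ y → η y ≤ 1)
    (hη_one : ∀ y : ℝ, 0 ≤ y → y ≤ 1 / 2 → η y = 1)
    (hη_zero : ∀ y : ℝ, 2 ≤ y → η y = 0)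
    (φ : ℝ → ℝ) (hφ : ∀ y : ℝ, φ y = η y + (1 - η y) * y ^ (-(c / 2))) :
    ∃ F K : ℝ → ℝ, Continuous F ∧ Continuous K ∧ (∃ B, 0 ≤ B ∧ ∀ y, 0 < y → |K y| ≤ B) ∧
      ∀ y, 0 < y → φ y = F y ∧ HasDerivAt φ (F y * K y) y := by
  have hpos : ∀ y, 0 < y → 0 < φ y := by
    intro y hy
    rw [hφ]
    have h1 := hη_nonneg y hy.le
    have h2 := hη_le_one y hy.le
    have h3 : 0 < y ^ (-(c / 2)) := Real.rpow_pos_of_pos hy _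
    rcases h1.eq_or_lt with h | h
    · rw [← h]; simpa using h3
    · have : 0 ≤ (1 - η y) * y ^ (-(c / 2)) := mul_nonneg (by linarith) h3.le
      linarith
  have hsm : ContDiffOn ℝ (⊤ : ℕ∞) φ (Set.Ioi 0) := by
    have h1 : ContDiffOn ℝ (⊤ : ℕ∞) η (Set.Ioi 0) := hη_smooth.mono Set.Ioi_subset_Ici_self
    have h2 : ContDiffOn ℝ (⊤ : ℕ∞) (fun y : ℝ => y ^ (-(c / 2))) (Set.Ioi 0) :=
      contDiffOn_id.rpow_const_of_ne (fun y hy => ne_of_gt hy)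
    have h3 : φ = fun y => η y + (1 - η y) * y ^ (-(c / 2)) := funext hφ
    rw [h3]
    exact h1.add ((contDiffOn_const.sub h1).mul h2)
  have hdiff : ∀ y, 0 < y → HasDerivAt φ (deriv φ y) y := fun y hy =>
    ((hsm.differentiableOn (by simp)).differentiableAt (Ioi_mem_nhds hy)).hasDerivAt
  have hcd : ContinuousOn (deriv φ) (Set.Ioi 0) :=
    hsm.continuousOn_deriv_of_isOpen isOpen_Ioi (by simp)
  have hcφ := hsm.continuousOn
  have hm : Continuous (fun y : ℝ => max y (1/4)) := by fun_prop
  have hmp : ∀ y : ℝ, max y (1/4) ∈ Set.Ioi (0:ℝ) := fun y => by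
    simp
  have hF : Continuous (fun y : ℝ => φ (max y (1/4))) := hcφ.comp_continuous hm hmp
  have hD : Continuous (fun y : ℝ => deriv φ (max y (1/4))) := hcd.comp_continuous hm hmp
  have hK : Continuous (fun y : ℝ => deriv φ (max y (1/4)) / φ (max y (1/4))) :=
    hD.div hF (fun y => (hpos _ (hmp y)).ne')
  have hsmall : ∀ y : ℝ, 0 < y → y < 1/2 → φ y = 1 ∧ HasDerivAt φ 0 y := by
    intro y h0 h1
    have hh : ∀ y : ℝ, 0 < y → y < 1/2 → φ y = 1 := by
      intro y h0 h1
      rw [hφ, hη_one y h0.le h1.le]; simp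
    refine ⟨hh y h0 h1, ?_⟩
    refine (hasDerivAt_const y (1:ℝ)).congr_of_eventuallyEq ?_
    filter_upwards [Ioo_mem_nhds h0 h1] with t ht using hh t ht.1 ht.2
  refine ⟨_, _, hF, hK, ?_, ?_⟩
  · obtain ⟨B, hB⟩ := (isCompact_Icc (a := (0:ℝ)) (b := 3)).exists_bound_of_continuousOn
      hK.continuousOn
    refine ⟨max B |c|, le_max_of_le_right (abs_nonneg _), ?_⟩
    intro y hy
    rcases le_or_gt y 3 with h | h
    · exact (hB y ⟨hy.le, h⟩).trans (le_max_left _ _)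
    · refine le_trans ?_ (le_max_right _ _)
      have e1 : max y (1/4) = y := max_eq_left (by linarith)
      rw [e1]
      have hh : ∀ t : ℝ, 2 < t → φ t = t ^ (-(c / 2)) := by
        intro t ht; rw [hφ, hη_zero t ht.le]; simp
      have hd : HasDerivAt φ ((-(c / 2)) * y ^ (-(c / 2) - 1)) y := by
        refine (Real.hasDerivAt_rpow_const (Or.inl hy.ne')).congr_of_eventuallyEq ?_
        filter_upwards [Ioi_mem_nhds (show (2:ℝ) < y by linarith)] with t ht using hh t ht
      rw [hd.deriv, hh y (by linarith), Real.rpow_sub_one hy.ne']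
      have hp : y ^ (-(c / 2)) ≠ 0 := (Real.rpow_pos_of_pos hy _).ne'
      have : -(c / 2) * (y ^ (-(c / 2)) / y) / y ^ (-(c / 2)) = -(c/(2 * y)) := by
        field_simp
      rw [this, abs_neg, abs_div]
      apply div_le_self (abs_nonneg _)
      rw [abs_of_pos (by linarith)]; linarith
  · intro y hy
    rcases le_or_gt y (1/4) with h | h
    · have e1 : max y (1/4) = 1/4 := max_eq_right h
      obtain ⟨a1, a2⟩ := hsmall y hy (by linarith)
      obtain ⟨b1, b2⟩ := hsmall (1/4) (by norm_num) (by norm_num)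
      simp only [e1]
      rw [a1, b1, b2.deriv]
      simpa using a2
    · have e1 : max y (1/4) = y := max_eq_left h.le
      simp only [e1]
      refine ⟨trivial, ?_⟩
      rw [mul_div_cancel₀ _ (hpos y hy).ne']
      exact hdiff y hy

theorem weight_int {N : ℕ} (c : ℝ) (hc : c + 1 > 0) {E : Type*} [NormedAddCommGroup E]
    [NormedSpace ℝ E] (G : ((Fin N → ℝ) × ℝ) → E) (hG : Continuous G)
    (hs : HasCompactSupport G) :
    IntegrableOn (fun z => (z.2 ^ c) • G z) (HS N) := by
  have hHS : HS N = Set.univ ×ˢ Set.Ioi (0:ℝ) := by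
    ext z; simp [HS]
  have hmeas : (volume : Measure ((Fin N → ℝ) × ℝ)).restrict (HS N) =
      (volume : Measure (Fin N → ℝ)).prod ((volume : Measure ℝ).restrict (Set.Ioi 0)) := by
    rw [hHS, Measure.volume_eq_prod, ← Measure.prod_restrict, Measure.restrict_univ]
  have hl : LocallyIntegrable (fun z : (Fin N → ℝ) × ℝ => z.2 ^ c)
      ((volume : Measure ((Fin N → ℝ) × ℝ)).restrict (HS N)) := by
    rw [locallyIntegrable_iff]
    intro k hk
    obtain ⟨R, hR⟩ := hk.isBounded.subset_closedBall 0
    rw [hmeas]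
    have h1 : IntegrableOn (fun y : ℝ => y ^ c) (Set.Iic (max R 0))
        ((volume : Measure ℝ).restrict (Set.Ioi 0)) := by
      rw [IntegrableOn, Measure.restrict_restrict measurableSet_Iic, Set.Iic_inter_Ioi]
      exact (intervalIntegrable_iff_integrableOn_Ioc_of_le (le_max_right _ _)).1
        (intervalIntegral.intervalIntegrable_rpow' (by linarith))
    have h2 : IntegrableOn (fun _ : Fin N → ℝ => (1:ℝ)) (Metric.closedBall 0 R) volume :=
      integrableOn_const (isCompact_closedBall _ _).measure_ne_top
    have h3 := Integrable.mul_prod h2 h1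
    rw [Measure.prod_restrict] at h3
    simp only [one_mul] at h3
    refine IntegrableOn.mono_set h3 ?_
    intro z hz
    have := hR hz
    rw [mem_closedBall_zero_iff, Prod.norm_def] at this
    refine ⟨by simpa using (le_max_left _ _).trans this, ?_⟩
    have h4 := (le_max_right _ _).trans this
    exact (le_abs_self _).trans (h4.trans (le_max_left _ _))
  exact hl.integrable_smul_right_of_hasCompactSupport hG hs

theorem real_ineq (A B ε X q u α S R T : ℝ) (hA0 : 0 ≤ A) (hA1 : A < 1) (hB : 0 ≤ B) (hε₁ : ε < 1)
    (hX0 : 0 ≤ X) (hq0 : 0 ≤ q) (hu0 : 0 ≤ u) (hs1 : S ≤ 1)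
    (f1 : q ^ 2 - 2 * B * q * u ≤ R)
    (f2 : -((q + (|α| + B) * u) * (A * X + |α| * u)) ≤ T) :
    ε * (1 - A) * (X ^ 2 + q ^ 2) -
      ((3 + 2 / ((1 - ε) * (1 - A))) * (2 * (1 + B ^ 2))) * (α ^ 2 + 1) * u ^ 2 ≤
    X ^ 2 + R - α ^ 2 * u ^ 2 * S + 2 * T := by
  have hα0 := abs_nonneg α
  set L := (|α| + B) * u with hL
  set δ := (1 - ε) * (1 - A) with hδ
  have hδ0 : 0 < δ := mul_pos (by linarith) (by linarith)
  have hL0 : 0 ≤ L := by positivity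
  have young : ∀ r : ℝ, 2 * L * r ≤ δ * r ^ 2 + L ^ 2 / δ := by
    intro r
    have : 0 ≤ (δ * r - L) ^ 2 / δ := by positivity
    have h : (δ * r - L) ^ 2 / δ = δ * r ^ 2 + L ^ 2 / δ - 2 * L * r := by
      field_simp
      ring
    linarith
  have y1 := young X
  have y2 := young q
  have g1 : L ^ 2 ≤ 2 * (1 + B ^ 2) * ((α ^ 2 + 1) * u ^ 2) := by
    have h1 : (|α| + B) ^ 2 ≤ 2 * (1 + B ^ 2) * (α ^ 2 + 1) := by
      have := sq_abs α
      nlinarith [sq_nonneg (|α| - B), sq_nonneg (α * B)]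
    have : L ^ 2 = (|α| + B) ^ 2 * u ^ 2 := by rw [hL]; ring
    rw [this]
    nlinarith [sq_nonneg u]
  have g2 : (3 + 2 / δ) * L ^ 2 ≤ ((3 + 2 / δ) * (2 * (1 + B ^ 2))) * (α ^ 2 + 1) * u ^ 2 := by
    have : 0 ≤ 3 + 2 / δ := by positivity
    calc _ ≤ (3 + 2 / δ) * (2 * (1 + B ^ 2) * ((α ^ 2 + 1) * u ^ 2)) := by gcongr
      _ = _ := by ring
  have g3 : α ^ 2 * u ^ 2 * S ≤ α ^ 2 * u ^ 2 :=
    mul_le_of_le_one_right (by positivity) hs1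
  have hαu : |α| * u ≤ L := by rw [hL]; nlinarith
  have g4 : α ^ 2 * u ^ 2 ≤ L ^ 2 := by
    rw [← sq_abs α, ← mul_pow]
    gcongr
  have g5 : L * (|α| * u) ≤ L ^ 2 := by nlinarith
  have g6 : B * u + |α| * u = L := by rw [hL]; ring
  have g7 : L * (A * X) ≤ L * X := by
    gcongr; nlinarith
  have g8 : 2 * A * q * X ≤ A * (q ^ 2 + X ^ 2) := by nlinarith [sq_nonneg (q - X)]
  have g9 : 2 * B * q * u + 2 * q * (|α| * u) = 2 * L * q := by rw [← g6]; ring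
  have g10 : (3 + 2 / δ) * L ^ 2 = 3 * L ^ 2 + 2 * (L ^ 2 / δ) := by ring
  have g11 : ε * (1 - A) = 1 - A - δ := by rw [hδ]; ring
  rw [g11]
  have g12 : (q + L) * (A * X + |α| * u) =
      A * q * X + q * (|α| * u) + L * (A * X) + L * (|α| * u) := by ring
  rw [g12] at f2
  linarith

theorem pointwise_ineq {N : ℕ} (a : Fin N → ℝ) (A B ε : ℝ) (hA : A = Real.sqrt (∑ i, a i ^ 2))
    (hA1 : A < 1) (hB : 0 ≤ B) (hε₁ : ε < 1)
    (p : Fin N → ℂ) (q u : ℂ) (s : Fin N → ℝ) (t k α : ℝ)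
    (hs : Real.sqrt ((∑ i, s i ^ 2) + t ^ 2) ≤ 1) (hk : |k| ≤ B) :
    ε * (1 - A) * ((∑ i, ‖p i‖ ^ 2) + ‖q‖ ^ 2) -
      ((3 + 2 / ((1 - ε) * (1 - A))) * (2 * (1 + B ^ 2))) * (α ^ 2 + 1) * ‖u‖ ^ 2 ≤
    ((∑ i, (p i + ((α * s i : ℝ) : ℂ) * u) * (starRingEnd ℂ) (p i + ((-α * s i : ℝ) : ℂ) * u)) +
      (q + ((α * t + k : ℝ) : ℂ) * u) * (starRingEnd ℂ) (q + ((-α * t + k : ℝ) : ℂ) * u)).re +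
    2 * ((q + ((α * t + k : ℝ) : ℂ) * u) *
      ∑ i, (a i : ℂ) * (starRingEnd ℂ) (p i + ((-α * s i : ℝ) : ℂ) * u)).re := by
  have hA0 : 0 ≤ A := hA ▸ Real.sqrt_nonneg _
  have hs1 : (∑ i, s i ^ 2) + t ^ 2 ≤ 1 := by
    have := (Real.sqrt_le_iff.1 hs).2
    linarith
  have hσ : 0 ≤ ∑ i, s i ^ 2 := Finset.sum_nonneg (fun i _ => sq_nonneg _)
  set X := Real.sqrt (∑ i, ‖p i‖ ^ 2) with hX
  have hX0 : 0 ≤ X := Real.sqrt_nonneg _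
  have hX2 : X ^ 2 = ∑ i, ‖p i‖ ^ 2 := Real.sq_sqrt (Finset.sum_nonneg (fun i _ => sq_nonneg _))
  set b : ℂ := ∑ i, (a i : ℂ) * (starRingEnd ℂ) (p i) with hb
  have hbn : ‖b‖ ≤ A * X := by
    calc ‖b‖ ≤ ∑ i, |a i| * ‖p i‖ := by
          refine (norm_sum_le _ _).trans (le_of_eq ?_)
          simp
      _ ≤ Real.sqrt (∑ i, |a i| ^ 2) * Real.sqrt (∑ i, ‖p i‖ ^ 2) :=
          Real.sum_mul_le_sqrt_mul_sqrt _ _ _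
      _ = A * X := by rw [hA, hX]; simp
  set m : ℝ := ∑ i, a i * s i with hm
  have hmn : |m| ≤ 1 := by
    have h1 : |m| ≤ Real.sqrt (∑ i, |a i| ^ 2) * Real.sqrt (∑ i, |s i| ^ 2) := by
      refine le_trans ?_ (Real.sum_mul_le_sqrt_mul_sqrt _ _ _)
      refine (Finset.abs_sum_le_sum_abs _ _).trans (le_of_eq ?_)
      simp [abs_mul]
    have h2 : Real.sqrt (∑ i, |s i| ^ 2) ≤ 1 := by
      rw [Real.sqrt_le_iff]
      refine ⟨zero_le_one, ?_⟩
      simp only [sq_abs]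
      nlinarith [sq_nonneg t]
    have h3 : Real.sqrt (∑ i, |a i| ^ 2) = A := by rw [hA]; simp
    rw [h3] at h1
    nlinarith
  have ht : |t| ≤ 1 := by
    rw [← sq_le_one_iff_abs_le_one]; linarith
  have e1 : ((∑ i, (p i + ((α * s i : ℝ) : ℂ) * u) *
      (starRingEnd ℂ) (p i + ((-α * s i : ℝ) : ℂ) * u))).re =
      X ^ 2 - α ^ 2 * (∑ i, s i ^ 2) * ‖u‖ ^ 2 := by
    rw [hX2, Complex.re_sum, Finset.mul_sum, Finset.sum_mul, ← Finset.sum_sub_distrib]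
    refine Finset.sum_congr rfl (fun i _ => ?_)
    rw [← Complex.normSq_eq_norm_sq, ← Complex.normSq_eq_norm_sq, Complex.normSq_apply,
      Complex.normSq_apply]
    simp
    ring
  have e2 : ((q + ((α * t + k : ℝ) : ℂ) * u) *
      (starRingEnd ℂ) (q + ((-α * t + k : ℝ) : ℂ) * u)).re =
      ‖q + (k : ℂ) * u‖ ^ 2 - α ^ 2 * t ^ 2 * ‖u‖ ^ 2 := by
    rw [← Complex.normSq_eq_norm_sq, ← Complex.normSq_eq_norm_sq, Complex.normSq_apply,
      Complex.normSq_apply]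
    simp
    ring
  have e3 : ∑ i, (a i : ℂ) * (starRingEnd ℂ) (p i + ((-α * s i : ℝ) : ℂ) * u) =
      b - ((α * m : ℝ) : ℂ) * (starRingEnd ℂ) u := by
    rw [hb, hm]
    push_cast
    rw [Finset.mul_sum, Finset.sum_mul, ← Finset.sum_sub_distrib]
    refine Finset.sum_congr rfl (fun i _ => ?_)
    simp
    ring
  rw [Complex.add_re, e1, e2, e3, ← hX2]
  have hq0 := norm_nonneg q
  have hu0 := norm_nonneg u
  have hα0 := abs_nonneg α
  have f1 : ‖q‖ ^ 2 - 2 * B * ‖q‖ * ‖u‖ ≤ ‖q + (k : ℂ) * u‖ ^ 2 := by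
    have h1 : ‖q‖ - |k| * ‖u‖ ≤ ‖q + (k : ℂ) * u‖ := by
      have := norm_sub_norm_le q (-((k : ℂ) * u))
      simpa using this
    have h1' := norm_nonneg (q + (k : ℂ) * u)
    have h2 : |k| * ‖u‖ ≤ B * ‖u‖ := by gcongr
    have h3 : 0 ≤ B * ‖u‖ := by positivity
    rcases le_or_gt (‖q‖) (B * ‖u‖) with h | h
    · nlinarith
    · nlinarith
  have f2 : -((‖q‖ + (|α| + B) * ‖u‖) * (A * X + |α| * ‖u‖)) ≤
      ((q + ((α * t + k : ℝ) : ℂ) * u) * (b - ((α * m : ℝ) : ℂ) * (starRingEnd ℂ) u)).re := by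
    have h1 : ‖q + ((α * t + k : ℝ) : ℂ) * u‖ ≤ ‖q‖ + (|α| + B) * ‖u‖ := by
      refine (norm_add_le _ _).trans ?_
      rw [norm_mul, Complex.norm_real, Real.norm_eq_abs]
      have : |α * t + k| ≤ |α| + B := by
        refine (abs_add_le _ _).trans ?_
        rw [abs_mul]
        nlinarith
      gcongr
    have h2 : ‖b - ((α * m : ℝ) : ℂ) * (starRingEnd ℂ) u‖ ≤ A * X + |α| * ‖u‖ := by
      refine (norm_sub_le _ _).trans ?_
      rw [norm_mul, Complex.norm_real, Real.norm_eq_abs, RCLike.norm_conj]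
      have : |α * m| ≤ |α| := by
        rw [abs_mul]
        nlinarith
      gcongr
    have h3 := Complex.abs_re_le_norm
      ((q + ((α * t + k : ℝ) : ℂ) * u) * (b - ((α * m : ℝ) : ℂ) * (starRingEnd ℂ) u))
    rw [norm_mul] at h3
    have h4 := mul_le_mul h1 h2 (norm_nonneg _) (by positivity)
    have := neg_abs_le ((q + ((α * t + k : ℝ) : ℂ) * u) *
      (b - ((α * m : ℝ) : ℂ) * (starRingEnd ℂ) u)).re
    linarith
  have := real_ineq A B ε X ‖q‖ ‖u‖ α ((∑ i, s i ^ 2) + t ^ 2) _ _ hA0 hA1 hB hε₁ hX0 hq0 hu0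
    hs1 f1 f2
  refine this.trans (le_of_eq ?_)
  ring

theorem deriv_prod {N : ℕ} (β : ℝ) (ψ : ((Fin N → ℝ) × ℝ) → ℝ) (u : ((Fin N → ℝ) × ℝ) → ℂ)
    (φ : ℝ → ℝ) (F K : ℝ) (z v : (Fin N → ℝ) × ℝ) (hψ : DifferentiableAt ℝ ψ z)
    (hu : DifferentiableAt ℝ u z) (hF : φ z.2 = F) (hφ : HasDerivAt φ (F * K) z.2) :
    fderiv ℝ (fun z => (Real.exp (β * ψ z) : ℂ) * (φ z.2 : ℂ) * u z) z v =
      ((Real.exp (β * ψ z) * F : ℝ) : ℂ) *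
        (fderiv ℝ u z v + ((β * fderiv ℝ ψ z v + v.2 * K : ℝ) : ℂ) * u z) := by
  have h1 : HasFDerivAt (fun z => Real.exp (β * ψ z)) _ z := (hψ.hasFDerivAt.const_mul β).exp
  have h2 : HasFDerivAt (fun z : (Fin N → ℝ) × ℝ => φ z.2) _ z :=
    hφ.hasFDerivAt.comp z hasFDerivAt_snd
  have h3 := Complex.ofRealCLM.hasFDerivAt.comp z (h1.mul h2)
  have h4 := h3.mul hu.hasFDerivAt
  have h5 : (fun z => (Real.exp (β * ψ z) : ℂ) * (φ z.2 : ℂ) * u z) =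
      (fun z => (Complex.ofRealCLM ∘ ((fun z => Real.exp (β * ψ z)) * fun z => φ z.2)) z * u z) := by
    funext z; simp
  rw [h5]
  erw [h4.fderiv]
  simp [hF]
  ring

/-- lower bound for the perturbed forms
`Re 𝔞(e^{αψ}φu, e^{−αψ}φu) ≥ ε(1−|a|)‖∇u‖²_ν − C_ε(α²+1)‖u‖²_ν`, where
`dν = φ² y^c dx dy`, uniformly in `α ∈ ℝ` and `ψ ∈ Ψ`. -/
theorem stmt_14 (N : ℕ) (hN : 1 ≤ N) (c : ℝ) (hc : c + 1 > 0)
    (a : Fin N → ℝ) (ha : Real.sqrt (∑ i, a i ^ 2) < 1)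
    (η : ℝ → ℝ) (hη_smooth : ContDiffOn ℝ (⊤ : ℕ∞) η (Set.Ici (0 : ℝ)))
    (hη_nonneg : ∀ y : ℝ, 0 ≤ y → 0 ≤ η y)
    (hη_le_one : ∀ y : ℝ, 0 ≤ y → η y ≤ 1)
    (hη_one : ∀ y : ℝ, 0 ≤ y → y ≤ 1 / 2 → η y = 1)
    (hη_zero : ∀ y : ℝ, 2 ≤ y → η y = 0)
    (φ : ℝ → ℝ) (hφ : ∀ y : ℝ, φ y = η y + (1 - η y) * y ^ (-(c / 2)))
    (ε : ℝ) (hε₀ : 0 < ε) (hε₁ : ε < 1) :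
    ∃ C > 0, ∀ (α : ℝ) (ψ : ((Fin N → ℝ) × ℝ) → ℝ), memPsi ψ →
      ∀ u : ((Fin N → ℝ) × ℝ) → ℂ, memC u →
        ε * (1 - Real.sqrt (∑ i, a i ^ 2)) *
            (∫ z in HS N, gradSqC u z * (φ z.2 ^ 2 * z.2 ^ c)) -
          C * (α ^ 2 + 1) * (∫ z in HS N, ‖u z‖ ^ 2 * (φ z.2 ^ 2 * z.2 ^ c)) ≤
        (aForm N c a
          (fun z => (Real.exp (α * ψ z) : ℂ) * (φ z.2 : ℂ) * u z)
          (fun z => (Real.exp (-(α * ψ z)) : ℂ) * (φ z.2 : ℂ) * u z)).re := by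
  obtain ⟨F, K, hFc, hKc, ⟨B, hB, hKB⟩, hFK⟩ := phi_props c η hη_smooth hη_nonneg hη_le_one
    hη_one hη_zero φ hφ
  set A := Real.sqrt (∑ i, a i ^ 2) with hA
  set C := (3 + 2 / ((1 - ε) * (1 - A))) * (2 * (1 + B ^ 2)) with hC
  have hδ0 : 0 < (1 - ε) * (1 - A) := mul_pos (by linarith) (by linarith)
  refine ⟨C, by positivity, ?_⟩
  rintro α ψ ⟨hψs, -, hψ1, -⟩ u ⟨hus, hucs, -⟩
  have hud : ∀ z, DifferentiableAt ℝ u z := fun z => (hus.differentiable (by simp)) z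
  have hψd : ∀ z, DifferentiableAt ℝ ψ z := fun z => (hψs.differentiable (by simp)) z
  have huc : Continuous u := hus.continuous
  have hfu : Continuous (fderiv ℝ u) := hus.continuous_fderiv (by simp)
  have hfψ : Continuous (fderiv ℝ ψ) := hψs.continuous_fderiv (by simp)
  have hpX : ∀ i, Continuous (pXc u i) := fun i => hfu.clm_apply continuous_const
  have hpY : Continuous (pYc u) := hfu.clm_apply continuous_const
  have hsX : ∀ i, Continuous (pXr ψ i) := fun i => hfψ.clm_apply continuous_const
  have hsY : Continuous (pYr ψ) := hfψ.clm_apply continuous_const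
  have hu0 : ∀ z, z ∉ tsupport u → u z = 0 := fun z hz => image_eq_zero_of_notMem_tsupport hz
  have hd0 : ∀ z, z ∉ tsupport u → fderiv ℝ u z = 0 := fun z hz => by
    by_contra h
    exact hz (support_fderiv_subset ℝ h)
  have hX0 : ∀ i z, z ∉ tsupport u → pXc u i z = 0 := fun i z hz => by simp [pXc, hd0 z hz]
  have hY0 : ∀ z, z ∉ tsupport u → pYc u z = 0 := fun z hz => by simp [pYc, hd0 z hz]
  have hconj : Continuous (starRingEnd ℂ) := Complex.continuous_conj
  have hHSm : MeasurableSet (HS N) := measurableSet_lt measurable_const measurable_snd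
  -- the derivatives of the two arguments
  have hUX : ∀ β : ℝ, ∀ i, ∀ z ∈ HS N,
      pXc (fun z => (Real.exp (β * ψ z) : ℂ) * (φ z.2 : ℂ) * u z) i z =
      ((Real.exp (β * ψ z) * F z.2 : ℝ) : ℂ) *
        (pXc u i z + ((β * pXr ψ i z : ℝ) : ℂ) * u z) := by
    intro β i z hz
    obtain ⟨h1, h2⟩ := hFK z.2 hz
    have := deriv_prod β ψ u φ (F z.2) (K z.2) z (Pi.single i 1, 0) (hψd z) (hud z) h1 h2
    rw [pXc, this]
    simp [pXc, pXr]
  have hUY : ∀ β : ℝ, ∀ z ∈ HS N,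
      pYc (fun z => (Real.exp (β * ψ z) : ℂ) * (φ z.2 : ℂ) * u z) z =
      ((Real.exp (β * ψ z) * F z.2 : ℝ) : ℂ) *
        (pYc u z + ((β * pYr ψ z + K z.2 : ℝ) : ℂ) * u z) := by
    intro β z hz
    obtain ⟨h1, h2⟩ := hFK z.2 hz
    have := deriv_prod β ψ u φ (F z.2) (K z.2) z (0, 1) (hψd z) (hud z) h1 h2
    rw [pYc, this]
    simp [pYc, pYr]
  set H1 : ((Fin N → ℝ) × ℝ) → ℂ := fun z =>
    (∑ i, (pXc u i z + ((α * pXr ψ i z : ℝ) : ℂ) * u z) *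
      (starRingEnd ℂ) (pXc u i z + ((-α * pXr ψ i z : ℝ) : ℂ) * u z)) +
      (pYc u z + ((α * pYr ψ z + K z.2 : ℝ) : ℂ) * u z) *
      (starRingEnd ℂ) (pYc u z + ((-α * pYr ψ z + K z.2 : ℝ) : ℂ) * u z) with hH1
  set H2 : ((Fin N → ℝ) × ℝ) → ℂ := fun z =>
    (pYc u z + ((α * pYr ψ z + K z.2 : ℝ) : ℂ) * u z) *
      ∑ i, (a i : ℂ) * (starRingEnd ℂ) (pXc u i z + ((-α * pXr ψ i z : ℝ) : ℂ) * u z) with hH2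
  have hexp : ∀ z, Real.exp (α * ψ z) * Real.exp (-α * ψ z) = 1 := fun z => by
    rw [← Real.exp_add]; simp
  have hneg : (fun z => (Real.exp (-(α * ψ z)) : ℂ) * (φ z.2 : ℂ) * u z) =
      (fun z => (Real.exp (-α * ψ z) : ℂ) * (φ z.2 : ℂ) * u z) := by
    funext z; rw [neg_mul]
  have hprod : ∀ z, ∀ P Q : ℂ, (((Real.exp (α * ψ z) * F z.2 : ℝ) : ℂ) * P) *
      (starRingEnd ℂ) (((Real.exp (-α * ψ z) * F z.2 : ℝ) : ℂ) * Q) =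
      ((F z.2 ^ 2 : ℝ) : ℂ) * (P * (starRingEnd ℂ) Q) := by
    intro z P Q
    rw [map_mul, Complex.conj_ofReal]
    have : F z.2 ^ 2 = (Real.exp (α * ψ z) * F z.2) * (Real.exp (-α * ψ z) * F z.2) := by
      linear_combination (-(F z.2 ^ 2)) * hexp z
    rw [this]
    push_cast
    ring
  have I1 : ∫ z in HS N, ((∑ i,
      pXc (fun z => (Real.exp (α * ψ z) : ℂ) * (φ z.2 : ℂ) * u z) i z * (starRingEnd ℂ)
        (pXc (fun z => (Real.exp (-α * ψ z) : ℂ) * (φ z.2 : ℂ) * u z) i z)) +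
      pYc (fun z => (Real.exp (α * ψ z) : ℂ) * (φ z.2 : ℂ) * u z) z * (starRingEnd ℂ)
        (pYc (fun z => (Real.exp (-α * ψ z) : ℂ) * (φ z.2 : ℂ) * u z) z)) *
        ((z.2 ^ c : ℝ) : ℂ) =
      ∫ z in HS N, (z.2 ^ c) • (((F z.2 ^ 2 : ℝ) : ℂ) * H1 z) := by
    refine setIntegral_congr_fun hHSm (fun z hz => ?_)
    simp only [hUX _ _ z hz, hUY _ z hz, hprod]
    rw [← Finset.mul_sum, ← mul_add, Complex.real_smul, mul_comm]
  have I2 : ∫ z in HS N, (pYc (fun z => (Real.exp (α * ψ z) : ℂ) * (φ z.2 : ℂ) * u z) z *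
      ∑ i, (a i : ℂ) * (starRingEnd ℂ)
        (pXc (fun z => (Real.exp (-α * ψ z) : ℂ) * (φ z.2 : ℂ) * u z) i z)) *
        ((z.2 ^ c : ℝ) : ℂ) =
      ∫ z in HS N, (z.2 ^ c) • (((F z.2 ^ 2 : ℝ) : ℂ) * H2 z) := by
    refine setIntegral_congr_fun hHSm (fun z hz => ?_)
    simp only [hUX _ _ z hz, hUY _ z hz, hH2]
    rw [Complex.real_smul, mul_comm]
    congr 1
    rw [Finset.mul_sum, Finset.mul_sum, Finset.mul_sum]
    refine Finset.sum_congr rfl (fun i _ => ?_)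
    have := hprod z (pYc u z + ((α * pYr ψ z + K z.2 : ℝ) : ℂ) * u z)
      (pXc u i z + ((-α * pXr ψ i z : ℝ) : ℂ) * u z)
    linear_combination (a i : ℂ) * this
  have I3 : ∫ z in HS N, gradSqC u z * (φ z.2 ^ 2 * z.2 ^ c) =
      ∫ z in HS N, (z.2 ^ c) • (F z.2 ^ 2 * gradSqC u z) := by
    refine setIntegral_congr_fun hHSm (fun z hz => ?_)
    simp only [(hFK z.2 hz).1, smul_eq_mul]
    ring
  have I4 : ∫ z in HS N, ‖u z‖ ^ 2 * (φ z.2 ^ 2 * z.2 ^ c) =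
      ∫ z in HS N, (z.2 ^ c) • (F z.2 ^ 2 * ‖u z‖ ^ 2) := by
    refine setIntegral_congr_fun hHSm (fun z hz => ?_)
    simp only [(hFK z.2 hz).1, smul_eq_mul]
    ring
  have J1 := weight_int c hc (fun z : (Fin N → ℝ) × ℝ => ((F z.2 ^ 2 : ℝ) : ℂ) * H1 z)
    (by rw [hH1]; fun_prop)
    (HasCompactSupport.intro hucs (fun z hz => by
      simp [hH1, hu0 z hz, hY0 z hz, hX0 _ z hz]))
  have J2 := weight_int c hc (fun z : (Fin N → ℝ) × ℝ => ((F z.2 ^ 2 : ℝ) : ℂ) * H2 z)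
    (by rw [hH2]; fun_prop)
    (HasCompactSupport.intro hucs (fun z hz => by
      simp [hH2, hu0 z hz, hY0 z hz]))
  have J3 := weight_int c hc (fun z : (Fin N → ℝ) × ℝ => F z.2 ^ 2 * gradSqC u z)
    (by unfold gradSqC; fun_prop)
    (HasCompactSupport.intro hucs (fun z hz => by
      simp [gradSqC, hY0 z hz, hX0 _ z hz]))
  have J4 := weight_int c hc (fun z : (Fin N → ℝ) × ℝ => F z.2 ^ 2 * ‖u z‖ ^ 2)
    (by fun_prop)
    (HasCompactSupport.intro hucs (fun z hz => by
      simp [hu0 z hz]))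
  rw [hneg, aForm, I1, I2, I3, I4, Complex.add_re]
  have r2 : ∀ w : ℂ, (2 * w).re = 2 * w.re := fun w => by simp
  rw [r2]
  have K1 : (∫ z in HS N, (z.2 ^ c) • (((F z.2 ^ 2 : ℝ) : ℂ) * H1 z)).re =
      ∫ z in HS N, ((z.2 ^ c) • (((F z.2 ^ 2 : ℝ) : ℂ) * H1 z)).re :=
    (Complex.reCLM.integral_comp_comm J1).symm
  have K2 : (∫ z in HS N, (z.2 ^ c) • (((F z.2 ^ 2 : ℝ) : ℂ) * H2 z)).re =
      ∫ z in HS N, ((z.2 ^ c) • (((F z.2 ^ 2 : ℝ) : ℂ) * H2 z)).re :=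
    (Complex.reCLM.integral_comp_comm J2).symm
  have J1' : IntegrableOn (fun z => ((z.2 ^ c) • (((F z.2 ^ 2 : ℝ) : ℂ) * H1 z)).re) (HS N) :=
    Complex.reCLM.integrable_comp J1
  have J2' : IntegrableOn (fun z => ((z.2 ^ c) • (((F z.2 ^ 2 : ℝ) : ℂ) * H2 z)).re) (HS N) :=
    Complex.reCLM.integrable_comp J2
  rw [K1, K2, ← integral_const_mul, ← integral_const_mul, ← integral_const_mul,
    ← integral_sub (J3.const_mul _) (J4.const_mul _), ← integral_add J1' (J2'.const_mul _)]
  refine setIntegral_mono_on ((J3.const_mul _).sub (J4.const_mul _))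
    (J1'.add (J2'.const_mul _)) hHSm (fun z hz => ?_)
  have key := pointwise_ineq a A B ε hA ha hB hε₁ (fun i => pXc u i z) (pYc u z) (u z)
    (fun i => pXr ψ i z) (pYr ψ z) (K z.2) α (hψ1 z) (hKB z.2 hz)
  have hz' : 0 < z.2 := hz
  have hw : 0 ≤ z.2 ^ c * F z.2 ^ 2 := by positivity
  have key2 := mul_le_mul_of_nonneg_left key hw
  rw [Complex.smul_re, Complex.smul_re, Complex.re_ofReal_mul, Complex.re_ofReal_mul]
  simp only [smul_eq_mul]
  refine le_trans (le_of_eq ?_) (key2.trans (le_of_eq ?_))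
  · rw [gradSqC]; ring
  · simp only [hH1, hH2]; ring
end
end
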